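/- arXiv:0709.0170 — 6 statements merged into one kernel-verified Lean document; each statement's English description precedes it below -/
import Mathlib

section
/- Let G be an outerplanar graph with n vertices. Then fix(G) ≥ √(n/2). -/
/-- A straight-line drawing `δ` of a simple graph `G` is *plane* if it is injective,
no vertex image lies on the segment of an edge except as one of its endpoints, and
any two distinct edges intersect only in images of common endpoints. -/
def IsPlaneDrawing {V : Type*} (G : SimpleGraph V) (δ : V → ℝ × ℝ) : Prop :=
  Function.Injective δ ∧
  (∀ u v w : V, G.Adj u v → δ w ∈ segment ℝ (δ u) (δ v) → w = u ∨ w = v) ∧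
  (∀ u v a b : V, G.Adj u v → G.Adj a b → ({u, v} : Set V) ≠ ({a, b} : Set V) →
    ∀ p : ℝ × ℝ, p ∈ segment ℝ (δ u) (δ v) → p ∈ segment ℝ (δ a) (δ b) →
      ∃ w : V, (w = u ∨ w = v) ∧ (w = a ∨ w = b) ∧ p = δ w)

/-- A set of points is in *strictly convex position* if no point of it lies in the
convex hull of the others. -/
def StrictlyConvexPosition (s : Set (ℝ × ℝ)) : Prop :=
  ∀ p ∈ s, p ∉ convexHull ℝ (s \ {p})


/-- Two drawn segments meet only in common endpoints. -/
def GoodPair {V : Type*} (x y : V → ℝ) (u v a b : V) : Prop :=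
  ∀ p : ℝ × ℝ, p ∈ segment ℝ (x u, y u) (x v, y v) → p ∈ segment ℝ (x a, y a) (x b, y b) →
    ∃ w : V, (w = u ∨ w = v) ∧ (w = a ∨ w = b) ∧ p = (x w, y w)

lemma GoodPair.symm {V : Type*} {x y : V → ℝ} {u v a b : V} (h : GoodPair x y u v a b) :
    GoodPair x y a b u v := by
  intro p h1 h2
  obtain ⟨w, h3, h4, h5⟩ := h p h2 h1
  exact ⟨w, h4, h3, h5⟩

lemma GoodPair.swap {V : Type*} {x y : V → ℝ} {u v a b : V} (h : GoodPair x y u v a b) :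
    GoodPair x y v u a b := by
  intro p h1 h2
  rw [segment_symm] at h1
  obtain ⟨w, h3, h4, h5⟩ := h p h1 h2
  exact ⟨w, h3.symm, h4, h5⟩

lemma GoodPair.swap' {V : Type*} {x y : V → ℝ} {u v a b : V} (h : GoodPair x y u v a b) :
    GoodPair x y u v b a := h.symm.swap.symm

lemma seg_le {V : Type*} (x y : V → ℝ) (α β γ : ℝ) (u v : V) (p : ℝ × ℝ)
    (hp : p ∈ segment ℝ (x u, y u) (x v, y v))
    (hu : α * x u + β * y u + γ ≤ 0) (hv : α * x v + β * y v + γ ≤ 0) :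
    α * p.1 + β * p.2 + γ ≤ 0 := by
  obtain ⟨s, t, hs, ht, hst, rfl⟩ := hp
  simp only [Prod.smul_mk, Prod.mk_add_mk, smul_eq_mul]
  have hg : γ = (s + t) * γ := by rw [hst, one_mul]
  nlinarith [mul_nonneg hs (neg_nonneg.2 hu), mul_nonneg ht (neg_nonneg.2 hv)]

lemma seg_zero {V : Type*} (x y : V → ℝ) (α β γ : ℝ) (u v : V) (p : ℝ × ℝ)
    (hp : p ∈ segment ℝ (x u, y u) (x v, y v))
    (hu : α * x u + β * y u + γ ≤ 0) (hv : α * x v + β * y v + γ ≤ 0)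
    (hz : α * x u + β * y u + γ = 0 → α * x v + β * y v + γ = 0 → u = v)
    (h0 : 0 ≤ α * p.1 + β * p.2 + γ) :
    ∃ w, (w = u ∨ w = v) ∧ α * x w + β * y w + γ = 0 ∧ p = (x w, y w) := by
  obtain ⟨s, t, hs, ht, hst, rfl⟩ := hp
  simp only [Prod.smul_mk, Prod.mk_add_mk, smul_eq_mul] at h0 ⊢
  have hg : γ = (s + t) * γ := by rw [hst, one_mul]
  have e1 : s * (α * x u + β * y u + γ) = 0 := by
    nlinarith [mul_nonneg hs (neg_nonneg.2 hu), mul_nonneg ht (neg_nonneg.2 hv)]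
  have e2 : t * (α * x v + β * y v + γ) = 0 := by
    nlinarith [mul_nonneg hs (neg_nonneg.2 hu), mul_nonneg ht (neg_nonneg.2 hv)]
  rcases mul_eq_zero.1 e1 with h | h
  · have : t = 1 := by linarith
    subst h this
    exact ⟨v, Or.inr rfl, by simpa using e2, by simp⟩
  · rcases mul_eq_zero.1 e2 with h' | h'
    · have : s = 1 := by linarith
      subst h' this
      exact ⟨u, Or.inl rfl, h, by simp⟩
    · have := hz h h'
      subst this
      refine ⟨u, Or.inl rfl, h, ?_⟩
      rw [← add_mul, ← add_mul, hst]; simp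

lemma sep2 {V : Type*} (x y : V → ℝ) (α β γ : ℝ) (u v a b : V)
    (hu : α * x u + β * y u + γ ≤ 0) (hv : α * x v + β * y v + γ ≤ 0)
    (ha : 0 ≤ α * x a + β * y a + γ) (hb : 0 ≤ α * x b + β * y b + γ)
    (ha' : α * x a + β * y a + γ = 0 → a = u ∨ a = v)
    (hb' : α * x b + β * y b + γ = 0 → b = u ∨ b = v)
    (hz : α * x a + β * y a + γ = 0 → α * x b + β * y b + γ = 0 → a = b) :
    GoodPair x y u v a b := by
  intro p h1 h2
  have := seg_le x y α β γ u v p h1 hu hv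
  obtain ⟨w, hw, hw0, hp⟩ := seg_zero x y (-α) (-β) (-γ) a b p h2 (by linarith) (by linarith)
    (fun h h' => hz (by linarith) (by linarith)) (by linarith)
  refine ⟨w, ?_, hw, hp⟩
  rcases hw with rfl | rfl
  · exact ha' (by linarith)
  · exact hb' (by linarith)

lemma sep1 {V : Type*} (x y : V → ℝ) (hinj : ∀ u v, x u = x v → y u = y v → u = v)
    (α β γ : ℝ) (u v a b : V)
    (hu : α * x u + β * y u + γ ≤ 0) (hv : α * x v + β * y v + γ ≤ 0)
    (ha : 0 ≤ α * x a + β * y a + γ) (hb : 0 ≤ α * x b + β * y b + γ)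
    (hz' : α * x u + β * y u + γ = 0 → α * x v + β * y v + γ = 0 → u = v)
    (hz : α * x a + β * y a + γ = 0 → α * x b + β * y b + γ = 0 → a = b) :
    GoodPair x y u v a b := by
  intro p h1 h2
  have := seg_le x y α β γ u v p h1 hu hv
  obtain ⟨w, hw, hw0, hp⟩ := seg_zero x y (-α) (-β) (-γ) a b p h2 (by linarith) (by linarith)
    (fun h h' => hz (by linarith) (by linarith)) (by linarith)
  obtain ⟨w', hw', hw0', hp'⟩ := seg_zero x y α β γ u v p h1 hu hv hz' (by
    rw [hp]; simp only; linarith)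
  rw [hp, Prod.mk.injEq] at hp'
  have := hinj _ _ hp'.1 hp'.2
  subst this
  exact ⟨w, hw', hw, hp⟩

/-- Vertical separation at abscissa `c`. -/
lemma sepx {V : Type*} (x y : V → ℝ) (hinj : ∀ u v, x u = x v → y u = y v → u = v)
    (c : ℝ) (u v a b : V)
    (hu : x u ≤ c) (hv : x v ≤ c) (ha : c ≤ x a) (hb : c ≤ x b)
    (hz' : x u = c → x v = c → u = v)
    (hz : x a = c → x b = c → a = b) :
    GoodPair x y u v a b := by
  apply sep1 x y hinj 1 0 (-c) u v a b <;> try linarith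
  · intro h h'; exact hz' (by linarith) (by linarith)
  · intro h h'; exact hz (by linarith) (by linarith)

/-- Horizontal separation at ordinate `c`. -/
lemma sepy {V : Type*} (x y : V → ℝ) (hinj : ∀ u v, x u = x v → y u = y v → u = v)
    (c : ℝ) (u v a b : V)
    (hu : y u ≤ c) (hv : y v ≤ c) (ha : c ≤ y a) (hb : c ≤ y b)
    (hz' : y u = c → y v = c → u = v)
    (hz : y a = c → y b = c → a = b) :
    GoodPair x y u v a b := by
  apply sep1 x y hinj 0 1 (-c) u v a b <;> try linarith
  · intro h h'; exact hz' (by linarith) (by linarith)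
  · intro h h'; exact hz (by linarith) (by linarith)

/-- The data of a snake drawing of a layered graph. -/
structure Lay {V : Type*} (G : SimpleGraph V) (L : V → ℕ) (x y : V → ℝ) (s : ℕ → ℝ) (M : ℝ) :
    Prop where
  adj : ∀ u v, G.Adj u v → L u ≤ L v + 1
  hM : 0 ≤ M
  hs : ∀ k, s k = 1 ∨ s k = -1
  s2 : ∀ k, k % 2 = 1 → s (k + 2) = - s k
  xlt : ∀ u v, L u < L v → x u < x v
  xodd : ∀ u v, L u = L v → L u % 2 = 1 → x u = x v
  xeven : ∀ u v, L u = L v → L u % 2 = 0 → x u = x v → u = v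
  yodd : ∀ u v, L u = L v → L u % 2 = 1 → y u = y v → u = v
  lip : ∀ u v, L u % 2 = 0 → L v % 2 = 0 → u ≠ v → |y u - y v| < M * |x u - x v|
  steep : ∀ u v, L u % 2 = 1 → L v % 2 = 0 → M * |x u - x v| < s (L u) * (y u - y v)
  ceven : ∀ u v w, G.Adj u v → L u = L v → L u % 2 = 0 → L w = L u →
    (x w ≤ x u ∧ x w ≤ x v) ∨ (x u ≤ x w ∧ x v ≤ x w)
  codd : ∀ u v w, G.Adj u v → L u = L v → L u % 2 = 1 → L w = L u →
    (y w ≤ y u ∧ y w ≤ y v) ∨ (y u ≤ y w ∧ y v ≤ y w)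
  ncl : ∀ u v u' v', G.Adj u v → G.Adj u' v' → L u = L u' → L v = L v' → L u % 2 = 0 →
    L v = L u + 1 → x u < x u' → s (L v) * y v' ≤ s (L v) * y v
  ncr : ∀ u v u' v', G.Adj u v → G.Adj u' v' → L u = L u' → L v = L v' → L u % 2 = 0 →
    L v + 1 = L u → x u' < x u → s (L v) * y v' ≤ s (L v) * y v

section
variable {V : Type*} {G : SimpleGraph V} {L : V → ℕ} {x y : V → ℝ} {s : ℕ → ℝ} {M : ℝ}

lemma Lay.inj (h : Lay G L x y s M) : ∀ u v, x u = x v → y u = y v → u = v := by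
  intro u v h1 h2
  rcases lt_trichotomy (L u) (L v) with h3 | h3 | h3
  · have := h.xlt _ _ h3; linarith
  · rcases Nat.mod_two_eq_zero_or_one (L u) with h4 | h4
    · exact h.xeven _ _ h3 h4 h1
    · exact h.yodd _ _ h3 h4 h2
  · have := h.xlt _ _ h3; linarith

/-- even layer edge or vertex -/
def HA (L : V → ℕ) (x : V → ℝ) (u v : V) : Prop := L u = L v ∧ L u % 2 = 0 ∧
  ∀ w, L w = L u → (x w ≤ x u ∧ x w ≤ x v) ∨ (x u ≤ x w ∧ x v ≤ x w)

/-- odd layer edge or vertex -/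
def HB (L : V → ℕ) (y : V → ℝ) (u v : V) : Prop := L u = L v ∧ L u % 2 = 1 ∧
  ∀ w, L w = L u → (y w ≤ y u ∧ y w ≤ y v) ∨ (y u ≤ y w ∧ y v ≤ y w)

/-- interlayer edge, first endpoint in an even layer -/
def HC (G : SimpleGraph V) (L : V → ℕ) (u v : V) : Prop :=
  G.Adj u v ∧ L u % 2 = 0 ∧ (L v = L u + 1 ∨ L v + 1 = L u)

lemma interval_cases {x : V → ℝ} (u v a b : V) (hxx : ∀ w z, (w = u ∨ w = v) → (z = a ∨ z = b) → x w = x z → w = z)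
    (hne : ¬ (u = a ∧ v = b) ∧ ¬ (u = b ∧ v = a))
    (h1 : (x a ≤ x u ∧ x a ≤ x v) ∨ (x u ≤ x a ∧ x v ≤ x a))
    (h2 : (x b ≤ x u ∧ x b ≤ x v) ∨ (x u ≤ x b ∧ x v ≤ x b))
    (h3 : (x u ≤ x a ∧ x u ≤ x b) ∨ (x a ≤ x u ∧ x b ≤ x u))
    (h4 : (x v ≤ x a ∧ x v ≤ x b) ∨ (x a ≤ x v ∧ x b ≤ x v)) :
    (∃ c, x u ≤ c ∧ x v ≤ c ∧ c ≤ x a ∧ c ≤ x b) ∨ (∃ c, x a ≤ c ∧ x b ≤ c ∧ c ≤ x u ∧ c ≤ x v) := by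
  have k1 := hxx u a (by simp) (by simp)
  have k2 := hxx u b (by simp) (by simp)
  have k3 := hxx v a (by simp) (by simp)
  have k4 := hxx v b (by simp) (by simp)
  by_cases c1 : x u ≤ x a ∧ x u ≤ x b ∧ x v ≤ x a ∧ x v ≤ x b
  · left
    exact ⟨max (x u) (x v), le_max_left _ _, le_max_right _ _, max_le c1.1 c1.2.2.1,
      max_le c1.2.1 c1.2.2.2⟩
  by_cases c2 : x a ≤ x u ∧ x b ≤ x u ∧ x a ≤ x v ∧ x b ≤ x v
  · right
    exact ⟨max (x a) (x b), le_max_left _ _, le_max_right _ _, max_le c2.1 c2.2.1,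
      max_le c2.2.2.1 c2.2.2.2⟩
  exfalso
  grind

/-- strict vertical separation -/
lemma sepx_strict (x y : V → ℝ) (u v a b : V) (h1 : x u < x a) (h2 : x u < x b)
    (h3 : x v < x a) (h4 : x v < x b) : GoodPair x y u v a b := by
  intro p hp hp'
  have j1 := seg_le x y 1 0 (- max (x u) (x v)) u v p hp (by linarith [le_max_left (x u) (x v)])
    (by linarith [le_max_right (x u) (x v)])
  have j2 := seg_le x y (-1) 0 (min (x a) (x b)) a b p hp' (by linarith [min_le_left (x a) (x b)])
    (by linarith [min_le_right (x a) (x b)])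
  have : max (x u) (x v) < min (x a) (x b) := by
    rw [max_lt_iff, lt_min_iff, lt_min_iff]; exact ⟨⟨h1, h2⟩, h3, h4⟩
  linarith

lemma Lay.AA (h : Lay G L x y s M) (u v a b : V) (h1 : HA L x u v) (h2 : HA L x a b)
    (hne : ¬ (u = a ∧ v = b) ∧ ¬ (u = b ∧ v = a)) : GoodPair x y u v a b := by
  obtain ⟨e1, e2, e3⟩ := h1
  obtain ⟨f1, f2, f3⟩ := h2
  rcases lt_trichotomy (L u) (L a) with h3 | h3 | h3
  · have i1 := h.xlt u a h3
    have i2 := h.xlt u b (by omega)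
    have i3 := h.xlt v a (by omega)
    have i4 := h.xlt v b (by omega)
    exact sepx_strict x y u v a b i1 i2 i3 i4
  · have kx : ∀ w z, (w = u ∨ w = v) → (z = a ∨ z = b) → x w = x z → w = z := by
      intro w z hw hz hwz
      apply h.xeven _ _ _ _ hwz <;> grind
    have kuv := h.xeven u v e1 e2
    have kab := h.xeven a b f1 f2
    rcases interval_cases u v a b kx hne (e3 a (by omega)) (e3 b (by omega)) (f3 u (by omega))
      (f3 v (by omega)) with ⟨c, c1, c2, c3, c4⟩ | ⟨c, c1, c2, c3, c4⟩
    · apply sepx x y h.inj c <;> grind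
    · apply GoodPair.symm
      apply sepx x y h.inj c <;> grind
  · have i1 := h.xlt a u h3
    have i2 := h.xlt b u (by omega)
    have i3 := h.xlt a v (by omega)
    have i4 := h.xlt b v (by omega)
    apply GoodPair.symm
    exact sepx_strict x y a b u v i1 i3 i2 i4

lemma Lay.BB (h : Lay G L x y s M) (u v a b : V) (h1 : HB L y u v) (h2 : HB L y a b)
    (hne : ¬ (u = a ∧ v = b) ∧ ¬ (u = b ∧ v = a)) : GoodPair x y u v a b := by
  obtain ⟨e1, e2, e3⟩ := h1
  obtain ⟨f1, f2, f3⟩ := h2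
  rcases lt_trichotomy (L u) (L a) with h3 | h3 | h3
  · have i1 := h.xlt u a h3
    have i2 := h.xlt u b (by omega)
    have i3 := h.xlt v a (by omega)
    have i4 := h.xlt v b (by omega)
    intro p hp hp'
    have j1 := seg_le x y 1 0 (- x u) u v p hp (by linarith) (by linarith [h.xodd u v e1 e2])
    have j2 := seg_le x y (-1) 0 (x a) a b p hp' (by linarith) (by linarith [h.xodd a b f1 f2])
    linarith
  · have kx : ∀ w z, (w = u ∨ w = v) → (z = a ∨ z = b) → y w = y z → w = z := by
      intro w z hw hz hwz
      apply h.yodd _ _ _ _ hwz <;> grind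
    have kuv := h.yodd u v e1 e2
    have kab := h.yodd a b f1 f2
    rcases interval_cases u v a b kx hne (e3 a (by omega)) (e3 b (by omega)) (f3 u (by omega))
      (f3 v (by omega)) with ⟨c, c1, c2, c3, c4⟩ | ⟨c, c1, c2, c3, c4⟩
    · apply sepy x y h.inj c <;> grind
    · apply GoodPair.symm
      apply sepy x y h.inj c <;> grind
  · have i1 := h.xlt a u h3
    intro p hp hp'
    have j1 := seg_le x y (-1) 0 (x u) u v p hp (by linarith) (by linarith [h.xodd u v e1 e2])
    have j2 := seg_le x y (1) 0 (-x a) a b p hp' (by linarith) (by linarith [h.xodd a b f1 f2])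
    linarith

lemma Lay.AB (h : Lay G L x y s M) (u v a b : V) (h1 : HA L x u v) (h2 : HB L y a b) :
    GoodPair x y u v a b := by
  obtain ⟨e1, e2, e3⟩ := h1
  obtain ⟨f1, f2, f3⟩ := h2
  rcases lt_trichotomy (L u) (L a) with h3 | h3 | h3
  · apply sepx_strict <;> apply h.xlt <;> omega
  · omega
  · apply GoodPair.symm
    apply sepx_strict <;> apply h.xlt <;> omega

lemma Lay.AC (h : Lay G L x y s M) (u v a b : V) (h1 : HC G L u v) (h2 : HA L x a b) :
    GoodPair x y u v a b := by
  obtain ⟨e1, e2, e3⟩ := h1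
  obtain ⟨f1, f2, f3⟩ := h2
  rcases lt_trichotomy (L u) (L a) with h3 | h3 | h3
  · apply sepx_strict <;> apply h.xlt <;> omega
  · have hst := h.steep v u (by omega) (by omega)
    have la : a ≠ u → |y a - y u| < M * |x a - x u| := h.lip a u (by omega) (by omega)
    have lb : b ≠ u → |y b - y u| < M * |x b - x u| := h.lip b u (by omega) (by omega)
    have xa := h.xeven a u (by omega) (by omega)
    have xb := h.xeven b u (by omega) (by omega)
    rcases e3 with e3 | e3
    · have hxv := h.xlt u v (by omega)
      rcases f3 u (by omega) with ⟨c1, c2⟩ | ⟨c1, c2⟩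
      · have key : ∀ z, x u ≤ x z → (z ≠ u → |y z - y u| < M * |x z - x u|) →
            0 ≤ M * x z + (-s (L v)) * y z + (s (L v) * y u - M * x u) ∧
            (M * x z + (-s (L v)) * y z + (s (L v) * y u - M * x u) = 0 → z = u) := by
          intro z hz hl
          by_cases hzu : z = u
          · subst hzu
            exact ⟨by linarith, fun _ => rfl⟩
          · have := hl hzu
            rw [abs_of_nonneg (by linarith : 0 ≤ x z - x u), abs_lt] at this
            rcases h.hs (L v) with q | q <;> rw [q]
            · exact ⟨by linarith, fun _ => by linarith⟩
            · exact ⟨by linarith, fun _ => by linarith⟩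
        obtain ⟨ka, ka'⟩ := key a c1 la
        obtain ⟨kb, kb'⟩ := key b c2 lb
        rw [abs_of_nonneg (by linarith : 0 ≤ x v - x u)] at hst
        apply sep2 x y M (-s (L v)) (s (L v) * y u - M * x u) u v a b (by linarith) (by linarith)
          ka kb (fun q => Or.inl (ka' q)) (fun q => Or.inl (kb' q))
        intro q q'
        rw [ka' q, kb' q']
      · apply GoodPair.symm
        apply sepx x y h.inj (x u) <;> grind
    · have hxv := h.xlt v u (by omega)
      rcases f3 u (by omega) with ⟨c1, c2⟩ | ⟨c1, c2⟩
      · apply sepx x y h.inj (x u) <;> grind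
      · have key : ∀ z, x z ≤ x u → (z ≠ u → |y z - y u| < M * |x z - x u|) →
            0 ≤ (-M) * x z + (-s (L v)) * y z + (s (L v) * y u + M * x u) ∧
            ((-M) * x z + (-s (L v)) * y z + (s (L v) * y u + M * x u) = 0 → z = u) := by
          intro z hz hl
          by_cases hzu : z = u
          · subst hzu
            exact ⟨by linarith, fun _ => rfl⟩
          · have := hl hzu
            rw [abs_of_nonpos (by linarith : x z - x u ≤ 0), abs_lt] at this
            rcases h.hs (L v) with q | q <;> rw [q]
            · exact ⟨by linarith, fun _ => by linarith⟩
            · exact ⟨by linarith, fun _ => by linarith⟩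
        obtain ⟨ka, ka'⟩ := key a c1 la
        obtain ⟨kb, kb'⟩ := key b c2 lb
        rw [abs_of_nonpos (by linarith : x v - x u ≤ 0)] at hst
        apply sep2 x y (-M) (-s (L v)) (s (L v) * y u + M * x u) u v a b (by linarith) (by linarith)
          ka kb (fun q => Or.inl (ka' q)) (fun q => Or.inl (kb' q))
        intro q q'
        rw [ka' q, kb' q']
  · apply GoodPair.symm
    apply sepx_strict <;> apply h.xlt <;> omega

/-- separation by the line through `u` and `v`, with orientation factor `r` -/
lemma sep_line (x y : V → ℝ) (r : ℝ) (u v a b : V)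
    (ha : 0 ≤ r * ((y a - y v) * (x v - x u) - (y v - y u) * (x a - x v)))
    (hb : 0 ≤ r * ((y b - y v) * (x v - x u) - (y v - y u) * (x b - x v)))
    (ha' : r * ((y a - y v) * (x v - x u) - (y v - y u) * (x a - x v)) = 0 → a = u ∨ a = v)
    (hb' : r * ((y b - y v) * (x v - x u) - (y v - y u) * (x b - x v)) = 0 → b = u ∨ b = v)
    (hz : r * ((y a - y v) * (x v - x u) - (y v - y u) * (x a - x v)) = 0 →
      r * ((y b - y v) * (x v - x u) - (y v - y u) * (x b - x v)) = 0 → a = b) :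
    GoodPair x y u v a b := by
  have hh : ∀ z, (-r * (y v - y u)) * x z + (r * (x v - x u)) * y z +
      r * (-y v * (x v - x u) + (y v - y u) * x v) =
      r * ((y z - y v) * (x v - x u) - (y v - y u) * (x z - x v)) := by intro z; ring
  apply sep2 x y (-r * (y v - y u)) (r * (x v - x u))
    (r * (-y v * (x v - x u) + (y v - y u) * x v)) u v a b
  · rw [hh]; apply le_of_eq; ring
  · rw [hh]; apply le_of_eq; ring
  · rw [hh]; exact ha
  · rw [hh]; exact hb
  · rw [hh]; exact ha'
  · rw [hh]; exact hb'
  · rw [hh, hh]; exact hz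

lemma Lay.BC (h : Lay G L x y s M) (u v a b : V) (h1 : HC G L u v) (h2 : HB L y a b) :
    GoodPair x y u v a b := by
  obtain ⟨e1, e2, e3⟩ := h1
  obtain ⟨f1, f2, f3⟩ := h2
  rcases lt_trichotomy (L v) (L a) with h3 | h3 | h3
  · apply sepx_strict <;> apply h.xlt <;> omega
  · have hst := h.steep v u (by omega) (by omega)
    have hst' : 0 < s (L v) * (y v - y u) := lt_of_le_of_lt (mul_nonneg h.hM (abs_nonneg _)) hst
    have ya := h.yodd a v (by omega) (by omega)
    have yb := h.yodd b v (by omega) (by omega)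
    have xa := h.xodd a v (by omega) (by omega)
    have xb := h.xodd b v (by omega) (by omega)
    have hsplit : (0 ≤ s (L v) * (y a - y v) ∧ 0 ≤ s (L v) * (y b - y v)) ∨
        (0 ≤ -s (L v) * (y a - y v) ∧ 0 ≤ -s (L v) * (y b - y v)) := by
      rcases f3 v (by omega) with ⟨c1, c2⟩ | ⟨c1, c2⟩ <;> rcases h.hs (L v) with q | q <;> rw [q]
      · left; constructor <;> linarith
      · right; constructor <;> linarith
      · right; constructor <;> linarith
      · left; constructor <;> linarith
    have hs0 : s (L v) ≠ 0 := by rcases h.hs (L v) with q | q <;> rw [q] <;> norm_num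
    have ka : s (L v) * (y a - y v) = 0 → a = v := fun q =>
      ya (by rcases mul_eq_zero.1 q with q | q; exact absurd q hs0; linarith)
    have kb : s (L v) * (y b - y v) = 0 → b = v := fun q =>
      yb (by rcases mul_eq_zero.1 q with q | q; exact absurd q hs0; linarith)
    rcases hsplit with ⟨c1, c2⟩ | ⟨c1, c2⟩
    · apply sep2 x y 0 (s (L v)) (-(s (L v) * y v)) u v a b (by linarith) (by linarith)
        (by linarith) (by linarith)
        (fun q => Or.inr (ka (by linarith))) (fun q => Or.inr (kb (by linarith)))
      intro q q'
      rw [ka (by linarith), kb (by linarith)]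
    · have hx0 : ∃ r, r * (x v - x u) = - s (L v) := by
        have : x v - x u ≠ 0 := by
          rcases e3 with e3 | e3
          · have hxv := h.xlt u v (by omega)
            intro; linarith
          · have hxv := h.xlt v u (by omega)
            intro; linarith
        exact ⟨- s (L v) / (x v - x u), by field_simp⟩
      obtain ⟨r, hr⟩ := hx0
      have hA : r * ((y a - y v) * (x v - x u) - (y v - y u) * (x a - x v)) =
          - s (L v) * (y a - y v) := by rw [xa, ← hr]; ring
      have hB : r * ((y b - y v) * (x v - x u) - (y v - y u) * (x b - x v)) =
          - s (L v) * (y b - y v) := by rw [xb, ← hr]; ring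
      apply sep_line x y r u v a b
      · rw [hA]; exact c1
      · rw [hB]; exact c2
      · rw [hA]; exact fun q => Or.inr (ka (by linarith))
      · rw [hB]; exact fun q => Or.inr (kb (by linarith))
      · rw [hA, hB]
        intro q q'
        rw [ka (by linarith), kb (by linarith)]
  · apply GoodPair.symm
    apply sepx_strict <;> apply h.xlt <;> omega

lemma Lay.CC0 (h : Lay G L x y s M) (u v u' v' : V) (h1 : HC G L u v)
    (hu : L u = L u') (hv : L v = L v') (hne : ¬ (u = u' ∧ v = v'))
    (hy : s (L v) * y v' ≤ s (L v) * y v)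
    (ho : |x u' - x v| ≤ |x u - x v|) :
    GoodPair x y u v u' v' := by
  obtain ⟨e1, e2, e3⟩ := h1
  have hst := h.steep v u (by omega) (by omega)
  have yv := h.yodd v' v (by omega) (by omega)
  have xv := h.xodd v' v (by omega) (by omega)
  have xu := h.xeven u' u (by omega) (by omega)
  have lu : u' ≠ u → |y u' - y u| < M * |x u' - x u| := h.lip u' u (by omega) (by omega)
  have hs0 : s (L v) ≠ 0 := by rcases h.hs (L v) with q | q <;> rw [q] <;> norm_num
  have hdir : ∃ σ : ℝ, (σ = 1 ∨ σ = -1) ∧ 0 < σ * (x v - x u) ∧ 0 ≤ σ * (x u' - x u) := by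
    rcases e3 with e3 | e3
    · have := h.xlt u v (by omega)
      have := h.xlt u' v (by omega)
      rw [abs_of_neg (by linarith), abs_of_neg (by linarith)] at ho
      exact ⟨1, Or.inl rfl, by linarith, by linarith⟩
    · have := h.xlt v u (by omega)
      have := h.xlt v u' (by omega)
      rw [abs_of_pos (by linarith), abs_of_pos (by linarith)] at ho
      exact ⟨-1, Or.inr rfl, by linarith, by linarith⟩
  obtain ⟨σ, hσ, d1, d2⟩ := hdir
  have a1 : |x v - x u| = σ * (x v - x u) := by
    rcases hσ with rfl | rfl
    · rw [abs_of_pos (by linarith)]; ring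
    · rw [abs_of_neg (by linarith)]; ring
  have a2 : |x u' - x u| = σ * (x u' - x u) := by
    rcases hσ with rfl | rfl
    · rw [abs_of_nonneg (by linarith)]; ring
    · rw [abs_of_nonpos (by linarith)]; ring
  rw [a1] at hst
  rw [a2] at lu
  have hV : (-s (L v) * σ) * ((y v' - y v) * (x v - x u) - (y v - y u) * (x v' - x v)) =
      (σ * (x v - x u)) * (s (L v) * (y v - y v')) := by rw [xv]; ring
  have hU : (-s (L v) * σ) * ((y u' - y v) * (x v - x u) - (y v - y u) * (x u' - x v)) =
      (σ * (x u' - x u)) * (s (L v) * (y v - y u)) - s (L v) * (y u' - y u) * (σ * (x v - x u)) := by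
    ring
  have kV0 : 0 ≤ (σ * (x v - x u)) * (s (L v) * (y v - y v')) :=
    mul_nonneg d1.le (by linarith)
  have kV : (σ * (x v - x u)) * (s (L v) * (y v - y v')) = 0 → v' = v := by
    intro q
    rcases mul_eq_zero.1 q with q | q
    · linarith
    · rcases mul_eq_zero.1 q with q | q
      · exact absurd q hs0
      · exact yv (by linarith)
  have kU : u' ≠ u → 0 < (σ * (x u' - x u)) * (s (L v) * (y v - y u)) -
      s (L v) * (y u' - y u) * (σ * (x v - x u)) := by
    intro hn
    have l := lu hn
    have l2 : s (L v) * (y u' - y u) < M * (σ * (x u' - x u)) := by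
      rw [abs_lt] at l
      rcases h.hs (L v) with q | q <;> rw [q] <;> linarith
    have m1 := mul_le_mul_of_nonneg_left hst.le d2
    have m2 := mul_lt_mul_of_pos_right l2 d1
    linarith
  have kU0 : 0 ≤ (σ * (x u' - x u)) * (s (L v) * (y v - y u)) -
      s (L v) * (y u' - y u) * (σ * (x v - x u)) := by
    by_cases hn : u' = u
    · rw [hn]; apply le_of_eq; ring
    · exact (kU hn).le
  have kU' : (σ * (x u' - x u)) * (s (L v) * (y v - y u)) -
      s (L v) * (y u' - y u) * (σ * (x v - x u)) = 0 → u' = u := by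
    intro q
    by_contra hn
    have := kU hn
    linarith
  apply sep_line x y (-s (L v) * σ) u v u' v'
  · rw [hU]; exact kU0
  · rw [hV]; exact kV0
  · rw [hU]; exact fun q => Or.inl (kU' q)
  · rw [hV]; exact fun q => Or.inr (kV q)
  · rw [hU, hV]; exact fun q q' => absurd ⟨(kU' q).symm, (kV q').symm⟩ hne

lemma Lay.CC1 (h : Lay G L x y s M) (u v u' v' : V) (h1 : HC G L u v) (h2 : HC G L u' v')
    (hv : L v < L v') : GoodPair x y u v u' v' := by
  obtain ⟨e1, e2, e3⟩ := h1
  obtain ⟨f1, f2, f3⟩ := h2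
  by_cases hu : L u < L u'
  · apply sepx_strict <;> apply h.xlt <;> omega
  have x1 := h.xlt v u (by omega)
  have x2 := h.xlt v u' (by omega)
  have x3 := h.xlt u v' (by omega)
  have x4 := h.xlt u' v' (by omega)
  by_cases hx : x u ≤ x u'
  · apply sepx x y h.inj (x u) <;> grind
  push Not at hx
  have s1 := h.steep v u (by omega) (by omega)
  have s2 := h.steep v' u' (by omega) (by omega)
  have hss : s (L v') = - s (L v) := by
    rw [← h.s2 _ (by omega)]; congr 1; omega
  rw [hss, abs_of_pos (by linarith)] at s2
  rw [abs_of_neg (by linarith)] at s1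
  have hl := h.lip u u' (by omega) (by omega) (by rintro rfl; linarith)
  rw [abs_of_pos (by linarith : 0 < x u - x u'), abs_lt] at hl
  have hl1 : s (L v) * (y u - y u') < M * (x u - x u') := by
    rcases h.hs (L v) with q | q <;> rw [q] <;> linarith
  have hl2 : -(s (L v) * (y u - y u')) < M * (x u - x u') := by
    rcases h.hs (L v) with q | q <;> rw [q] <;> linarith
  have hd : 0 < x u - x u' := by linarith
  have hh : ∀ z, (s (L v) * (y u - y u')) * x z + (-s (L v) * (x u - x u')) * y z +
      s (L v) * (y u * (x u - x u') - (y u - y u') * x u) =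
      -(s (L v) * (y z - y u)) * (x u - x u') + (s (L v) * (y u - y u')) * (x z - x u) := by
    intro z; ring
  have hh' : ∀ z, (s (L v) * (y u - y u')) * x z + (-s (L v) * (x u - x u')) * y z +
      s (L v) * (y u * (x u - x u') - (y u - y u') * x u) =
      -(s (L v) * (y z - y u')) * (x u - x u') + (s (L v) * (y u - y u')) * (x z - x u') := by
    intro z; ring
  have g1 : -(s (L v) * (y v - y u)) * (x u - x u') + (s (L v) * (y u - y u')) * (x v - x u) < 0 := by
    have m1 := mul_lt_mul_of_pos_right s1 hd
    have m2 := mul_le_mul_of_nonneg_right hl2.le (by linarith : 0 ≤ x u - x v)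
    linarith
  have g2 : 0 < -(s (L v) * (y v' - y u')) * (x u - x u') +
      (s (L v) * (y u - y u')) * (x v' - x u') := by
    have m1 := mul_lt_mul_of_pos_right s2 hd
    have m2 := mul_le_mul_of_nonneg_right hl2.le (by linarith : 0 ≤ x v' - x u')
    linarith
  apply sep1 x y h.inj (s (L v) * (y u - y u')) (-s (L v) * (x u - x u'))
      (s (L v) * (y u * (x u - x u') - (y u - y u') * x u)) u v u' v'
  · rw [hh]; apply le_of_eq; ring
  · rw [hh]; exact g1.le
  · rw [hh']; apply le_of_eq; ring
  · rw [hh']; exact g2.le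
  · intro _; rw [hh]; intro q; linarith
  · intro _; rw [hh']; intro q; linarith

lemma Lay.CC (h : Lay G L x y s M) (u v u' v' : V) (h1 : HC G L u v) (h2 : HC G L u' v')
    (hne : ¬ (u = u' ∧ v = v')) : GoodPair x y u v u' v' := by
  rcases lt_trichotomy (L v) (L v') with hv | hv | hv
  · exact h.CC1 u v u' v' h1 h2 hv
  · obtain ⟨e1, e2, e3⟩ := id h1
    obtain ⟨f1, f2, f3⟩ := id h2
    have xvv := h.xodd v v' hv (by omega)
    have hne' : ¬ (u' = u ∧ v' = v) := fun q => hne ⟨q.1.symm, q.2.symm⟩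
    rcases lt_trichotomy (L u) (L u') with hu | hu | hu
    · have := h.xlt u v (by omega)
      have := h.xlt v u' (by omega)
      apply sepx x y h.inj (x v) <;> grind
    · rcases lt_trichotomy (x u) (x u') with hx | hx | hx
      · rcases e3 with e3 | e3
        · have i1 := h.xlt u v (by omega)
          have i2 := h.xlt u' v (by omega)
          apply h.CC0 u v u' v' h1 hu hv hne
          · exact h.ncl u v u' v' e1 f1 hu hv e2 e3 hx
          · rw [abs_of_neg (by linarith), abs_of_neg (by linarith)]; linarith
        · have i1 := h.xlt v u (by omega)
          have i2 := h.xlt v u' (by omega)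
          apply GoodPair.symm
          apply h.CC0 u' v' u v h2 hu.symm hv.symm hne'
          · exact h.ncr u' v' u v f1 e1 hu.symm hv.symm f2 (by omega) hx
          · rw [← xvv, abs_of_pos (by linarith), abs_of_pos (by linarith)]; linarith
      · rcases le_total (s (L v) * y v') (s (L v) * y v) with hy | hy
        · apply h.CC0 u v u' v' h1 hu hv hne hy
          rw [hx]
        · apply GoodPair.symm
          apply h.CC0 u' v' u v h2 hu.symm hv.symm hne' (by rw [← hv]; exact hy)
          rw [hx]
      · rcases e3 with e3 | e3
        · have i1 := h.xlt u v (by omega)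
          have i2 := h.xlt u' v (by omega)
          apply GoodPair.symm
          apply h.CC0 u' v' u v h2 hu.symm hv.symm hne'
          · exact h.ncl u' v' u v f1 e1 hu.symm hv.symm f2 (by omega) hx
          · rw [← xvv, abs_of_neg (by linarith), abs_of_neg (by linarith)]; linarith
        · have i1 := h.xlt v u (by omega)
          have i2 := h.xlt v u' (by omega)
          apply h.CC0 u v u' v' h1 hu hv hne
          · exact h.ncr u v u' v' e1 f1 hu hv e2 e3 hx
          · rw [abs_of_pos (by linarith), abs_of_pos (by linarith)]; linarith
    · have := h.xlt u' v (by omega)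
      have := h.xlt v u (by omega)
      apply GoodPair.symm
      apply sepx x y h.inj (x v) <;> grind
  · exact (h.CC1 u' v' u v h2 h1 hv).symm

lemma Lay.cases (h : Lay G L x y s M) (u v : V) (he : u = v ∨ G.Adj u v) :
    HA L x u v ∨ HB L y u v ∨ HC G L u v ∨ HC G L v u := by
  rcases he with rfl | he
  · rcases Nat.mod_two_eq_zero_or_one (L u) with h4 | h4
    · left
      refine ⟨rfl, h4, fun w _ => ?_⟩
      rcases le_total (x w) (x u) with q | q <;> simp [q]
    · right; left
      refine ⟨rfl, h4, fun w _ => ?_⟩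
      rcases le_total (y w) (y u) with q | q <;> simp [q]
  · have a1 := h.adj _ _ he
    have a2 := h.adj _ _ he.symm
    by_cases hl : L u = L v
    · rcases Nat.mod_two_eq_zero_or_one (L u) with h4 | h4
      · left
        exact ⟨hl, h4, fun w hw => h.ceven u v w he hl h4 hw⟩
      · right; left
        exact ⟨hl, h4, fun w hw => h.codd u v w he hl h4 hw⟩
    · right; right
      rcases Nat.mod_two_eq_zero_or_one (L u) with h4 | h4
      · left; exact ⟨he, h4, by omega⟩
      · right; exact ⟨he.symm, by omega, by omega⟩

lemma Lay.good (h : Lay G L x y s M) (u v a b : V) (he : u = v ∨ G.Adj u v)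
    (hf : a = b ∨ G.Adj a b) (hne : ¬ (u = a ∧ v = b) ∧ ¬ (u = b ∧ v = a)) :
    GoodPair x y u v a b := by
  rcases h.cases u v he with h1 | h1 | h1 | h1 <;> rcases h.cases a b hf with h2 | h2 | h2 | h2
  · exact h.AA _ _ _ _ h1 h2 hne
  · exact h.AB _ _ _ _ h1 h2
  · exact (h.AC _ _ _ _ h2 h1).symm
  · exact (h.AC _ _ _ _ h2 h1).symm.swap'
  · exact (h.AB _ _ _ _ h2 h1).symm
  · exact h.BB _ _ _ _ h1 h2 hne
  · exact (h.BC _ _ _ _ h2 h1).symm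
  · exact (h.BC _ _ _ _ h2 h1).symm.swap'
  · exact h.AC _ _ _ _ h1 h2
  · exact h.BC _ _ _ _ h1 h2
  · exact h.CC _ _ _ _ h1 h2 hne.1
  · exact (h.CC _ _ _ _ h1 h2 hne.2).swap'
  · exact (h.AC _ _ _ _ h1 h2).swap
  · exact (h.BC _ _ _ _ h1 h2).swap
  · exact (h.CC _ _ _ _ h1 h2 (fun q => hne.2 ⟨q.2, q.1⟩)).swap
  · exact (h.CC _ _ _ _ h1 h2 (fun q => hne.1 ⟨q.2, q.1⟩)).swap.swap'

theorem Lay.plane (h : Lay G L x y s M) : IsPlaneDrawing G (fun v => (x v, y v)) := by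
  refine ⟨?_, ?_, ?_⟩
  · intro u v huv
    rw [Prod.mk.injEq] at huv
    exact h.inj u v huv.1 huv.2
  · intro u v w he hw
    by_contra hn
    push Not at hn
    obtain ⟨z, hz, hz', -⟩ := h.good u v w w (Or.inr he) (Or.inl rfl)
      ⟨fun q => hn.1 q.1.symm, fun q => hn.1 q.1.symm⟩ _ hw (by simp)
    grind
  · intro u v a b he hf hne p hp hp'
    refine h.good u v a b (Or.inr he) (Or.inr hf) ⟨?_, ?_⟩ p hp hp'
    · rintro ⟨rfl, rfl⟩; exact hne rfl
    · rintro ⟨rfl, rfl⟩; exact hne (Set.pair_comm _ _)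

end

lemma exists_layering {V : Type*} [LinearOrder V] [Fintype V] (G : SimpleGraph V)
    (hnc : ∀ a b c d : V, a < b → b < c → c < d → G.Adj a c → G.Adj b d → False) :
    ∃ L : V → ℕ, (∀ u v, G.Adj u v → L u ≤ L v + 1) ∧
      (∀ u v w, G.Adj u v → u < w → w < v → L u = L v → L w ≠ L u) ∧
      (∀ u v u' v', G.Adj u v → G.Adj u' v' → L u = L u' → L v = L u + 1 → L v' = L v →
        u < u' → v ≤ v') := by
  classical
  rcases isEmpty_or_nonempty V with hV | hV
  · exact ⟨fun _ => 0, fun u => hV.elim u, fun u => hV.elim u, fun u => hV.elim u⟩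
  let _ : LocallyFiniteOrder V := Fintype.toLocallyFiniteOrder
  let _ : SuccOrder V := LinearLocallyFiniteOrder.succOrder V
  have hpre : (SimpleGraph.hasse V).Preconnected := SimpleGraph.hasse_preconnected_of_succ V
  obtain ⟨m, hm⟩ := Finite.exists_min (id : V → V)
  simp only [id] at hm
  set H : SimpleGraph V := G ⊔ SimpleGraph.hasse V with hH
  have hGH : ∀ u v, G.Adj u v → H.Adj u v := fun u v h => Or.inl h
  have hconn : H.Connected := ⟨hpre.mono le_sup_right⟩
  have hnc' : ∀ a b c d : V, a < b → b < c → c < d → H.Adj a c → H.Adj b d → False := by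
    intro a b c d h1 h2 h3 h4 h5
    rcases h4 with h4 | h4
    · rcases h5 with h5 | h5
      · exact hnc a b c d h1 h2 h3 h4 h5
      · rw [SimpleGraph.hasse_adj] at h5
        rcases h5 with h5 | h5
        · exact h5.2 h2 h3
        · exact absurd h5.1 (not_lt.2 (h2.trans h3).le)
    · rw [SimpleGraph.hasse_adj] at h4
      rcases h4 with h4 | h4
      · exact h4.2 h1 h2
      · exact absurd h4.1 (not_lt.2 (h1.trans h2).le)
  have hstep : ∀ u v, H.Adj u v → H.dist m u ≤ H.dist m v + 1 := by
    intro u v h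
    have h1 := hconn.dist_triangle (u := m) (v := v) (w := u)
    have h2 := SimpleGraph.dist_eq_one_iff_adj.2 h.symm
    omega
  have hpred : ∀ w, w ≠ m → ∃ w', H.Adj w' w ∧ H.dist m w = H.dist m w' + 1 := by
    intro w hw
    obtain ⟨p, hp⟩ := hconn.exists_walk_length_eq_dist w m
    cases p with
    | nil => exact absurd rfl hw
    | cons h q =>
      rename_i w'
      refine ⟨w', h.symm, ?_⟩
      have h1 := SimpleGraph.dist_le q
      have h2 := hstep w w' h
      rw [SimpleGraph.Walk.length_cons] at hp
      rw [SimpleGraph.dist_comm] at hp h1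
      omega
  have hkey : ∀ n, ∀ a b w, H.dist m w = n → H.Adj a b → a < w → w < b →
      min (H.dist m a) (H.dist m b) < H.dist m w := by
    intro n
    induction n with
    | zero =>
      intro a b w h0 _ h1 _
      have := hconn.dist_eq_zero_iff.1 h0
      exact absurd (hm a) (not_le.2 (this ▸ h1))
    | succ n ih =>
      intro a b w h0 hab h1 h2
      have hwm : w ≠ m := by
        rintro rfl
        exact absurd (hm a) (not_le.2 h1)
      obtain ⟨w', hw', hd⟩ := hpred w hwm
      rcases lt_trichotomy w' a with h3 | h3 | h3
      · exact (hnc' w' a w b h3 h1 h2 hw' hab).elim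
      · subst h3; omega
      · rcases lt_trichotomy w' b with h4 | h4 | h4
        · have := ih a b w' (by omega) hab h3 h4
          omega
        · subst h4; omega
        · exact (hnc' a w b w' h1 h2 h4 hab hw'.symm).elim
  refine ⟨fun v => H.dist m v, fun u v h => hstep u v (hGH _ _ h), ?_, ?_⟩
  · intro u v w h h1 h2 h3 h4
    have := hkey _ u v w rfl (hGH _ _ h) h1 h2
    simp only at h3 h4
    omega
  · intro u v u' v' h h' h1 h2 h3 h4
    simp only at h1 h2 h3
    by_contra hlt
    push Not at hlt
    have A := hGH _ _ h
    have A' := hGH _ _ h'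
    have huv : u ≠ v := A.ne
    have huv' : u' ≠ v' := A'.ne
    have n1 : u ≠ v' := by rintro rfl; omega
    have n2 : u' ≠ v := by rintro rfl; omega
    rcases lt_or_gt_of_ne huv with a1 | a1
    · rcases lt_or_gt_of_ne n2 with a2 | a2
      · have := hkey _ u v u' rfl A h4 a2
        omega
      · rcases lt_or_gt_of_ne n1 with a3 | a3
        · exact hnc' u v' v u' a3 hlt a2 A A'.symm
        · have := hkey _ v' u' u rfl A'.symm a3 h4
          omega
    · have := hkey _ v' u' u rfl A'.symm (hlt.trans a1) h4
      omega

lemma exists_height {V : Type*} (R : V → V → Prop)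
    (htr : ∀ a b c, R a b → R b c → R a c) (hirr : ∀ a, ¬ R a a) (S : Finset V) :
    ∃ h : V → ℕ, (∀ u ∈ S, ∀ v ∈ S, R u v → h u < h v) ∧
      ∀ v ∈ S, 1 ≤ h v ∧ ∃ T ⊆ S, T.card = h v ∧ ∀ a ∈ T, ∀ b ∈ T, a ≠ b → R a b ∨ R b a := by
  classical
  let F : V → Finset (Finset V) := fun v => S.powerset.filter (fun T =>
    (∀ a ∈ T, ∀ b ∈ T, a ≠ b → R a b ∨ R b a) ∧ v ∈ T ∧ ∀ w ∈ T, w ≠ v → R w v)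
  have hF : ∀ v T, T ∈ F v ↔ T ⊆ S ∧ (∀ a ∈ T, ∀ b ∈ T, a ≠ b → R a b ∨ R b a) ∧ v ∈ T ∧
    ∀ w ∈ T, w ≠ v → R w v := by
    intro v T
    simp only [F, Finset.mem_filter, Finset.mem_powerset]
  have hne : ∀ v ∈ S, {v} ∈ F v := by
    intro v hv
    rw [hF]
    refine ⟨by simpa using hv, ?_, by simp, ?_⟩
    · intro a ha b hb hab
      simp only [Finset.mem_singleton] at ha hb
      exact absurd (ha.trans hb.symm) hab
    · intro w hw hwv
      exact absurd (Finset.mem_singleton.1 hw) hwv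
  have hmax : ∀ v ∈ S, ∃ T ∈ F v, (F v).sup Finset.card = T.card := by
    intro v hv
    exact Finset.exists_mem_eq_sup _ ⟨_, hne v hv⟩ _
  refine ⟨fun v => (F v).sup Finset.card, ?_, ?_⟩
  · intro u hu v hv huv
    obtain ⟨T, hT, hTc⟩ := hmax u hu
    simp only
    rw [hTc]
    rw [hF] at hT
    obtain ⟨t1, t2, t3, t4⟩ := hT
    have hall : ∀ w ∈ T, R w v := by
      intro w hw
      by_cases hwu : w = u
      · rw [hwu]; exact huv
      · exact htr _ _ _ (t4 w hw hwu) huv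
    have hvT : v ∉ T := fun hh => hirr v (hall v hh)
    have : insert v T ∈ F v := by
      rw [hF]
      refine ⟨Finset.insert_subset hv t1, ?_, by simp, ?_⟩
      · intro a ha b hb hab
        rcases Finset.mem_insert.1 ha with ha1 | ha1
        · rcases Finset.mem_insert.1 hb with hb1 | hb1
          · exact absurd (ha1.trans hb1.symm) hab
          · rw [ha1]; exact Or.inr (hall _ hb1)
        · rcases Finset.mem_insert.1 hb with hb1 | hb1
          · rw [hb1]; exact Or.inl (hall _ ha1)
          · exact t2 a ha1 b hb1 hab
      · intro w hw hwv
        rcases Finset.mem_insert.1 hw with rfl | hw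
        · exact absurd rfl hwv
        · exact hall w hw
    have := Finset.le_sup (f := Finset.card) this
    rw [Finset.card_insert_of_notMem hvT] at this
    omega
  · intro v hv
    refine ⟨?_, ?_⟩
    · have := Finset.le_sup (f := Finset.card) (hne v hv)
      simpa using this
    · obtain ⟨T, hT, hTc⟩ := hmax v hv
      rw [hF] at hT
      exact ⟨T, hT.1, hTc.symm, hT.2.1⟩

lemma exists_monotone_subset {V K : Type*} [LinearOrder K] (κ : V → K) (f : V → ℝ) (S : Finset V)
    (hκ : ∀ u ∈ S, ∀ v ∈ S, κ u = κ v → u = v) (hf : Function.Injective f) :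
    ∃ T ⊆ S, S.card ≤ T.card ^ 2 ∧ ((∀ u ∈ T, ∀ v ∈ T, κ u < κ v → f u < f v) ∨
      (∀ u ∈ T, ∀ v ∈ T, κ u < κ v → f v < f u)) := by
  classical
  by_contra hcon
  push Not at hcon
  have hS : 0 < S.card := by
    by_contra h0
    have := hcon ∅ (by simp) (by simp; simpa using h0)
    simp at this
  obtain ⟨h1, hm1, hc1⟩ := exists_height (fun a b => κ a < κ b ∧ f a < f b)
    (fun a b c p q => ⟨p.1.trans q.1, p.2.trans q.2⟩) (fun a p => lt_irrefl _ p.1) S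
  obtain ⟨h2, hm2, hc2⟩ := exists_height (fun a b => κ a < κ b ∧ f b < f a)
    (fun a b c p q => ⟨p.1.trans q.1, q.2.trans p.2⟩) (fun a p => lt_irrefl _ p.1) S
  have b1 : ∀ v ∈ S, h1 v ≤ Nat.sqrt (S.card - 1) := by
    intro v hv
    obtain ⟨_, T, hT, hTc, hT'⟩ := hc1 v hv
    rw [Nat.le_sqrt', ← hTc]
    by_contra hlt
    obtain ⟨⟨u, hu, w, hw, q1, q2⟩, -⟩ := hcon T hT (by omega)
    have := hT' u hu w hw (by rintro rfl; exact lt_irrefl _ q1)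
    rcases this with q | q
    · exact absurd q.2 (not_lt.2 q2)
    · exact absurd q.1 (not_lt.2 q1.le)
  have b2 : ∀ v ∈ S, h2 v ≤ Nat.sqrt (S.card - 1) := by
    intro v hv
    obtain ⟨_, T, hT, hTc, hT'⟩ := hc2 v hv
    rw [Nat.le_sqrt', ← hTc]
    by_contra hlt
    obtain ⟨-, u, hu, w, hw, q1, q2⟩ := hcon T hT (by omega)
    have := hT' u hu w hw (by rintro rfl; exact lt_irrefl _ q1)
    rcases this with q | q
    · exact absurd q.2 (not_lt.2 q2)
    · exact absurd q.1 (not_lt.2 q1.le)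
  have hcard : S.card ≤ (Finset.Icc 1 (Nat.sqrt (S.card - 1)) ×ˢ
      Finset.Icc 1 (Nat.sqrt (S.card - 1))).card := by
    apply Finset.card_le_card_of_injOn (fun v => (h1 v, h2 v))
    · intro v hv
      have hv' : v ∈ S := hv
      have := b1 v hv'
      have := b2 v hv'
      have := (hc1 v hv').1
      have := (hc2 v hv').1
      simp only [Finset.coe_product, Set.mem_prod, Finset.mem_coe, Finset.mem_Icc]
      omega
    · intro u hu v hv huv
      have hu' : u ∈ S := hu
      have hv' : v ∈ S := hv
      simp only [Prod.mk.injEq] at huv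
      by_contra hne
      have k1 : κ u ≠ κ v := fun q => hne (hκ u hu' v hv' q)
      have k2 : f u ≠ f v := fun q => hne (hf q)
      rcases lt_or_gt_of_ne k1 with k1 | k1 <;> rcases lt_or_gt_of_ne k2 with k2 | k2
      · have := hm1 u hu' v hv' ⟨k1, k2⟩; omega
      · have := hm2 u hu' v hv' ⟨k1, k2⟩; omega
      · have := hm2 v hv' u hu' ⟨k1, k2⟩; omega
      · have := hm1 v hv' u hu' ⟨k1, k2⟩; omega
  rw [Finset.card_product, Nat.card_Icc] at hcard
  have := Nat.sqrt_le (S.card - 1)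
  simp only [Nat.add_sub_cancel] at hcard
  omega

lemma extend_mono {K : Type*} [LinearOrder K] (A : Finset K) (g : K → ℝ)
    (hg : ∀ a ∈ A, ∀ b ∈ A, a < b → g a < g b) (B : Finset K) :
    ∃ h : K → ℝ, (∀ a ∈ A, h a = g a) ∧ ∀ a ∈ A ∪ B, ∀ b ∈ A ∪ B, a < b → h a < h b := by
  classical
  induction B using Finset.induction_on with
  | empty => exact ⟨g, fun _ _ => rfl, by simpa using hg⟩
  | insert c B hc ih =>
    obtain ⟨h, h1, h2⟩ := ih
    by_cases hcA : c ∈ A ∪ B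
    · refine ⟨h, h1, ?_⟩
      rwa [Finset.union_insert, Finset.insert_eq_of_mem hcA]
    · obtain ⟨m, m1, m2⟩ := Order.exists_between_finsets
        (((A ∪ B).filter (· < c)).image h) (((A ∪ B).filter (c < ·)).image h) (by
          intro x hx y hy
          simp only [Finset.mem_image, Finset.mem_filter] at hx hy
          obtain ⟨a, ⟨ha, ha'⟩, rfl⟩ := hx
          obtain ⟨b, ⟨hb, hb'⟩, rfl⟩ := hy
          exact h2 a ha b hb (ha'.trans hb'))
      refine ⟨Function.update h c m, ?_, ?_⟩
      · intro a ha
        rw [Function.update_of_ne, h1 a ha]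
        rintro rfl
        exact hcA (Finset.mem_union_left _ ha)
      · rw [Finset.union_insert]
        intro a ha b hb hab
        rcases Finset.mem_insert.1 ha with ha1 | ha1 <;> rcases Finset.mem_insert.1 hb with hb1 | hb1
        · exact absurd hab (by rw [ha1, hb1]; exact lt_irrefl _)
        · subst ha1
          rw [Function.update_self, Function.update_of_ne hab.ne']
          apply m2
          simp only [Finset.mem_image, Finset.mem_filter]
          exact ⟨b, ⟨hb1, hab⟩, rfl⟩
        · subst hb1
          rw [Function.update_self, Function.update_of_ne hab.ne]
          apply m1
          simp only [Finset.mem_image, Finset.mem_filter]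
          exact ⟨a, ⟨ha1, hab⟩, rfl⟩
        · rw [Function.update_of_ne, Function.update_of_ne]
          · exact h2 a ha1 b hb1 hab
          · rintro rfl; exact hcA hb1
          · rintro rfl; exact hcA ha1

lemma exists_positions {V K : Type*} [Fintype V] [LinearOrder K] (κ : V → K) (f : V → ℝ)
    (T : Finset V) (hκ : ∀ u ∈ T, ∀ v ∈ T, κ u = κ v → u = v)
    (hf : ∀ u ∈ T, ∀ v ∈ T, κ u < κ v → f u < f v) :
    ∃ x : V → ℝ, (∀ u v, κ u < κ v → x u < x v) ∧ (∀ u v, κ u = κ v → x u = x v) ∧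
      ∀ v ∈ T, x v = f v := by
  classical
  have hg : ∃ g : K → ℝ, ∀ v ∈ T, g (κ v) = f v := by
    refine ⟨fun k => if h : ∃ v ∈ T, κ v = k then f h.choose else 0, ?_⟩
    intro v hv
    have hex : ∃ w ∈ T, κ w = κ v := ⟨v, hv, rfl⟩
    simp only
    rw [dif_pos hex]
    rw [hκ _ hex.choose_spec.1 v hv hex.choose_spec.2]
  obtain ⟨g, hg⟩ := hg
  obtain ⟨h, h1, h2⟩ := extend_mono (T.image κ) g (by
    intro a ha b hb hab
    simp only [Finset.mem_image] at ha hb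
    obtain ⟨u, hu, rfl⟩ := ha
    obtain ⟨v, hv, rfl⟩ := hb
    rw [hg u hu, hg v hv]
    exact hf u hu v hv hab) (Finset.univ.image κ)
  refine ⟨fun v => h (κ v), ?_, ?_, ?_⟩
  · intro u v huv
    exact h2 _ (Finset.mem_union_right _ (Finset.mem_image_of_mem _ (Finset.mem_univ _))) _
      (Finset.mem_union_right _ (Finset.mem_image_of_mem _ (Finset.mem_univ _))) huv
  · intro u v huv
    simp only [huv]
  · intro v hv
    simp only
    rw [h1 _ (Finset.mem_image_of_mem _ hv), hg v hv]

lemma exists_generic {V : Type*} [Fintype V] (δ : V → ℝ × ℝ) (hδ : Function.Injective δ) :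
    ∃ t : ℝ, Function.Injective (fun v => (δ v).1 + t * (δ v).2) := by
  classical
  obtain ⟨t, ht⟩ := (Set.finite_range (fun q : V × V =>
    ((δ q.1).1 - (δ q.2).1) / ((δ q.2).2 - (δ q.1).2))).exists_notMem
  refine ⟨t, fun u v huv => ?_⟩
  simp only at huv
  by_cases h : (δ v).2 - (δ u).2 = 0
  · apply hδ
    have h2 : (δ u).2 = (δ v).2 := by linarith
    rw [h2] at huv
    exact Prod.ext (by linarith) h2
  · exfalso
    apply ht
    refine ⟨(u, v), ?_⟩
    simp only
    field_simp
    linarith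

/-- orientation determinant -/
def ori (a b c : ℝ × ℝ) : ℝ := (b.1 - a.1) * (c.2 - a.2) - (b.2 - a.2) * (c.1 - a.1)

lemma hull_contra {V : Type*} (δ : V → ℝ × ℝ) (hδ : Function.Injective δ)
    (hc : StrictlyConvexPosition (Set.range δ)) (p a c b : V) (w1 w2 w3 : ℝ)
    (h1 : 0 ≤ w1) (h2 : 0 ≤ w2) (h3 : 0 ≤ w3) (hs : w1 + w2 + w3 = 1)
    (hp : p ≠ b) (ha : a ≠ b) (hcb : c ≠ b)
    (e1 : (δ b).1 = w1 * (δ p).1 + w2 * (δ a).1 + w3 * (δ c).1)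
    (e2 : (δ b).2 = w1 * (δ p).2 + w2 * (δ a).2 + w3 * (δ c).2) : False := by
  apply hc (δ b) ⟨b, rfl⟩
  have hm : ∀ z, z ≠ b → δ z ∈ convexHull ℝ (Set.range δ \ {δ b}) := fun z hz =>
    subset_convexHull _ _ ⟨⟨z, rfl⟩, fun h => hz (hδ h)⟩
  have hcv := convex_convexHull ℝ (Set.range δ \ {δ b})
  have : δ b = w1 • δ p + w2 • δ a + w3 • δ c := by
    ext
    · simp [e1]
    · simp [e2]
  have key := hcv.sum_mem (t := Finset.univ) (w := ![w1, w2, w3]) (z := ![δ p, δ a, δ c])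
    (by intro i _; fin_cases i <;> simp [h1, h2, h3])
    (by simp [Fin.sum_univ_three, hs])
    (by intro i _; fin_cases i <;> simp [hm _ hp, hm _ ha, hm _ hcb])
  have key' : w1 • δ p + w2 • δ a + w3 • δ c ∈ convexHull ℝ (Set.range δ \ {δ b}) := by
    simpa [Fin.sum_univ_three] using key
  rwa [← this] at key'

lemma convex_order {V : Type*} [Fintype V] (G : SimpleGraph V) (δ : V → ℝ × ℝ)
    (hpl : IsPlaneDrawing G δ) (hc : StrictlyConvexPosition (Set.range δ)) :
    ∃ f : V → ℝ, Function.Injective f ∧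
      ∀ a b c d, f a < f b → f b < f c → f c < f d → G.Adj a c → G.Adj b d → False := by
  classical
  rcases isEmpty_or_nonempty V with hV | hV
  · exact ⟨fun _ => 0, fun u => hV.elim u, fun u => hV.elim u⟩
  have hδ := hpl.1
  obtain ⟨t, ht⟩ := exists_generic δ hδ
  set φ : V → ℝ := fun v => (δ v).1 + t * (δ v).2 with hφ
  have hφv : ∀ v, φ v = (δ v).1 + t * (δ v).2 := fun _ => rfl
  obtain ⟨p, hp⟩ := Finite.exists_min φ
  have hpos : ∀ v, v ≠ p → 0 < φ v - φ p := by
    intro v hv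
    have := hp v
    have : φ v ≠ φ p := fun q => hv (ht q)
    rcases lt_or_gt_of_ne this with q | q <;> linarith
  let g : V → ℝ := fun v => ((δ v).2 - (δ p).2) / (φ v - φ p)
  have hg : ∀ v, v ≠ p → (δ v).2 = (δ p).2 + g v * (φ v - φ p) := by
    intro v hv
    have := (hpos v hv).ne'
    simp only [g]
    field_simp
    ring
  obtain ⟨m, hm⟩ := Finite.exists_min g
  let f : V → ℝ := fun v => if v = p then g m - 1 else g v
  have hfp : f p = g m - 1 := by simp [f]
  have hfv : ∀ v, v ≠ p → f v = g v := fun v hv => by simp [f, hv]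
  have hgi : ∀ a b, a ≠ p → b ≠ p → g a = g b → φ a < φ b → False := by
    intro a b ha hb hab hlt
    have pa := hpos a ha
    have pb := hpos b hb
    have hw : ∃ w, 0 ≤ w ∧ w ≤ 1 ∧ w * (φ b - φ p) = φ a - φ p :=
      ⟨(φ a - φ p) / (φ b - φ p), by positivity, by rw [div_le_one pb]; linarith,
        by field_simp⟩
    obtain ⟨w, w0, w1, we⟩ := hw
    have s2 : (δ a).2 = (1 - w) * (δ p).2 + w * (δ b).2 := by
      rw [hg a ha, hg b hb, hab, ← we]; ring
    refine hull_contra δ hδ hc p b b a (1 - w) w 0 (by linarith) w0 le_rfl (by ring) ha.symm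
      (by rintro rfl; exact lt_irrefl _ hlt) (by rintro rfl; exact lt_irrefl _ hlt) ?_ ?_
    · have h1 := hφv a
      have h2 := hφv b
      have h3 := hφv p
      have : (δ a).1 = φ a - t * (δ a).2 := by linarith
      rw [this, s2]
      have e : φ a = (1 - w) * φ p + w * φ b := by linarith
      rw [e, h2, h3]; ring
    · rw [s2]; ring
  have hdet : ∀ a b, a ≠ p → b ≠ p → g a < g b → 0 < ori (δ p) (δ a) (δ b) := by
    intro a b ha hb hab
    have pa := hpos a ha
    have pb := hpos b hb
    have : ori (δ p) (δ a) (δ b) = (φ a - φ p) * (φ b - φ p) * (g b - g a) := by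
      have e1 : (φ a - φ p) * (φ b - φ p) * (g b - g a) =
          (φ a - φ p) * ((δ b).2 - (δ p).2) - (φ b - φ p) * ((δ a).2 - (δ p).2) := by
        rw [hg a ha, hg b hb]; ring
      rw [e1, hφv, hφv, hφv, ori]; ring
    rw [this]
    exact mul_pos (mul_pos pa pb) (by linarith)
  have hnp : ∀ a b, f a < f b → b ≠ p := by
    rintro a b hab rfl
    rw [hfp] at hab
    by_cases ha : a = b
    · rw [ha, hfp] at hab; linarith
    · rw [hfv a ha] at hab
      have := hm a
      linarith
  have htri : ∀ a b c, f a < f b → f b < f c → 0 < ori (δ a) (δ b) (δ c) := by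
    intro a b c hab hbc
    have hb := hnp a b hab
    have hcp := hnp b c hbc
    by_cases ha : a = p
    · subst ha
      apply hdet b c hb hcp
      rwa [hfv b hb, hfv c hcp] at hbc
    · rw [hfv a ha, hfv b hb] at hab
      rw [hfv b hb, hfv c hcp] at hbc
      by_contra hneg
      push Not at hneg
      have o1 := hdet a b ha hb hab
      have o2 := hdet b c hb hcp hbc
      have o3 := hdet a c ha hcp (hab.trans hbc)
      refine hull_contra δ hδ hc p a c b (-ori (δ a) (δ b) (δ c) / ori (δ p) (δ a) (δ c))
        (ori (δ p) (δ b) (δ c) / ori (δ p) (δ a) (δ c))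
        (ori (δ p) (δ a) (δ b) / ori (δ p) (δ a) (δ c))
        (div_nonneg (by linarith) o3.le) (div_nonneg o2.le o3.le) (div_nonneg o1.le o3.le)
        ?_ hb.symm (by rintro rfl; exact lt_irrefl _ hab) (by rintro rfl; exact lt_irrefl _ hbc)
        ?_ ?_
      · have := o3.ne'
        field_simp
        simp only [ori]; ring
      · have := o3.ne'
        field_simp
        simp only [ori]; ring
      · have := o3.ne'
        field_simp
        simp only [ori]; ring
  refine ⟨f, ?_, ?_⟩
  · intro a b hab
    by_cases ha : a = p
    · by_cases hb : b = p
      · rw [ha, hb]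
      · rw [ha, hfp, hfv b hb] at hab
        have := hm b
        linarith
    · by_cases hb : b = p
      · rw [hb, hfp, hfv a ha] at hab
        have := hm a
        linarith
      · rw [hfv a ha, hfv b hb] at hab
        rcases lt_trichotomy (φ a) (φ b) with q | q | q
        · exact (hgi a b ha hb hab q).elim
        · exact ht q
        · exact (hgi b a hb ha hab.symm q).elim
  · intro a b c d h1 h2 h3 hac hbd
    have o1 := htri b c d h2 h3
    have o2 := htri a b d h1 (h2.trans h3)
    have o3 := htri a c d (h1.trans h2) h3
    have o4 := htri a b c h1 h2
    have hD : ori (δ b) (δ c) (δ d) + ori (δ a) (δ b) (δ d) =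
        ori (δ a) (δ c) (δ d) + ori (δ a) (δ b) (δ c) := by
      simp only [ori]; ring
    have hne : ({a, c} : Set V) ≠ {b, d} := by
      intro h
      have : a ∈ ({b, d} : Set V) := by rw [← h]; simp
      rcases this with q | q
      · rw [q] at h1; exact lt_irrefl _ h1
      · have q' : a = d := q
        have := h1.trans (h2.trans h3)
        rw [q'] at this; exact lt_irrefl _ this
    set D := ori (δ b) (δ c) (δ d) + ori (δ a) (δ b) (δ d) with hDD
    have hDpos : 0 < D := by linarith
    obtain ⟨w, hw, hw', -⟩ := hpl.2.2 a c b d hac hbd hne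
      ((ori (δ b) (δ c) (δ d) / D) • δ a + (ori (δ a) (δ b) (δ d) / D) • δ c)
      ⟨_, _, by positivity, by positivity, by rw [← add_div, ← hDD]; exact div_self hDpos.ne', rfl⟩
      ⟨ori (δ a) (δ c) (δ d) / D, ori (δ a) (δ b) (δ c) / D, by positivity, by positivity,
        by rw [← add_div, ← hD]; exact div_self hDpos.ne', by
          ext
          · simp only [Prod.fst_add, Prod.smul_fst, smul_eq_mul]
            field_simp
            simp only [ori]; ring
          · simp only [Prod.snd_add, Prod.smul_snd, smul_eq_mul]
            field_simp
            simp only [ori]; ring⟩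
    have i1 := h1.trans h2
    have i2 := h2.trans h3
    have i3 := h1.trans i2
    rcases hw with rfl | rfl <;> rcases hw' with rfl | rfl
    · exact lt_irrefl _ h1
    · exact lt_irrefl _ i3
    · exact lt_irrefl _ h2
    · exact lt_irrefl _ h3

lemma plane_linear {V : Type*} {G : SimpleGraph V} {D : V → ℝ × ℝ} (h : IsPlaneDrawing G D)
    (B : ℝ × ℝ →ₗ[ℝ] ℝ × ℝ) (hB : Function.Injective B) :
    IsPlaneDrawing G (fun v => B (D v)) := by
  have him : ∀ a b : ℝ × ℝ, segment ℝ (B a) (B b) = B '' segment ℝ a b := by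
    intro a b
    exact (image_segment ℝ B.toAffineMap a b).symm
  refine ⟨fun u v huv => h.1 (hB huv), ?_, ?_⟩
  · intro u v w he hw
    rw [him] at hw
    obtain ⟨q, hq, hqe⟩ := hw
    rw [hB hqe] at hq
    exact h.2.1 u v w he hq
  · intro u v a b he hf hne p hp hp'
    rw [him] at hp hp'
    obtain ⟨q, hq, rfl⟩ := hp
    obtain ⟨q', hq', hqe⟩ := hp'
    rw [hB hqe] at hq'
    obtain ⟨w, h1, h2, h3⟩ := h.2.2 u v a b he hf hne q hq hq'
    exact ⟨w, h1, h2, by rw [h3]⟩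

lemma exists_bound {V : Type*} [Fintype V] (F : V → V → ℝ) :
    ∃ B, 0 ≤ B ∧ ∀ u v, F u v < B := by
  obtain ⟨B, hB⟩ := (Set.finite_range (fun q : V × V => F q.1 q.2)).bddAbove
  refine ⟨max 0 (B + 1), le_max_left _ _, fun u v => ?_⟩
  have : F u v ≤ B := hB ⟨(u, v), rfl⟩
  have := le_max_right 0 (B + 1)
  linarith

lemma core {V : Type*} [LinearOrder V] [Fintype V] (G : SimpleGraph V) (δ : V → ℝ × ℝ)
    (hδ : Function.Injective δ) (L : V → ℕ) (hL1 : ∀ u v, G.Adj u v → L u ≤ L v + 1)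
    (hL2 : ∀ u v w, G.Adj u v → u < w → w < v → L u = L v → L w ≠ L u)
    (hL3 : ∀ u v u' v', G.Adj u v → G.Adj u' v' → L u = L u' → L v = L u + 1 → L v' = L v →
        u < u' → v ≤ v') :
    ∃ δ' : V → ℝ × ℝ, IsPlaneDrawing G δ' ∧
      (Finset.univ.filter (fun v => L v % 2 = 0)).card ≤ {v : V | δ' v = δ v}.ncard ^ 2 := by
  classical
  obtain ⟨t, ht⟩ := exists_generic δ hδ
  have hr : ∃ (r : V → ℤ) (N : ℤ), (∀ v, 0 ≤ r v ∧ r v < N) ∧ StrictMono r := by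
    let e := (Fintype.orderIsoFinOfCardEq V rfl).symm
    refine ⟨fun v => ((e v : Fin _) : ℕ), Fintype.card V, ?_, ?_⟩
    · intro v
      have := (e v).2
      simp only
      constructor <;> omega
    · intro a b hab
      have : e a < e b := e.strictMono hab
      have : (e a : ℕ) < e b := this
      simp only
      omega
  obtain ⟨r, N, hrN, hrm⟩ := hr
  let κ : V → Lex (ℕ × ℤ) := fun v =>
    toLex (L v, if L v % 4 = 0 then r v else if L v % 4 = 2 then - r v else 0)
  have hκL : ∀ u v, L u < L v → κ u < κ v := fun u v h =>
    Prod.Lex.toLex_lt_toLex.2 (Or.inl h)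
  have hκ0 : ∀ u v, L u = L v → L u % 4 = 0 → u < v → κ u < κ v := by
    intro u v h h4 huv
    refine Prod.Lex.toLex_lt_toLex.2 (Or.inr ⟨h, ?_⟩)
    simp only [← h, h4, if_true]
    exact hrm huv
  have hκ2 : ∀ u v, L u = L v → L u % 4 = 2 → u < v → κ v < κ u := by
    intro u v h h4 huv
    refine Prod.Lex.toLex_lt_toLex.2 (Or.inr ⟨h.symm, ?_⟩)
    have := hrm huv
    simp [← h, h4, this]
  have hκ1 : ∀ u v, L u = L v → L u % 2 = 1 → κ u = κ v := by
    intro u v h h4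
    have a1 : ¬ L v % 4 = 0 := by omega
    have a2 : ¬ L v % 4 = 2 := by omega
    simp [κ, h, a1, a2]
  have hκi : ∀ u v, L u % 2 = 0 → κ u = κ v → u = v := by
    intro u v h huv
    rcases lt_trichotomy (L u) (L v) with q | q | q
    · exact absurd huv (hκL _ _ q).ne
    · by_contra hne
      rcases lt_or_gt_of_ne hne with l | l
      · by_cases h4 : L u % 4 = 0
        · exact (hκ0 u v q h4 l).ne huv
        · exact (hκ2 u v q (by omega) l).ne huv.symm
      · by_cases h4 : L u % 4 = 0
        · exact (hκ0 v u q.symm (by omega) l).ne huv.symm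
        · exact (hκ2 v u q.symm (by omega) l).ne huv
    · exact absurd huv (hκL _ _ q).ne'
  obtain ⟨T, hTS, hTc, hT⟩ := exists_monotone_subset κ (fun v => (δ v).1 + t * (δ v).2)
    (Finset.univ.filter (fun v => L v % 2 = 0))
    (fun u hu v _ => hκi u v (Finset.mem_filter.1 hu).2) ht
  have hTe : ∀ v ∈ T, L v % 2 = 0 := fun v hv => (Finset.mem_filter.1 (hTS hv)).2
  have hε : ∃ ε : ℝ, ε * ε = 1 ∧ ∀ u ∈ T, ∀ v ∈ T, κ u < κ v →
      ε * ((δ u).1 + t * (δ u).2) < ε * ((δ v).1 + t * (δ v).2) := by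
    rcases hT with hT | hT
    · exact ⟨1, by norm_num, fun u hu v hv h => by have := hT u hu v hv h; linarith⟩
    · exact ⟨-1, by norm_num, fun u hu v hv h => by have := hT u hu v hv h; linarith⟩
  obtain ⟨ε, hε1, hε2⟩ := hε
  obtain ⟨x, hx1, hx2, hx3⟩ := exists_positions κ (fun v => ε * ((δ v).1 + t * (δ v).2)) T
    (fun u hu v _ => hκi u v (hTe u hu)) hε2
  obtain ⟨M, hM0, hM⟩ := exists_bound (fun u v => |(δ u).2 - (δ v).2| / |x u - x v|)
  obtain ⟨H, hH0, hH⟩ := exists_bound (fun u v => M * |x u - x v| + |(δ v).2|)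
  let s : ℕ → ℝ := fun k => if k % 4 = 1 then -1 else 1
  let y : V → ℝ := fun v => if L v % 2 = 0 then (δ v).2 else
    s (L v) * (H + if L v % 4 = 1 then ((N - r v : ℤ) : ℝ) else (r v : ℝ))
  have hs1 : ∀ k, k % 4 = 1 → s k = -1 := fun k h => by simp [s, h]
  have hs3 : ∀ k, k % 4 = 3 → s k = 1 := fun k h => by simp [s, h]
  have hs : ∀ k, s k = 1 ∨ s k = -1 := by
    intro k
    by_cases h : k % 4 = 1
    · right; exact hs1 k h
    · left; simp [s, h]
  have hye : ∀ v, L v % 2 = 0 → y v = (δ v).2 := fun v h => by simp [y, h]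
  have hy1 : ∀ v, L v % 4 = 1 → y v = -(H + ((N - r v : ℤ) : ℝ)) := by
    intro v h
    have h2 : ¬ L v % 2 = 0 := by omega
    simp only [y, if_neg h2, if_pos h, hs1 _ h]
    ring
  have hy3 : ∀ v, L v % 4 = 3 → y v = H + (r v : ℝ) := by
    intro v h
    have h2 : ¬ L v % 2 = 0 := by omega
    have h3 : ¬ L v % 4 = 1 := by omega
    simp only [y, if_neg h2, if_neg h3, hs3 _ h]
    ring
  have hymono : ∀ u v, L u = L v → L u % 2 = 1 → u < v → y u < y v := by
    intro u v h h2 huv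
    have hrr := hrm huv
    have hrr' : (r u : ℝ) < r v := by exact_mod_cast hrr
    by_cases h4 : L u % 4 = 1
    · rw [hy1 u h4, hy1 v (by omega)]
      push_cast
      linarith
    · rw [hy3 u (by omega), hy3 v (by omega)]
      linarith
  have hymono' : ∀ u v, L u = L v → L u % 2 = 1 → u ≤ v → y u ≤ y v := by
    intro u v h h2 huv
    rcases huv.eq_or_lt with rfl | huv
    · exact le_rfl
    · exact (hymono u v h h2 huv).le
  have hx0 : ∀ u v, L u = L v → L u % 4 = 0 → u ≤ v → x u ≤ x v := by
    intro u v h h2 huv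
    rcases huv.eq_or_lt with rfl | huv
    · exact le_rfl
    · exact (hx1 _ _ (hκ0 u v h h2 huv)).le
  have hx22 : ∀ u v, L u = L v → L u % 4 = 2 → u ≤ v → x v ≤ x u := by
    intro u v h h2 huv
    rcases huv.eq_or_lt with rfl | huv
    · exact le_rfl
    · exact (hx1 _ _ (hκ2 u v h h2 huv)).le
  have hcons : ∀ u v w, G.Adj u v → L u = L v → L w = L u →
      (w ≤ u ∧ w ≤ v) ∨ (u ≤ w ∧ v ≤ w) := by
    intro u v w he h hw
    have k1 := hL2 u v w he
    have k2 := hL2 v u w he.symm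
    rcases le_or_gt w u with a | a <;> rcases le_or_gt w v with b | b
    · exact Or.inl ⟨a, b⟩
    · rcases a.eq_or_lt with a | a
      · right; exact ⟨a.ge, b.le⟩
      · exact absurd (hw.trans h) (k2 b a h.symm)
    · rcases b.eq_or_lt with b | b
      · right; exact ⟨a.le, b.ge⟩
      · exact absurd hw (k1 a b h)
    · exact Or.inr ⟨a.le, b.le⟩
  have hxne : ∀ u v, L u % 2 = 0 → x u = x v → u = v := by
    intro u v h hxx
    apply hκi u v h
    by_contra hne
    rcases lt_or_gt_of_ne hne with q | q
    · have := hx1 _ _ q; linarith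
    · have := hx1 _ _ q; linarith
  have hlay : Lay G L x y s M := by
    refine ⟨hL1, hM0, hs, ?_, fun u v h => hx1 _ _ (hκL u v h), fun u v h h' =>
      hx2 _ _ (hκ1 u v h h'), fun u v _ h' h'' => hxne u v h' h'', ?_, ?_, ?_, ?_, ?_, ?_, ?_⟩
    · intro k hk
      by_cases h4 : k % 4 = 1
      · rw [hs1 k h4, hs3 _ (by omega)]; norm_num
      · rw [hs3 k (by omega), hs1 _ (by omega)]
    · intro u v h h' hyy
      by_contra hne
      rcases lt_or_gt_of_ne hne with q | q
      · have := hymono u v h h' q; linarith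
      · have := hymono v u h.symm (by omega) q; linarith
    · intro u v hu hv hne
      rw [hye u hu, hye v hv]
      have hx : 0 < |x u - x v| := by
        rw [abs_pos]
        intro q
        exact hne (hxne u v hu (by linarith))
      have := hM u v
      rwa [div_lt_iff₀ hx] at this
    · intro u v hu hv
      rw [hye v hv]
      have b := hH u v
      have hq := hrN u
      have q1 : (0 : ℝ) ≤ r u := by exact_mod_cast hq.1
      have q2 : (r u : ℝ) < N := by exact_mod_cast hq.2
      have a1 := le_abs_self (δ v).2
      have a2 := neg_abs_le (δ v).2
      by_cases h4 : L u % 4 = 1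
      · rw [hy1 u h4, hs1 _ h4]
        push_cast
        linarith
      · rw [hy3 u (by omega), hs3 _ (by omega)]
        linarith
    · intro u v w he h h2 hw
      rcases hcons u v w he h hw with ⟨a, b⟩ | ⟨a, b⟩ <;> by_cases h4 : L u % 4 = 0
      · left; exact ⟨hx0 _ _ (by omega) (by omega) a, hx0 _ _ (by omega) (by omega) b⟩
      · right; exact ⟨hx22 _ _ (by omega) (by omega) a, hx22 _ _ (by omega) (by omega) b⟩
      · right; exact ⟨hx0 _ _ (by omega) (by omega) a, hx0 _ _ (by omega) (by omega) b⟩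
      · left; exact ⟨hx22 _ _ (by omega) (by omega) a, hx22 _ _ (by omega) (by omega) b⟩
    · intro u v w he h h2 hw
      rcases hcons u v w he h hw with ⟨a, b⟩ | ⟨a, b⟩
      · left; exact ⟨hymono' _ _ (by omega) (by omega) a, hymono' _ _ (by omega) (by omega) b⟩
      · right; exact ⟨hymono' _ _ (by omega) (by omega) a, hymono' _ _ (by omega) (by omega) b⟩
    · intro u v u' v' he he' hu hv h2 h3 hx
      by_cases h4 : L u % 4 = 0
      · have huu : u < u' := by
          by_contra q
          have := hx0 u' u hu.symm (by omega) (not_lt.1 q)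
          linarith
        have := hL3 u v u' v' he he' hu h3 hv.symm huu
        have := hymono' v v' hv (by omega) this
        rw [hs1 _ (by omega)]
        linarith
      · have huu : u' < u := by
          by_contra q
          have := hx22 u u' hu (by omega) (not_lt.1 q)
          linarith
        have := hL3 u' v' u v he' he hu.symm (by omega) hv huu
        have := hymono' v' v hv.symm (by omega) this
        rw [hs3 _ (by omega)]
        linarith
    · intro u v u' v' he he' hu hv h2 h3 hx
      by_cases h4 : L u % 4 = 0
      · have huu : u' < u := by
          by_contra q
          have := hx0 u u' hu (by omega) (not_lt.1 q)
          linarith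
        have hvv : v' ≤ v := by
          by_contra q
          have := hL3 v u v' u' he.symm he'.symm hv (by omega) (by omega) (not_le.1 q)
          exact absurd huu (not_lt.2 this)
        have := hymono' v' v hv.symm (by omega) hvv
        rw [hs3 _ (by omega)]
        linarith
      · have huu : u < u' := by
          by_contra q
          have := hx22 u' u hu.symm (by omega) (not_lt.1 q)
          linarith
        have hvv : v ≤ v' := by
          by_contra q
          have := hL3 v' u' v u he'.symm he.symm hv.symm (by omega) (by omega) (not_le.1 q)
          exact absurd huu (not_lt.2 this)
        have := hymono' v v' hv (by omega) hvv
        rw [hs1 _ (by omega)]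
        linarith
  let B : ℝ × ℝ →ₗ[ℝ] ℝ × ℝ :=
    { toFun := fun z => (ε * z.1 - t * z.2, z.2)
      map_add' := fun a b => by ext <;> simp <;> ring
      map_smul' := fun c a => by ext <;> simp <;> ring }
  have hBv : ∀ z, B z = (ε * z.1 - t * z.2, z.2) := fun _ => rfl
  have hB : Function.Injective B := by
    intro a b hab
    rw [hBv, hBv, Prod.mk.injEq] at hab
    obtain ⟨h1, h2⟩ := hab
    rw [h2] at h1
    have h3 : ε * a.1 = ε * b.1 := by linarith
    have h4 : a.1 = b.1 := by
      calc a.1 = ε * (ε * a.1) := by rw [← mul_assoc, hε1, one_mul]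
        _ = ε * (ε * b.1) := by rw [h3]
        _ = b.1 := by rw [← mul_assoc, hε1, one_mul]
    exact Prod.ext h4 h2
  refine ⟨fun v => B (x v, y v), plane_linear hlay.plane B hB, hTc.trans ?_⟩
  apply Nat.pow_le_pow_left
  rw [← Set.ncard_coe_finset]
  apply Set.ncard_le_ncard _ (Set.toFinite _)
  intro v hv
  have hv' : v ∈ T := hv
  change B (x v, y v) = δ v
  rw [hBv]
  apply Prod.ext
  · simp only
    rw [hx3 v hv', hye v (hTe v hv'), ← mul_assoc, hε1]; ring
  · exact hye v (hTe v hv')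

/-- Let `G` be an outerplanar graph (it has a plane straight-line drawing with the
vertex images in strictly convex position) with `n` vertices.  Then `fix(G) ≥ √(n/2)`:
for every straight-line drawing `δ` of `G` there is a plane straight-line drawing `δ'`
fixing at least `√(n/2)` vertices of `δ`. -/
theorem fix_outerplanar_ge {V : Type*} [Fintype V] (G : SimpleGraph V)
    (houter : ∃ δ : V → ℝ × ℝ, IsPlaneDrawing G δ ∧ StrictlyConvexPosition (Set.range δ))
    (δ : V → ℝ × ℝ) (hδ : Function.Injective δ) :
    ∃ δ' : V → ℝ × ℝ, IsPlaneDrawing G δ' ∧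
      Real.sqrt ((Fintype.card V : ℝ) / 2) ≤ ({v : V | δ' v = δ v}.ncard : ℝ) := by
  classical
  obtain ⟨δ₀, hpl, hc⟩ := houter
  obtain ⟨f, hf, hnc⟩ := convex_order G δ₀ hpl hc
  let _ : LinearOrder V := LinearOrder.lift' f hf
  obtain ⟨L, hL1, hL2, hL3⟩ := exists_layering G (fun a b c d h1 h2 h3 => hnc a b c d h1 h2 h3)
  have hsum := Finset.card_filter_add_card_filter_not (s := (Finset.univ : Finset V))
    (fun v => L v % 2 = 0)
  rw [Finset.card_univ] at hsum
  have hfin : ∃ δ' : V → ℝ × ℝ, IsPlaneDrawing G δ' ∧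
      Fintype.card V ≤ 2 * {v : V | δ' v = δ v}.ncard ^ 2 := by
    rcases le_total (Finset.univ.filter (fun v => ¬ L v % 2 = 0)).card
      (Finset.univ.filter (fun v => L v % 2 = 0)).card with h | h
    · obtain ⟨δ', h1, h2⟩ := core G δ hδ L hL1 hL2 hL3
      exact ⟨δ', h1, by omega⟩
    · obtain ⟨δ', h1, h2⟩ := core G δ hδ (fun v => L v + 1)
        (fun u v h => by have := hL1 u v h; omega)
        (fun u v w h h1 h2 h3 h4 => hL2 u v w h h1 h2 (by omega) (by omega))
        (fun u v u' v' h h' h1 h2 h3 h4 => hL3 u v u' v' h h' (by omega) (by omega) (by omega) h4)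
      refine ⟨δ', h1, ?_⟩
      have : (Finset.univ.filter (fun v => ¬ L v % 2 = 0)) =
          (Finset.univ.filter (fun v => (L v + 1) % 2 = 0)) := by
        ext v; simp; omega
      rw [this] at hsum h
      omega
  obtain ⟨δ', h1, h2⟩ := hfin
  refine ⟨δ', h1, ?_⟩
  rw [Real.sqrt_le_left (by positivity)]
  have : (Fintype.card V : ℝ) ≤ 2 * ({v : V | δ' v = δ v}.ncard : ℝ) ^ 2 := by exact_mod_cast h2
  linarith
end

section
/- For every positive integer n₀ there exists a planar graph G with some number n ≥ n₀ of vertices such that fix(G) ≤ √(n−2) + 1. -/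
namespace FixUB

theorem seg_mem {P Q R : ℝ × ℝ} (s : ℝ) (h0 : 0 ≤ s) (h1 : s ≤ 1)
    (hx : R.1 = (1 - s) * P.1 + s * Q.1) (hy : R.2 = (1 - s) * P.2 + s * Q.2) :
    R ∈ segment ℝ P Q := by
  refine ⟨1 - s, s, by linarith, h0, by ring, ?_⟩
  ext <;> simp [hx, hy]

theorem mem_seg {P Q R : ℝ × ℝ} (h : R ∈ segment ℝ P Q) : ∃ s : ℝ, 0 ≤ s ∧ s ≤ 1 ∧
    R.1 = (1 - s) * P.1 + s * Q.1 ∧ R.2 = (1 - s) * P.2 + s * Q.2 := by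
  obtain ⟨a, b, ha, hb, hab, rfl⟩ := h
  refine ⟨b, hb, by linarith, ?_, ?_⟩ <;> simp <;> left <;> linarith

theorem plane_comp {V : Type*} {G : SimpleGraph V} {δ : V → ℝ × ℝ} (h : IsPlaneDrawing G δ)
    (f : ℝ × ℝ → ℝ × ℝ) (hf : Function.Injective f)
    (hl : ∀ (s t : ℝ) P Q, s + t = 1 → f (s • P + t • Q) = s • f P + t • f Q) :
    IsPlaneDrawing G (fun v => f (δ v)) := by
  have key : ∀ P Q R, R ∈ segment ℝ (f P) (f Q) → ∃ R', R' ∈ segment ℝ P Q ∧ f R' = R := by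
    rintro P Q R ⟨s, t, hs, ht, hst, rfl⟩
    exact ⟨s • P + t • Q, ⟨s, t, hs, ht, hst, rfl⟩, hl s t P Q hst⟩
  obtain ⟨h1, h2, h3⟩ := h
  refine ⟨hf.comp h1, ?_, ?_⟩
  · intro u v w huv hw
    obtain ⟨R, hR, hR'⟩ := key _ _ _ hw
    rw [hf hR'] at hR
    exact h2 u v w huv hR
  · intro u v a b huv hab hne p hp hq
    obtain ⟨R, hR, rfl⟩ := key _ _ _ hp
    obtain ⟨R', hR', hh⟩ := key _ _ _ hq
    rw [hf hh] at hR'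
    obtain ⟨w, hw1, hw2, hw3⟩ := h3 u v a b huv hab hne R hR hR'
    exact ⟨w, hw1, hw2, by rw [hw3]⟩

/-- Normalized situation: `a` at the origin, `b` at `(0,1)`. -/
structure Nor {V : Type*} (G : SimpleGraph V) (δ : V → ℝ × ℝ) (a b : V) : Prop where
  pl : IsPlaneDrawing G δ
  ab : G.Adj a b
  a1 : (δ a).1 = 0
  a2 : (δ a).2 = 0
  b1 : (δ b).1 = 0
  b2 : (δ b).2 = 1

variable {V : Type*} {G : SimpleGraph V} {δ : V → ℝ × ℝ} {a b : V}

theorem Nor.reflect (h : Nor G δ a b) : Nor G (fun v => (-(δ v).1, (δ v).2)) a b := by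
  refine ⟨plane_comp h.pl (fun P => (-P.1, P.2)) ?_ ?_, h.ab, ?_, ?_, ?_, ?_⟩
  · rintro ⟨x, y⟩ ⟨x', y'⟩ h; simpa using h
  · intro s t P Q _; ext <;> simp; ring
  all_goals simp [h.a1, h.a2, h.b1, h.b2]

theorem no_cross (h : IsPlaneDrawing G δ) {u v c d : V} (huv : G.Adj u v) (hcd : G.Adj c d)
    (h1 : u ≠ c) (h2 : u ≠ d) (h3 : v ≠ c) (h4 : v ≠ d) (p : ℝ × ℝ)
    (hp : p ∈ segment ℝ (δ u) (δ v)) (hq : p ∈ segment ℝ (δ c) (δ d)) : False := by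
  have hne : ({u, v} : Set V) ≠ {c, d} := by
    intro he
    have : u ∈ ({c, d} : Set V) := by rw [← he]; simp
    simp at this; tauto
  obtain ⟨w, hw1, hw2, _⟩ := h.2.2 u v c d huv hcd hne p hp hq
  rcases hw1 with rfl | rfl <;> rcases hw2 with h | h <;> tauto

theorem Nor.ne_zero (h : Nor G δ a b) {v : V} (hav : G.Adj a v) (hbv : G.Adj b v) :
    (δ v).1 ≠ 0 := by
  intro hx
  rcases le_or_gt (δ v).2 0 with hy | hy
  · have : δ a ∈ segment ℝ (δ b) (δ v) := by
      have hd : (1 - (δ v).2) ≠ 0 := by linarith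
      refine seg_mem (1 / (1 - (δ v).2)) (by apply one_div_nonneg.2; linarith) ?_ ?_ ?_
      · rw [div_le_one] <;> linarith
      · rw [h.a1, h.b1, hx]; ring
      · rw [h.a2, h.b2]; field_simp; ring
    rcases h.pl.2.1 _ _ _ hbv this with e | e
    · exact h.ab.ne e
    · exact hav.ne e
  rcases le_or_gt (δ v).2 1 with hy1 | hy1
  · have : δ v ∈ segment ℝ (δ a) (δ b) := by
      refine seg_mem (δ v).2 hy.le hy1 ?_ ?_
      · rw [h.a1, h.b1, hx]; ring
      · rw [h.a2, h.b2]; ring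
    rcases h.pl.2.1 _ _ _ h.ab this with e | e
    · exact hav.ne e.symm
    · exact hbv.ne e.symm
  · have : δ b ∈ segment ℝ (δ a) (δ v) := by
      refine seg_mem (1 / (δ v).2) (by positivity) ?_ ?_ ?_
      · rw [div_le_one] <;> linarith
      · rw [h.a1, h.b1, hx]; ring
      · rw [h.a2, h.b2]; field_simp; ring
    rcases h.pl.2.1 _ _ _ hav this with e | e
    · exact h.ab.ne e.symm
    · exact hbv.ne e

theorem Nor.cross (h : Nor G δ a b) {v w : V} (hav : G.Adj a v) (hbv : G.Adj b v)
    (haw : G.Adj a w) (hbw : G.Adj b w) (hvw : v ≠ w) (hv : 0 < (δ v).1) (hw : 0 < (δ w).1)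
    (h1 : (δ w).2 * (δ v).1 ≤ (δ v).2 * (δ w).1)
    (h2 : (1 - (δ v).2) * (δ w).1 ≤ (1 - (δ w).2) * (δ v).1) : False := by
  set x := (δ v).1 with hx
  set y := (δ v).2 with hy
  set x' := (δ w).1 with hx'
  set y' := (δ w).2 with hy'
  have hE : 0 < y * x' + (1 - y') * x := by nlinarith
  set E := y * x' + (1 - y') * x with hEd
  have hE0 : E ≠ 0 := hE.ne'
  refine no_cross h.pl hav hbw h.ab.ne haw.ne hbv.ne' hvw (x' / E * x, x' / E * y) ?_ ?_
  · refine seg_mem (x' / E) (by positivity) ?_ ?_ ?_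
    · rw [div_le_one hE]; nlinarith
    · rw [h.a1]; ring
    · rw [h.a2]; ring
  · refine seg_mem (x / E) (by positivity) ?_ ?_ ?_
    · rw [div_le_one hE]; nlinarith
    · rw [h.b1]; simp only [← hx']; ring
    · rw [h.b2]; simp only [← hy']; field_simp; ring

/-- nesting -/
theorem Nor.nest (h : Nor G δ a b) {v w : V} (hav : G.Adj a v) (hbv : G.Adj b v)
    (haw : G.Adj a w) (hbw : G.Adj b w) (hvw : v ≠ w) (hv : 0 < (δ v).1) (hw : 0 < (δ w).1) :
    ((δ w).2 * (δ v).1 < (δ v).2 * (δ w).1 ∧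
      (1 - (δ w).2) * (δ v).1 < (1 - (δ v).2) * (δ w).1) ∨
    ((δ v).2 * (δ w).1 < (δ w).2 * (δ v).1 ∧
      (1 - (δ v).2) * (δ w).1 < (1 - (δ w).2) * (δ v).1) := by
  have A := h.cross hav hbv haw hbw hvw hv hw
  have B := h.cross haw hbw hav hbv hvw.symm hw hv
  grind

theorem Nor.inj_pos (h : Nor G δ a b) {v w : V} (hav : G.Adj a v) (hbv : G.Adj b v)
    (haw : G.Adj a w) (hbw : G.Adj b w) (hvw : v ≠ w) (hv : 0 < (δ v).1) :
    (δ v).1 ≠ (δ w).1 := by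
  intro he
  have hw : 0 < (δ w).1 := he ▸ hv
  have := h.nest hav hbv haw hbw hvw hv hw
  rw [he] at this
  rcases this with ⟨h1, h2⟩ | ⟨h1, h2⟩ <;> nlinarith

theorem Nor.inj (h : Nor G δ a b) {v w : V} (hav : G.Adj a v) (hbv : G.Adj b v)
    (haw : G.Adj a w) (hbw : G.Adj b w) (hvw : v ≠ w) :
    (δ v).1 ≠ (δ w).1 := by
  rcases lt_or_gt_of_ne (h.ne_zero hav hbv) with h0 | h0
  · have := h.reflect.inj_pos hav hbv haw hbw hvw (by simpa using h0)
    simpa using this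
  · exact h.inj_pos hav hbv haw hbw hvw h0

theorem exit3 (q1 q2 q3 p1 p2 p3 : ℝ) (h1 : 0 < q1) (h2 : 0 < q2) (h3 : 0 < q3)
    (hp : p1 < 0 ∨ p2 < 0 ∨ p3 < 0) : ∃ s : ℝ, 0 ≤ s ∧ s ≤ 1 ∧
      0 ≤ (1 - s) * q1 + s * p1 ∧ 0 ≤ (1 - s) * q2 + s * p2 ∧ 0 ≤ (1 - s) * q3 + s * p3 ∧
      ((1 - s) * q1 + s * p1 = 0 ∨ (1 - s) * q2 + s * p2 = 0 ∨ (1 - s) * q3 + s * p3 = 0) := by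
  let m : ℝ → ℝ := fun s => min ((1 - s) * q1 + s * p1)
    (min ((1 - s) * q2 + s * p2) ((1 - s) * q3 + s * p3))
  have hc : ContinuousOn m (Set.Icc 0 1) := by
    apply Continuous.continuousOn; fun_prop
  have hm := intermediate_value_Icc' (zero_le_one) hc
  have h0 : 0 < m 0 := by simp [m, h1, h2, h3]
  have h1' : m 1 < 0 := by simpa [m] using hp
  obtain ⟨s, ⟨hs0, hs1⟩, hs⟩ := hm ⟨h1'.le, h0.le⟩
  refine ⟨s, hs0, hs1, ?_⟩
  simp only [m] at hs
  grind

theorem Nor.between_pos (h : Nor G δ a b) {v w m : V} (hav : G.Adj a v) (hbv : G.Adj b v)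
    (haw : G.Adj a w) (hbw : G.Adj b w) (ham : G.Adj a m) (hbm : G.Adj b m) (hvw : G.Adj v w)
    (hm : 0 < (δ m).1) (h1 : (δ v).1⁻¹ < (δ m).1⁻¹) (h2 : (δ m).1⁻¹ < (δ w).1⁻¹) : False := by
  have hw : 0 < (δ w).1 := inv_pos.1 ((inv_pos.2 hm).trans h2)
  have hlt : (δ w).1 < (δ m).1 := (inv_lt_inv₀ hm hw).1 h2
  have hwm : w ≠ m := by rintro rfl; exact lt_irrefl _ h2
  have hvm : v ≠ m := by rintro rfl; exact lt_irrefl _ h1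
  have hv0 := h.ne_zero hav hbv
  have hv : (δ v).1 < 0 ∨ (δ v).2 * (δ m).1 - (δ m).2 * (δ v).1 < 0 ∨
      (1 - (δ v).2) * (δ m).1 - (1 - (δ m).2) * (δ v).1 < 0 := by
    rcases lt_or_gt_of_ne hv0 with h0 | h0
    · exact Or.inl h0
    · have hl : (δ m).1 < (δ v).1 := (inv_lt_inv₀ h0 hm).1 h1
      rcases h.nest hav hbv ham hbm hvm h0 hm with ⟨c, d⟩ | ⟨c, d⟩
      · nlinarith
      · right; left; linarith
  have hw' : 0 < (δ w).2 * (δ m).1 - (δ m).2 * (δ w).1 ∧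
      0 < (1 - (δ w).2) * (δ m).1 - (1 - (δ m).2) * (δ w).1 := by
    rcases h.nest haw hbw ham hbm hwm hw hm with ⟨c, d⟩ | ⟨c, d⟩
    · constructor <;> linarith
    · nlinarith
  obtain ⟨s, hs0, hs1, e1, e2, e3, he⟩ := exit3 _ _ _ _ _ _ hw hw'.1 hw'.2 hv
  set x := (1 - s) * (δ w).1 + s * (δ v).1 with hx
  set y := (1 - s) * (δ w).2 + s * (δ v).2 with hy
  have g2 : (1 - s) * ((δ w).2 * (δ m).1 - (δ m).2 * (δ w).1) +
    s * ((δ v).2 * (δ m).1 - (δ m).2 * (δ v).1) = y * (δ m).1 - (δ m).2 * x := by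
    rw [hx, hy]; ring
  have g3 : (1 - s) * ((1 - (δ w).2) * (δ m).1 - (1 - (δ m).2) * (δ w).1) +
    s * ((1 - (δ v).2) * (δ m).1 - (1 - (δ m).2) * (δ v).1) =
      (1 - y) * (δ m).1 - (1 - (δ m).2) * x := by
    rw [hx, hy]; ring
  rw [g2] at e2 he
  rw [g3] at e3 he
  have hseg : (x, y) ∈ segment ℝ (δ w) (δ v) := seg_mem s hs0 hs1 rfl rfl
  have hm0 := hm.ne'
  have hxm : x / (δ m).1 ≤ 1 := by rw [div_le_one hm]; linarith
  have hxm0 : 0 ≤ x / (δ m).1 := by positivity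
  rcases he with he | he | he
  · refine no_cross h.pl hvw.symm h.ab haw.ne' hbw.ne' hav.ne' hbv.ne' _ hseg ?_
    rw [he] at e2 e3
    refine seg_mem y (by nlinarith) (by nlinarith) ?_ ?_
    · rw [h.a1, h.b1]; simp [he]
    · rw [h.a2, h.b2]; simp
  · refine no_cross h.pl hvw.symm ham haw.ne' hwm hav.ne' hvm _ hseg ?_
    refine seg_mem (x / (δ m).1) hxm0 hxm ?_ ?_
    · rw [h.a1]; field_simp; ring
    · rw [h.a2]; field_simp; linarith
  · refine no_cross h.pl hvw.symm hbm hbw.ne' hwm hbv.ne' hvm _ hseg ?_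
    refine seg_mem (x / (δ m).1) hxm0 hxm ?_ ?_
    · rw [h.b1]; field_simp; ring
    · rw [h.b2]; field_simp; linarith

theorem Nor.between (h : Nor G δ a b) {v w m : V} (hav : G.Adj a v) (hbv : G.Adj b v)
    (haw : G.Adj a w) (hbw : G.Adj b w) (ham : G.Adj a m) (hbm : G.Adj b m) (hvw : G.Adj v w)
    (h1 : (δ v).1⁻¹ < (δ m).1⁻¹) (h2 : (δ m).1⁻¹ < (δ w).1⁻¹) : False := by
  rcases lt_or_gt_of_ne (h.ne_zero ham hbm) with h0 | h0
  · refine h.reflect.between_pos haw hbw hav hbv ham hbm hvw.symm (by simpa using h0) ?_ ?_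
    · simpa [inv_neg] using h2
    · simpa [inv_neg] using h1
  · exact h.between_pos hav hbv haw hbw ham hbm hvw h0 h1 h2

theorem mono_aux {N : ℕ} (f : Fin N → ℝ) (hf : Function.Injective f)
    (hb : ∀ i j m : Fin N, (i : ℕ) + 1 = j → (f i < f m → f m < f j → False) ∧
      (f j < f m → f m < f i → False))
    (h1 : ∀ h : 1 < N, f ⟨0, by omega⟩ < f ⟨1, h⟩) : StrictMono f := by
  have key : ∀ k (h : k + 1 < N), f ⟨k, by omega⟩ < f ⟨k + 1, h⟩ := by
    intro k
    induction k with
    | zero => intro h; exact h1 h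
    | succ k ih =>
      intro h
      have h0 := ih (by omega)
      by_contra hc
      have hne : f ⟨k + 1, by omega⟩ ≠ f ⟨k + 1 + 1, h⟩ := fun e => by
        have := hf e; simp at this
      have hne' : f ⟨k, by omega⟩ ≠ f ⟨k + 1 + 1, h⟩ := fun e => by
        have := hf e; simp at this; omega
      have hlt := lt_of_le_of_ne (not_lt.1 hc) hne.symm
      rcases lt_or_gt_of_ne hne' with h2 | h2
      · exact (hb ⟨k, by omega⟩ ⟨k + 1, by omega⟩ ⟨k + 1 + 1, h⟩ rfl).1 h2 hlt
      · exact (hb ⟨k + 1, by omega⟩ ⟨k + 1 + 1, h⟩ ⟨k, by omega⟩ rfl).2 h2 h0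
  cases N with
  | zero => intro i; exact i.elim0
  | succ M =>
    rw [Fin.strictMono_iff_lt_succ]
    intro i
    exact key i (by omega)

theorem mono_or_anti {N : ℕ} (f : Fin N → ℝ) (hf : Function.Injective f)
    (hb : ∀ i j m : Fin N, (i : ℕ) + 1 = j → (f i < f m → f m < f j → False) ∧
      (f j < f m → f m < f i → False)) : StrictMono f ∨ StrictAnti f := by
  by_cases hN : 1 < N
  · rcases lt_trichotomy (f ⟨0, by omega⟩) (f ⟨1, hN⟩) with h | h | h
    · exact Or.inl (mono_aux f hf hb (fun _ => h))
    · have := hf h; simp at this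
    · right
      have := mono_aux (fun i => - f i) (fun i j e => hf (by simpa using e))
        (fun i j m hij => ⟨fun h1 h2 => (hb i j m hij).2 (by linarith) (by linarith),
          fun h1 h2 => (hb i j m hij).1 (by linarith) (by linarith)⟩) (fun _ => by simpa using h)
      intro i j hij
      have := this hij
      simp only at this; linarith
  · exact Or.inl (mono_aux f hf hb (fun h => absurd h hN))

theorem exists_key {N : ℕ} (hpl : IsPlaneDrawing G δ) (hab : G.Adj a b) (p : Fin N → V)
    (hp : Function.Injective p) (ha : ∀ i, G.Adj a (p i)) (hb : ∀ i, G.Adj b (p i))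
    (hc : ∀ i j : Fin N, (i : ℕ) + 1 = j → G.Adj (p i) (p j)) :
    ∃ (c : ℝ) (z : Fin N → ℝ), c ≠ 0 ∧ (∀ i, z i ≠ 0) ∧
      (∀ i, z i = c * (((δ b).1 - (δ a).1) * ((δ (p i)).2 - (δ a).2) -
        ((δ b).2 - (δ a).2) * ((δ (p i)).1 - (δ a).1))) ∧ Function.Injective z ∧
      (StrictMono (fun i => (z i)⁻¹) ∨ StrictAnti (fun i => (z i)⁻¹)) := by
  set d1 := (δ b).1 - (δ a).1 with hd1
  set d2 := (δ b).2 - (δ a).2 with hd2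
  have hD : 0 < d1 ^ 2 + d2 ^ 2 := by
    by_contra hn
    have e1 : d1 = 0 := by nlinarith [sq_nonneg d1, sq_nonneg d2]
    have e2 : d2 = 0 := by nlinarith [sq_nonneg d1, sq_nonneg d2]
    apply hab.ne
    apply hpl.1
    ext <;> linarith
  set c := (d1 ^ 2 + d2 ^ 2)⁻¹ with hcd
  have hc0 : c ≠ 0 := (inv_pos.2 hD).ne'
  have hcD : c * (d1 ^ 2 + d2 ^ 2) = 1 := inv_mul_cancel₀ hD.ne'
  let f : ℝ × ℝ → ℝ × ℝ := fun P =>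
    (c * (d1 * (P.2 - (δ a).2) - d2 * (P.1 - (δ a).1)),
     c * (d1 * (P.1 - (δ a).1) + d2 * (P.2 - (δ a).2)))
  have hf : Function.Injective f := by
    intro P Q h
    have h1 := mul_left_cancel₀ hc0 (congrArg Prod.fst h)
    have h2 := mul_left_cancel₀ hc0 (congrArg Prod.snd h)
    ext
    · apply mul_left_cancel₀ hD.ne'
      linear_combination d1 * h2 - d2 * h1
    · apply mul_left_cancel₀ hD.ne'
      linear_combination d2 * h2 + d1 * h1
  have hl : ∀ (s t : ℝ) P Q, s + t = 1 → f (s • P + t • Q) = s • f P + t • f Q := by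
    intro s t P Q hst
    obtain rfl : s = 1 - t := by linarith
    ext <;> simp [f] <;> ring
  have hn : Nor G (fun v => f (δ v)) a b := by
    refine ⟨plane_comp hpl f hf hl, hab, ?_, ?_, ?_, ?_⟩
    · simp [f]
    · simp [f]
    · simp only [f, ← hd1, ← hd2]; ring
    · simp only [f, ← hd1, ← hd2]; linarith
  have hinj : Function.Injective fun i => (f (δ (p i))).1 := by
    intro i j h
    by_contra hij
    exact hn.inj (ha i) (hb i) (ha j) (hb j) (fun e => hij (hp e)) h
  refine ⟨c, fun i => (f (δ (p i))).1, hc0, fun i => hn.ne_zero (ha i) (hb i), fun i => rfl,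
    hinj, ?_⟩
  apply mono_or_anti
  · intro i j h; exact hinj (inv_injective h)
  · intro i j m hij
    exact ⟨hn.between (ha i) (hb i) (ha j) (hb j) (ha m) (hb m) (hc i j hij),
      hn.between (ha j) (hb j) (ha i) (hb i) (ha m) (hb m) (hc i j hij).symm⟩


/-- line position of the path vertex with index `i` -/
noncomputable def pos (q : ℕ) (i : ℕ) : ℝ := ((i % q : ℕ) : ℝ) * q - ((i / q : ℕ) : ℝ)

theorem lat {x y c d q : ℕ} (hc : c < q) (h : x * q + d < y * q + c) : x ≤ y := by
  by_contra hh
  have h1 : y + 1 ≤ x := by omega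
  have h2 : (y + 1) * q ≤ x * q := Nat.mul_le_mul_right q h1
  nlinarith

theorem lat' {x y c d q : ℕ} (hc : c < q) (h : x * q + d = y * q + c) : x ≤ y := by
  by_contra hh
  have h1 : y + 1 ≤ x := by omega
  have h2 : (y + 1) * q ≤ x * q := Nat.mul_le_mul_right q h1
  nlinarith

theorem pos_lt_x {q i j : ℕ} (hi : i < q * q) (h : pos q i < pos q j) : i % q ≤ j % q := by
  have hq : i / q < q := Nat.div_lt_of_lt_mul hi
  unfold pos at h
  have h3 : i % q * q + j / q < j % q * q + i / q := by
    have : ((i % q * q + j / q : ℕ) : ℝ) < ((j % q * q + i / q : ℕ) : ℝ) := by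
      push_cast; linarith
    exact_mod_cast this
  exact lat hq h3

theorem pos_lt_x' {q i j : ℕ} (hi : i < q * q) (h : pos q i < pos q j) (hij : i < j) :
    i % q < j % q := by
  refine lt_of_le_of_ne (pos_lt_x hi h) ?_
  intro e
  unfold pos at h
  rw [e] at h
  have h1 : j / q < i / q := by
    have : ((j / q : ℕ) : ℝ) < ((i / q : ℕ) : ℝ) := by linarith
    exact_mod_cast this
  exact absurd (Nat.div_le_div_right (c := q) hij.le) (by omega)

theorem pos_gt {q i j : ℕ} (hi : j < q * q) (h : pos q j < pos q i) (hij : i < j) :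
    i / q < j / q := by
  refine lt_of_le_of_ne (Nat.div_le_div_right (c := q) hij.le) ?_
  intro e
  have h1 := pos_lt_x hi h
  have h2 := Nat.div_add_mod i q
  have h3 := Nat.div_add_mod j q
  rw [e] at h2
  omega

theorem pos_inj {q i j : ℕ} (hi : i < q * q) (hj : j < q * q) (h : pos q i = pos q j) :
    i = j := by
  have h1 : i / q < q := Nat.div_lt_of_lt_mul hi
  have h1' : j / q < q := Nat.div_lt_of_lt_mul hj
  unfold pos at h
  have h3 : i % q * q + j / q = j % q * q + i / q := by
    have : ((i % q * q + j / q : ℕ) : ℝ) = ((j % q * q + i / q : ℕ) : ℝ) := by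
      push_cast; linarith
    exact_mod_cast this
  have h4 : i % q = j % q := le_antisymm (lat' h1 h3) (lat' h1' h3.symm)
  rw [h4] at h3
  have h5 : i / q = j / q := by omega
  rw [← Nat.div_add_mod i q, ← Nat.div_add_mod j q, h4, h5]

theorem pos_gt_neg {q i : ℕ} (hi : i < q * q) : -(q : ℝ) < pos q i := by
  have h1 : i / q < q := Nat.div_lt_of_lt_mul hi
  have : ((i / q : ℕ) : ℝ) < q := by exact_mod_cast h1
  unfold pos
  have : (0 : ℝ) ≤ ((i % q : ℕ) : ℝ) * q := by positivity
  linarith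

theorem count {q : ℕ} (hq : 0 < q) (F : Set (Fin (q * q))) (X k : ℝ) (hk : k ≠ 0)
    (z : Fin (q * q) → ℝ) (hz0 : ∀ i, z i ≠ 0) (hz : ∀ i ∈ F, z i = k * (X - pos q i))
    (hm : StrictMono (fun i => (z i)⁻¹) ∨ StrictAnti (fun i => (z i)⁻¹)) :
    ∃ g : Fin (q * q) → ℕ, (∀ i, g i < q) ∧
      Set.InjOn (fun i => g i + if X < pos q i then 1 else 0) F := by
  have hX : ∀ i ∈ F, pos q i ≠ X := by
    intro i hi e
    apply hz0 i
    rw [hz i hi, e]; ring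
  have ht : ∀ i ∈ F, (X - pos q i)⁻¹ = k * (z i)⁻¹ := by
    intro i hi
    rw [hz i hi, mul_inv, ← mul_assoc, mul_inv_cancel₀ hk, one_mul]
  have hm' : (∀ i ∈ F, ∀ j ∈ F, i < j → (X - pos q i)⁻¹ < (X - pos q j)⁻¹) ∨
      (∀ i ∈ F, ∀ j ∈ F, i < j → (X - pos q j)⁻¹ < (X - pos q i)⁻¹) := by
    rcases lt_or_gt_of_ne hk with hk | hk <;> rcases hm with hm | hm
    · right; intro i hi j hj hij
      rw [ht i hi, ht j hj]; exact mul_lt_mul_of_neg_left (hm hij) hk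
    · left; intro i hi j hj hij
      rw [ht i hi, ht j hj]; exact mul_lt_mul_of_neg_left (hm hij) hk
    · left; intro i hi j hj hij
      rw [ht i hi, ht j hj]; exact mul_lt_mul_of_pos_left (hm hij) hk
    · right; intro i hi j hj hij
      rw [ht i hi, ht j hj]; exact mul_lt_mul_of_pos_left (hm hij) hk
  have inj : ∀ φ : Fin (q * q) → ℕ, (∀ i ∈ F, ∀ j ∈ F, i < j → φ i ≠ φ j) → Set.InjOn φ F := by
    intro φ h i hi j hj e
    rcases lt_trichotomy i j with c | c | c
    · exact absurd e (h i hi j hj c)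
    · exact c
    · exact absurd e.symm (h j hj i hi c)
  -- same-side comparison
  have same : ∀ x y : ℝ, (X < x ↔ X < y) → x ≠ X → y ≠ X → (X - x)⁻¹ < (X - y)⁻¹ → x < y := by
    intro x y hs hx hy h
    by_cases c : X < x
    · have c' := hs.1 c
      rw [← neg_lt_neg_iff, ← inv_neg, ← inv_neg, inv_lt_inv₀ (by linarith) (by linarith)] at h
      linarith
    · have c' : ¬ X < y := fun h => c (hs.2 h)
      have c1 := lt_of_le_of_ne (not_lt.1 c) hx
      have c2 := lt_of_le_of_ne (not_lt.1 c') hy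
      rw [inv_lt_inv₀ (by linarith) (by linarith)] at h
      linarith
  have opp : ∀ x y : ℝ, x < X → X < y → (X - x)⁻¹ < (X - y)⁻¹ → False := by
    intro x y hx hy h
    have h1 : 0 < (X - x)⁻¹ := inv_pos.2 (by linarith)
    have h2 : (X - y)⁻¹ < 0 := inv_lt_zero.2 (by linarith)
    linarith
  rcases hm' with hm | hm
  · refine ⟨fun i => (i : ℕ) % q, fun i => Nat.mod_lt _ hq, inj _ ?_⟩
    intro i hi j hj hij
    have h := hm i hi j hj hij
    by_cases c1 : X < pos q i <;> by_cases c2 : X < pos q j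
    · have := pos_lt_x' i.2 (same _ _ (by tauto) (hX i hi) (hX j hj) h) hij
      simp only [c1, c2, if_true]; omega
    · have := pos_lt_x j.2 (lt_of_le_of_lt (not_lt.1 c2) c1)
      simp only [c1, c2, if_true, if_false]; omega
    · exact (opp _ _ (lt_of_le_of_ne (not_lt.1 c1) (hX i hi)) c2 h).elim
    · have := pos_lt_x' i.2 (same _ _ (by tauto) (hX i hi) (hX j hj) h) hij
      simp only [c1, c2, if_false]; omega
  · refine ⟨fun i => (i : ℕ) / q, fun i => Nat.div_lt_of_lt_mul i.2, inj _ ?_⟩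
    intro i hi j hj hij
    have h := hm i hi j hj hij
    by_cases c1 : X < pos q i <;> by_cases c2 : X < pos q j
    · have := pos_gt j.2 (same _ _ (by tauto) (hX j hj) (hX i hi) h) hij
      simp only [c1, c2, if_true]; omega
    · exact (opp _ _ (lt_of_le_of_ne (not_lt.1 c2) (hX j hj)) c1 h).elim
    · have := Nat.div_le_div_right (c := q) (show (i : ℕ) ≤ j from hij.le)
      simp only [c1, c2, if_true, if_false]; omega
    · have := pos_gt j.2 (same _ _ (by tauto) (hX j hj) (hX i hi) h) hij
      simp only [c1, c2, if_false]; omega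

/-- bad drawing -/
noncomputable def bad (q : ℕ) : Bool ⊕ Fin (q * q) → ℝ × ℝ
  | .inl false => (-(q : ℝ), 0)
  | .inl true => (-(q : ℝ) - 1, 0)
  | .inr i => (pos q i, 0)

theorem bad_inj (q : ℕ) : Function.Injective (bad q) := by
  have key : ∀ i : Fin (q * q), -(q : ℝ) < pos q i := fun i => pos_gt_neg i.2
  rintro ((_ | _) | i) ((_ | _) | j) h
  all_goals have h' := congrArg Prod.fst h; simp only [bad] at h'
  · rfl
  · linarith
  · linarith [key j]
  · linarith
  · rfl
  · linarith [key j]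
  · linarith [key i]
  · linarith [key i]
  · rw [Fin.ext (pos_inj i.2 j.2 h')]

theorem bound {q : ℕ} (hq : 2 ≤ q) {G : SimpleGraph (Bool ⊕ Fin (q * q))}
    (hab : G.Adj (.inl false) (.inl true)) (ha : ∀ i, G.Adj (.inl false) (.inr i))
    (hb : ∀ i, G.Adj (.inl true) (.inr i))
    (hc : ∀ i j : Fin (q * q), (i : ℕ) + 1 = j → G.Adj (.inr i) (.inr j))
    {δ : Bool ⊕ Fin (q * q) → ℝ × ℝ} (hpl : IsPlaneDrawing G δ) :
    {v | δ v = bad q v}.ncard ≤ q + 1 := by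
  obtain ⟨c, z, hc0, hz0, hz, hzi, hm⟩ := exists_key hpl hab Sum.inr Sum.inr_injective ha hb hc
  set A := δ (.inl false) with hA
  set B := δ (.inl true) with hB
  set F : Set (Fin (q * q)) := {i | δ (.inr i) = bad q (.inr i)} with hF
  set S := {v | δ v = bad q v} with hS
  have hzF : ∀ i ∈ F, z i = c * ((B.1 - A.1) * (0 - A.2) - (B.2 - A.2) * (pos q i - A.1)) := by
    intro i hi
    rw [hz i, show δ (.inr i) = bad q (.inr i) from hi]
    simp [bad]
  have sub3 : S ⊆ insert (.inl false) (insert (.inl true) (Sum.inr '' F)) := by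
    rintro ((_ | _) | i) hv
    · simp
    · simp
    · right; right; exact ⟨_, hv, rfl⟩
  have cardF : (Sum.inr '' F : Set (Bool ⊕ Fin (q * q))).ncard = F.ncard :=
    Set.ncard_image_of_injective _ Sum.inr_injective
  by_cases h12 : B.2 - A.2 = 0
  · have hF1 : F.ncard ≤ 1 := by
      rw [Set.ncard_le_one_iff]
      intro i j hi hj
      apply hzi
      rw [hzF i hi, hzF j hj, h12]; ring
    have h1 := Set.ncard_le_ncard sub3 (Set.toFinite _)
    have h2 := Set.ncard_insert_le (Sum.inl false) (insert (.inl true) (Sum.inr '' F))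
    have h3 := Set.ncard_insert_le (Sum.inl true) (Sum.inr '' F)
    omega
  set X := A.1 - (B.1 - A.1) * A.2 / (B.2 - A.2) with hX
  have hXB : (B.2 - A.2) * (X - A.1) = - (B.1 - A.1) * A.2 := by
    rw [hX]; field_simp; ring
  obtain ⟨g, hg, hinj⟩ := count (by omega) F X (c * (B.2 - A.2)) (mul_ne_zero hc0 h12) z hz0
    (fun i hi => by rw [hzF i hi]; linear_combination (-c) * hXB) hm
  have hleft : (∀ i : Fin (q * q), X < pos q i) → F.ncard ≤ q := by
    intro hall
    have : F.ncard ≤ ((Finset.range q : Finset ℕ) : Set ℕ).ncard := by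
      refine Set.ncard_le_ncard_of_injOn g (fun i _ => by simpa using hg i) ?_ (Set.toFinite _)
      intro i hi j hj e
      apply hinj hi hj
      simp [hall, e]
    simpa using this
  have hgen : F.ncard ≤ q + 1 := by
    have : F.ncard ≤ ((Finset.range (q + 1) : Finset ℕ) : Set ℕ).ncard := by
      refine Set.ncard_le_ncard_of_injOn _ (fun i _ => ?_) hinj (Set.toFinite _)
      have := hg i
      simp only [Finset.coe_range, Set.mem_Iio]
      split_ifs <;> omega
    simpa using this
  by_cases hfa : A = bad q (.inl false)
  · have hfb : ¬ B = bad q (.inl true) := by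
      intro hfb
      apply h12; rw [hfa, hfb]; simp [bad]
    have h1 : F.ncard ≤ q := by
      apply hleft
      intro i
      rw [hX, hfa]
      simpa [bad] using pos_gt_neg i.2
    have sub : S ⊆ insert (.inl false) (Sum.inr '' F) := by
      intro v hv
      rcases sub3 hv with h | h | h
      · left; exact h
      · subst h; exact absurd hv hfb
      · right; exact h
    have h2 := Set.ncard_le_ncard sub (Set.toFinite _)
    have h3 := Set.ncard_insert_le (Sum.inl false) (Sum.inr '' F)
    omega
  by_cases hfb : B = bad q (.inl true)
  · have h1 : F.ncard ≤ q := by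
      apply hleft
      intro i
      have hXe : X = B.1 := by
        have hB2 : B.2 = 0 := by rw [hfb]; simp [bad]
        apply mul_left_cancel₀ h12
        rw [hB2] at hXB ⊢
        linear_combination hXB
      rw [hXe, hfb]
      have := pos_gt_neg i.2
      simp [bad]; linarith
    have sub : S ⊆ insert (.inl true) (Sum.inr '' F) := by
      intro v hv
      rcases sub3 hv with h | h | h
      · subst h; exact absurd hv hfa
      · left; exact h
      · right; exact h
    have h2 := Set.ncard_le_ncard sub (Set.toFinite _)
    have h3 := Set.ncard_insert_le (Sum.inl true) (Sum.inr '' F)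
    omega
  · have sub : S ⊆ (Sum.inr '' F) := by
      intro v hv
      rcases sub3 hv with h | h | h
      · subst h; exact absurd hv hfa
      · subst h; exact absurd hv hfb
      · exact h
    have h2 := Set.ncard_le_ncard sub (Set.toFinite _)
    omega

/-- oriented edges -/
inductive R (N : ℕ) : Bool ⊕ Fin N → Bool ⊕ Fin N → Prop
  | ab : R N (.inl false) (.inl true)
  | av (i : Fin N) : R N (.inl false) (.inr i)
  | bv (i : Fin N) : R N (.inl true) (.inr i)
  | vv (i j : Fin N) (h : (i : ℕ) + 1 = j) : R N (.inr i) (.inr j)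

theorem R.ne {N : ℕ} {u v : Bool ⊕ Fin N} (h : R N u v) : u ≠ v := by
  cases h with
  | ab => simp
  | av i => simp
  | bv i => simp
  | vv i j h => intro e; have := Sum.inr_injective e; subst this; omega

/-- the graph -/
def Gr (N : ℕ) : SimpleGraph (Bool ⊕ Fin N) where
  Adj u v := R N u v ∨ R N v u
  symm := ⟨fun _ _ h => h.symm⟩
  loopless := ⟨fun _ h => h.elim (fun h => h.ne rfl) (fun h => h.ne rfl)⟩

/-- good drawing -/
def good (N : ℕ) : Bool ⊕ Fin N → ℝ × ℝ
  | .inl false => (0, -1)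
  | .inl true => (0, 1)
  | .inr i => (((i : ℕ) : ℝ) + 1, 0)

/-- description of points on an edge -/
def Desc (N : ℕ) : Bool ⊕ Fin N → Bool ⊕ Fin N → ℝ × ℝ → Prop
  | .inl false, .inl _, p => p.1 = 0
  | .inl false, .inr i, p => p.1 = (((i : ℕ) : ℝ) + 1) * (1 + p.2) ∧ p.2 ≤ 0
  | .inl true, .inr i, p => p.1 = (((i : ℕ) : ℝ) + 1) * (1 - p.2) ∧ 0 ≤ p.2
  | .inr i, .inr _, p => p.2 = 0 ∧ ((i : ℕ) : ℝ) + 1 ≤ p.1 ∧ p.1 ≤ ((i : ℕ) : ℝ) + 2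
  | _, _, _ => False

theorem desc {N : ℕ} {u v : Bool ⊕ Fin N} (h : R N u v) {p : ℝ × ℝ}
    (hp : p ∈ segment ℝ (good N u) (good N v)) : Desc N u v p := by
  obtain ⟨s, h0, h1, hx, hy⟩ := mem_seg hp
  cases h with
  | ab => simpa [good, Desc] using hx
  | av i =>
    simp only [good, Desc] at hx hy ⊢
    constructor
    · rw [hx, hy]; ring
    · linarith
  | bv i =>
    simp only [good, Desc] at hx hy ⊢
    constructor
    · rw [hx, hy]; ring
    · linarith
  | vv i j h =>
    have : ((j : ℕ) : ℝ) = ((i : ℕ) : ℝ) + 1 := by exact_mod_cast h.symm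
    simp only [good, Desc, this] at hx hy ⊢
    refine ⟨by linarith, by linarith, by linarith⟩

theorem good_vert {N : ℕ} {u v w : Bool ⊕ Fin N} (h : R N u v)
    (hp : good N w ∈ segment ℝ (good N u) (good N v)) : w = u ∨ w = v := by
  have hd := desc h hp
  cases h with
  | ab =>
    rcases w with (_ | _) | k
    · simp
    · simp
    · simp only [good, Desc] at hd
      have : (0 : ℝ) ≤ ((k : ℕ) : ℝ) := by positivity
      linarith
  | av i =>
    have hi : (0 : ℝ) ≤ ((i : ℕ) : ℝ) := by positivity
    rcases w with (_ | _) | k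
    · simp
    · simp only [good, Desc] at hd; linarith
    · simp [good, Desc] at hd
      right; rw [Fin.ext hd]
  | bv i =>
    have hi : (0 : ℝ) ≤ ((i : ℕ) : ℝ) := by positivity
    rcases w with (_ | _) | k
    · simp only [good, Desc] at hd; linarith
    · simp
    · simp [good, Desc] at hd
      right; rw [Fin.ext hd]
  | vv i j h =>
    rcases w with (_ | _) | k
    · simp [good, Desc] at hd
    · simp [good, Desc] at hd
    · simp only [good, Desc] at hd
      have h1 : (i : ℕ) ≤ k := by
        have : ((i : ℕ) : ℝ) ≤ ((k : ℕ) : ℝ) := by linarith [hd.2.1]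
        exact_mod_cast this
      have h2 : (k : ℕ) ≤ i + 1 := by
        have : ((k : ℕ) : ℝ) ≤ ((i : ℕ) : ℝ) + 1 := by linarith [hd.2.2]
        exact_mod_cast this
      rcases Nat.lt_or_ge i k with c | c
      · right; congr 1; apply Fin.ext; omega
      · left; congr 1; apply Fin.ext; omega

theorem good_edge {N : ℕ} {u v c d : Bool ⊕ Fin N} (h : R N u v) (h' : R N c d)
    (hne : ¬ (u = c ∧ v = d)) {p : ℝ × ℝ} (hp : Desc N u v p) (hp' : Desc N c d p) :
    ∃ w, (w = u ∨ w = v) ∧ (w = c ∨ w = d) ∧ p = good N w := by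
  have pos : ∀ i : Fin N, (0 : ℝ) < ((i : ℕ) : ℝ) + 1 := fun i => by positivity
  have abav : ∀ i : Fin N, Desc N (.inl false) (.inl true) p → Desc N (.inl false) (.inr i) p →
      p = good N (.inl false) := by
    intro i h1 h2
    simp only [Desc] at h1 h2
    have h3 := h2.1
    rw [h1, eq_comm, mul_eq_zero] at h3
    ext
    · exact h1
    · have := h3.resolve_left (pos i).ne'; simp only [good]; linarith
  have abbv : ∀ i : Fin N, Desc N (.inl false) (.inl true) p → Desc N (.inl true) (.inr i) p →
      p = good N (.inl true) := by
    intro i h1 h2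
    simp only [Desc] at h1 h2
    have h3 := h2.1
    rw [h1, eq_comm, mul_eq_zero] at h3
    ext
    · exact h1
    · have := h3.resolve_left (pos i).ne'; simp only [good]; linarith
  have abvv : ∀ i j : Fin N, Desc N (.inl false) (.inl true) p → Desc N (.inr i) (.inr j) p →
      False := by
    intro i j h1 h2
    simp only [Desc] at h1 h2
    linarith [pos i, h2.2.1]
  have avbv : ∀ i j : Fin N, Desc N (.inl false) (.inr i) p → Desc N (.inl true) (.inr j) p →
      j = i ∧ p = good N (.inr i) := by
    intro i j h1 h2
    simp only [Desc] at h1 h2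
    have h3 : p.2 = 0 := le_antisymm h1.2 h2.2
    have h4 := h1.1
    have h5 := h2.1
    rw [h3] at h4 h5
    refine ⟨?_, ?_⟩
    · have : ((j : ℕ) : ℝ) = ((i : ℕ) : ℝ) := by linarith
      exact Fin.ext (by exact_mod_cast this)
    · ext
      · simp only [good]; linarith
      · exact h3
  have near : ∀ i j k : Fin N, (j : ℕ) + 1 = k → p.2 = 0 → p.1 = ((i : ℕ) : ℝ) + 1 →
      Desc N (.inr j) (.inr k) p → (i = j ∨ i = k) ∧ p = good N (.inr i) := by
    intro i j k hjk h2 h1 hd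
    simp only [Desc] at hd
    have g1 : (j : ℕ) ≤ i := by
      have : ((j : ℕ) : ℝ) ≤ ((i : ℕ) : ℝ) := by linarith [hd.2.1]
      exact_mod_cast this
    have g2 : (i : ℕ) ≤ j + 1 := by
      have : ((i : ℕ) : ℝ) ≤ ((j : ℕ) : ℝ) + 1 := by linarith [hd.2.2]
      exact_mod_cast this
    refine ⟨?_, Prod.ext h1 h2⟩
    rcases Nat.lt_or_ge j i with c | c
    · right; apply Fin.ext; omega
    · left; apply Fin.ext; omega
  have avvv : ∀ i j k : Fin N, (j : ℕ) + 1 = k → Desc N (.inl false) (.inr i) p →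
      Desc N (.inr j) (.inr k) p → (i = j ∨ i = k) ∧ p = good N (.inr i) := by
    intro i j k hjk h1 h2
    refine near i j k hjk h2.1 ?_ h2
    have := h1.1
    rw [h2.1] at this; linarith
  have bvvv : ∀ i j k : Fin N, (j : ℕ) + 1 = k → Desc N (.inl true) (.inr i) p →
      Desc N (.inr j) (.inr k) p → (i = j ∨ i = k) ∧ p = good N (.inr i) := by
    intro i j k hjk h1 h2
    refine near i j k hjk h2.1 ?_ h2
    have := h1.1
    rw [h2.1] at this; linarith
  have vvvv : ∀ i j k l : Fin N, (i : ℕ) + 1 = j → (k : ℕ) + 1 = l → i < k →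
      Desc N (.inr i) (.inr j) p → Desc N (.inr k) (.inr l) p →
      j = k ∧ p = good N (.inr k) := by
    intro i j k l hij hkl hik h1 h2
    simp only [Desc] at h1 h2
    have hik' : (i : ℕ) + 1 ≤ k := hik
    have e1 : ((i : ℕ) : ℝ) + 1 ≤ ((k : ℕ) : ℝ) := by exact_mod_cast hik'
    have e2 : (k : ℕ) ≤ i + 1 := by
      have : ((k : ℕ) : ℝ) ≤ ((i : ℕ) : ℝ) + 1 := by linarith [h1.2.2, h2.2.1]
      exact_mod_cast this
    refine ⟨Fin.ext (by omega), Prod.ext ?_ h1.1⟩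
    simp only [good]
    linarith [h1.2.2, h2.2.1]
  cases h with
  | ab =>
    cases h' with
    | ab => exact absurd ⟨rfl, rfl⟩ hne
    | av i => exact ⟨_, .inl rfl, .inl rfl, abav i hp hp'⟩
    | bv i => exact ⟨_, .inr rfl, .inl rfl, abbv i hp hp'⟩
    | vv i j h => exact (abvv i j hp hp').elim
  | av i =>
    cases h' with
    | ab => exact ⟨_, .inl rfl, .inl rfl, abav i hp' hp⟩
    | av j =>
      refine ⟨_, .inl rfl, .inl rfl, ?_⟩
      have h1 := hp.1
      have h2 := hp'.1
      have h3 : (((i : ℕ) : ℝ) - ((j : ℕ) : ℝ)) * (1 + p.2) = 0 := by linarith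
      rcases mul_eq_zero.1 h3 with c | c
      · exfalso; apply hne
        have : ((i : ℕ) : ℝ) = ((j : ℕ) : ℝ) := by linarith
        have : i = j := Fin.ext (by exact_mod_cast this)
        exact ⟨rfl, by rw [this]⟩
      · rw [c] at h1
        ext
        · simp only [good]; linarith
        · simp only [good]; linarith
    | bv j =>
      obtain ⟨rfl, e⟩ := avbv i j hp hp'
      exact ⟨_, .inr rfl, .inr rfl, e⟩
    | vv j k h =>
      obtain ⟨rfl | rfl, e⟩ := avvv i j k h hp hp'
      · exact ⟨_, .inr rfl, .inl rfl, e⟩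
      · exact ⟨_, .inr rfl, .inr rfl, e⟩
  | bv i =>
    cases h' with
    | ab => exact ⟨_, .inl rfl, .inr rfl, abbv i hp' hp⟩
    | av j =>
      obtain ⟨rfl, e⟩ := avbv j i hp' hp
      exact ⟨_, .inr rfl, .inr rfl, e⟩
    | bv j =>
      refine ⟨_, .inl rfl, .inl rfl, ?_⟩
      have h1 := hp.1
      have h2 := hp'.1
      have h3 : (((i : ℕ) : ℝ) - ((j : ℕ) : ℝ)) * (1 - p.2) = 0 := by linarith
      rcases mul_eq_zero.1 h3 with c | c
      · exfalso; apply hne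
        have : ((i : ℕ) : ℝ) = ((j : ℕ) : ℝ) := by linarith
        have : i = j := Fin.ext (by exact_mod_cast this)
        exact ⟨rfl, by rw [this]⟩
      · rw [c] at h1
        ext
        · simp only [good]; linarith
        · simp only [good]; linarith
    | vv j k h =>
      obtain ⟨rfl | rfl, e⟩ := bvvv i j k h hp hp'
      · exact ⟨_, .inr rfl, .inl rfl, e⟩
      · exact ⟨_, .inr rfl, .inr rfl, e⟩
  | vv i j h =>
    cases h' with
    | ab => exact (abvv i j hp' hp).elim
    | av k =>
      obtain ⟨rfl | rfl, e⟩ := avvv k i j h hp' hp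
      · exact ⟨_, .inl rfl, .inr rfl, e⟩
      · exact ⟨_, .inr rfl, .inr rfl, e⟩
    | bv k =>
      obtain ⟨rfl | rfl, e⟩ := bvvv k i j h hp' hp
      · exact ⟨_, .inl rfl, .inr rfl, e⟩
      · exact ⟨_, .inr rfl, .inr rfl, e⟩
    | vv k l h' =>
      rcases lt_trichotomy i k with c | c | c
      · obtain ⟨rfl, e⟩ := vvvv i j k l h h' c hp hp'
        exact ⟨_, .inr rfl, .inl rfl, e⟩
      · subst c
        exfalso; apply hne
        exact ⟨rfl, congrArg _ (Fin.ext (by omega))⟩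
      · obtain ⟨rfl, e⟩ := vvvv k l i j h' h c hp' hp
        exact ⟨_, .inl rfl, .inr rfl, e⟩

theorem good_plane (N : ℕ) : IsPlaneDrawing (Gr N) (good N) := by
  refine ⟨?_, ?_, ?_⟩
  · rintro ((_ | _) | i) ((_ | _) | j) h
    all_goals simp [good] at h ⊢
    · norm_num at h
    · norm_num at h
    · exact Fin.ext h
  · rintro u v w (h | h) hw
    · exact good_vert h hw
    · rw [segment_symm] at hw
      exact (good_vert h hw).symm
  · rintro u v c d (h | h) (h' | h') hne p hp hp'
    · exact good_edge h h' (by rintro ⟨rfl, rfl⟩; exact hne rfl) (desc h hp) (desc h' hp')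
    · rw [segment_symm] at hp'
      obtain ⟨w, h1, h2, h3⟩ := good_edge h h'
        (by rintro ⟨rfl, rfl⟩; exact hne (Set.pair_comm _ _)) (desc h hp) (desc h' hp')
      exact ⟨w, h1, h2.symm, h3⟩
    · rw [segment_symm] at hp
      obtain ⟨w, h1, h2, h3⟩ := good_edge h h'
        (by rintro ⟨rfl, rfl⟩; exact hne (Set.pair_comm _ _)) (desc h hp) (desc h' hp')
      exact ⟨w, h1.symm, h2, h3⟩
    · rw [segment_symm] at hp hp'
      obtain ⟨w, h1, h2, h3⟩ := good_edge h h'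
        (by rintro ⟨rfl, rfl⟩; exact hne rfl) (desc h hp) (desc h' hp')
      exact ⟨w, h1.symm, h2.symm, h3⟩

theorem plane_equiv {V W : Type*} {G : SimpleGraph V} {δ : V → ℝ × ℝ} (e : W ≃ V)
    (h : IsPlaneDrawing G δ) : IsPlaneDrawing (G.comap e) (δ ∘ e) := by
  obtain ⟨h1, h2, h3⟩ := h
  refine ⟨h1.comp e.injective, ?_, ?_⟩
  · intro u v w huv hw
    rcases h2 _ _ _ huv hw with h | h
    · exact Or.inl (e.injective h)
    · exact Or.inr (e.injective h)
  · intro u v c d huv hcd hne p hp hp'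
    obtain ⟨w, g1, g2, g3⟩ := h3 _ _ _ _ huv hcd (by
      intro he
      apply hne
      apply e.injective.image_injective
      simpa [Set.image_pair] using he) p hp hp'
    refine ⟨e.symm w, ?_, ?_, by simp [g3]⟩
    · rcases g1 with rfl | rfl <;> simp
    · rcases g2 with rfl | rfl <;> simp

end FixUB

/-- For every positive integer `n₀` there exists a planar graph `G` with some number
`n ≥ n₀` of vertices such that `fix(G) ≤ √(n-2) + 1`, i.e. there is a straight-line
drawing `δ` of `G` such that every plane straight-line drawing of `G` fixes at most
`√(n-2) + 1` vertices of `δ`. -/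
theorem planar_fix_upper_bound (n₀ : ℕ) (hn₀ : 0 < n₀) :
    ∃ (n : ℕ) (G : SimpleGraph (Fin n)),
      n₀ ≤ n ∧
      (∃ δ : Fin n → ℝ × ℝ, IsPlaneDrawing G δ) ∧
      ∃ δ : Fin n → ℝ × ℝ, Function.Injective δ ∧
        ∀ δ' : Fin n → ℝ × ℝ, IsPlaneDrawing G δ' →
          ({v : Fin n | δ' v = δ v}.ncard : ℝ) ≤ Real.sqrt ((n : ℝ) - 2) + 1 := by
  obtain ⟨q, hq, hqn⟩ : ∃ q : ℕ, 2 ≤ q ∧ n₀ ≤ q := ⟨n₀ + 2, by omega, by omega⟩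
  have hcard : Fintype.card (Bool ⊕ Fin (q * q)) = q * q + 2 := by simp; omega
  let e : Fin (q * q + 2) ≃ Bool ⊕ Fin (q * q) := (Fintype.equivFinOfCardEq hcard).symm
  refine ⟨q * q + 2, (FixUB.Gr (q * q)).comap e, by nlinarith,
    ⟨_, FixUB.plane_equiv e (FixUB.good_plane (q * q))⟩, FixUB.bad q ∘ e,
    (FixUB.bad_inj q).comp e.injective, ?_⟩
  intro δ' h
  have h1 := FixUB.plane_equiv e.symm h
  have hG : ((FixUB.Gr (q * q)).comap e).comap e.symm = FixUB.Gr (q * q) := by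
    ext u v; simp
  rw [hG] at h1
  have h2 := FixUB.bound hq (G := FixUB.Gr (q * q)) (Or.inl .ab) (fun i => Or.inl (.av i))
    (fun i => Or.inl (.bv i)) (fun i j hij => Or.inl (.vv i j hij)) h1
  have h3 : {v : Fin (q * q + 2) | δ' v = (FixUB.bad q ∘ e) v}.ncard =
      {v | (δ' ∘ e.symm) v = FixUB.bad q v}.ncard := by
    rw [← Set.ncard_image_of_injective _ e.injective]
    congr 1
    ext v
    constructor
    · rintro ⟨w, hw, rfl⟩; simpa using hw
    · intro hv; exact ⟨e.symm v, by simpa using hv, by simp⟩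
  rw [h3]
  have h4 : Real.sqrt (((q * q + 2 : ℕ) : ℝ) - 2) = q := by
    push_cast
    rw [add_sub_cancel_right, Real.sqrt_mul_self (by positivity)]
  rw [h4]
  exact_mod_cast h2
end

section
/- For every positive integer n₀ there exists an outerplanar graph H with some number n ≥ n₀ of vertices such that fix(H) ≤ 2√(n−1) + 1. -/
/-- 2d determinant. -/
def dt (u w : ℝ × ℝ) : ℝ := u.1 * w.2 - u.2 * w.1

/-- `x` lies in the open cone spanned by `u` and `w`. -/
def Cone (u w x : ℝ × ℝ) : Prop := 0 < dt u w * dt u x ∧ 0 < dt u w * dt x w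

lemma dt_coords (u w x : ℝ × ℝ) (h : dt u w ≠ 0) :
    x = (dt x w / dt u w) • u + (dt u x / dt u w) • w := by
  ext
  · simp only [Prod.fst_add, Prod.smul_fst, smul_eq_mul]
    field_simp
    simp only [dt]; ring
  · simp only [Prod.snd_add, Prod.smul_snd, smul_eq_mul]
    field_simp
    simp only [dt]; ring

lemma dt_comb_left (u w : ℝ × ℝ) (a b : ℝ) : dt (a • u + b • w) w = a * dt u w := by
  simp [dt]; ring
lemma dt_comb_right (u w : ℝ × ℝ) (a b : ℝ) : dt u (a • u + b • w) = b * dt u w := by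
  simp [dt]; ring
lemma dt_comb_both (u w : ℝ × ℝ) (a b c d : ℝ) :
    dt (a • u + b • w) (c • u + d • w) = (a * d - b * c) * dt u w := by
  simp [dt]; ring

lemma cone_comb (u w : ℝ × ℝ) (a b : ℝ) (h : dt u w ≠ 0) :
    Cone u w (a • u + b • w) ↔ 0 < a ∧ 0 < b := by
  have h2 : 0 < dt u w * dt u w := mul_self_pos.mpr h
  have e1 : dt u w * (b * dt u w) = b * (dt u w * dt u w) := by ring
  have e2 : dt u w * (a * dt u w) = a * (dt u w * dt u w) := by ring
  unfold Cone
  rw [dt_comb_left, dt_comb_right, e1, e2, mul_pos_iff_of_pos_right h2,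
    mul_pos_iff_of_pos_right h2]
  tauto

lemma cone_ne {u w x : ℝ × ℝ} (h : Cone u w x) : dt u w ≠ 0 := by
  rintro h0
  have := h.1
  rw [h0] at this
  simp at this

lemma cone_step (u w x y : ℝ × ℝ)
    (hx : Disjoint (segment ℝ 0 x) (segment ℝ u w))
    (hu : Disjoint (segment ℝ x y) (segment ℝ 0 u))
    (hw : Disjoint (segment ℝ x y) (segment ℝ 0 w))
    (huw : Disjoint (segment ℝ x y) (segment ℝ u w))
    (h : Cone u w x) : Cone u w y := by
  have hD := cone_ne h
  obtain ⟨a, b, rfl⟩ : ∃ a b : ℝ, x = a • u + b • w := ⟨_, _, dt_coords u w x hD⟩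
  obtain ⟨c, d, rfl⟩ : ∃ a b : ℝ, y = a • u + b • w := ⟨_, _, dt_coords u w y hD⟩
  rw [cone_comb u w _ _ hD] at h ⊢
  obtain ⟨ha, hb⟩ := h
  have hab : a + b < 1 := by
    by_contra! hge
    have hpos : 0 < a + b := by linarith
    refine Set.disjoint_left.mp hx
      (show (a / (a + b)) • u + (b / (a + b)) • w ∈ segment ℝ 0 (a • u + b • w) from ?_) ?_
    · refine ⟨1 - 1 / (a + b), 1 / (a + b), ?_, by positivity, by ring, ?_⟩
      · have : 1 / (a + b) ≤ 1 := by rw [div_le_one hpos]; exact hge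
        linarith
      · simp only [smul_zero, zero_add, smul_add, smul_smul]
        congr 2 <;> ring
    · exact ⟨_, _, by positivity, by positivity, by field_simp, rfl⟩
  by_contra hcd
  let A : ℝ → ℝ := fun t => (1 - t) * a + t * c
  let B : ℝ → ℝ := fun t => (1 - t) * b + t * d
  let f : ℝ → ℝ := fun t => min (min (A t) (B t)) (1 - A t - B t)
  have hf : ContinuousOn f (Set.Icc 0 1) := by
    apply Continuous.continuousOn
    simp only [f, A, B]
    fun_prop
  have hf0 : 0 ≤ f 0 := by
    simp only [f, A, B, le_min_iff]
    refine ⟨⟨?_, ?_⟩, ?_⟩ <;> nlinarith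
  have hf1 : f 1 ≤ 0 := by
    simp only [f, A, B, min_le_iff]
    by_contra! h1
    apply hcd
    constructor <;> linarith [h1.1.1, h1.1.2]
  obtain ⟨t, ⟨ht0, ht1⟩, ht⟩ := intermediate_value_Icc' (zero_le_one) hf ⟨hf1, hf0⟩
  have hA : 0 ≤ A t := by rw [← ht]; exact (min_le_left _ _).trans (min_le_left _ _)
  have hB : 0 ≤ B t := by rw [← ht]; exact (min_le_left _ _).trans (min_le_right _ _)
  have hC : 0 ≤ 1 - A t - B t := by rw [← ht]; exact min_le_right _ _
  have hmem : A t • u + B t • w ∈ segment ℝ (a • u + b • w) (c • u + d • w) := by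
    refine ⟨1 - t, t, by linarith, ht0, by ring, ?_⟩
    simp only [A, B]
    module
  have hcase : A t = 0 ∨ B t = 0 ∨ 1 - A t - B t = 0 := by
    simp only [f] at ht
    rcases min_choice (min (A t) (B t)) (1 - A t - B t) with h1 | h1
    · rcases min_choice (A t) (B t) with h2 | h2
      · left; rw [h1, h2] at ht; exact ht
      · right; left; rw [h1, h2] at ht; exact ht
    · right; right; rw [h1] at ht; exact ht
  rcases hcase with h0 | h0 | h0
  · refine Set.disjoint_left.mp hw hmem ⟨1 - B t, B t, by linarith, hB, by ring, ?_⟩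
    rw [h0]; simp
  · refine Set.disjoint_left.mp hu hmem ⟨1 - A t, A t, by linarith, hA, by ring, ?_⟩
    rw [h0]; simp
  · exact Set.disjoint_left.mp huw hmem ⟨A t, B t, hA, hB, by linarith, rfl⟩

lemma cone_sep (d e u w : ℝ × ℝ)
    (hwd : ∀ r : ℝ, 0 < r → w ≠ r • d) (hwe : ∀ r : ℝ, 0 < r → w ≠ r • e)
    (h0 : (0 : ℝ × ℝ) ∉ segment ℝ u w)
    (hiff : Cone u w d ↔ Cone u w e)
    (h : Cone d e u) : Cone d e w := by
  have hD := cone_ne h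
  obtain ⟨a, b, rfl⟩ : ∃ a b : ℝ, u = a • d + b • e := ⟨_, _, dt_coords d e u hD⟩
  obtain ⟨r, s, rfl⟩ : ∃ a b : ℝ, w = a • d + b • e := ⟨_, _, dt_coords d e w hD⟩
  rw [cone_comb d e _ _ hD] at h ⊢
  obtain ⟨ha, hb⟩ := h
  by_contra hrs
  have h2 : 0 < dt d e * dt d e := mul_self_pos.mpr hD
  have e1 : Cone (a • d + b • e) (r • d + s • e) d ↔
      0 < (a * s - b * r) * (-b) ∧ 0 < (a * s - b * r) * s := by
    unfold Cone
    rw [dt_comb_both]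
    have : (a * s - b * r) * dt d e * dt (a • d + b • e) d
      = ((a * s - b * r) * (-b)) * (dt d e * dt d e) := by simp [dt]; ring
    rw [this]
    have : (a * s - b * r) * dt d e * dt d (r • d + s • e)
      = ((a * s - b * r) * s) * (dt d e * dt d e) := by simp [dt]; ring
    rw [this, mul_pos_iff_of_pos_right h2, mul_pos_iff_of_pos_right h2]
  have e2 : Cone (a • d + b • e) (r • d + s • e) e ↔
      0 < (a * s - b * r) * a ∧ 0 < (a * s - b * r) * (-r) := by
    unfold Cone
    rw [dt_comb_both]
    have : (a * s - b * r) * dt d e * dt (a • d + b • e) e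
      = ((a * s - b * r) * a) * (dt d e * dt d e) := by simp [dt]; ring
    rw [this]
    have : (a * s - b * r) * dt d e * dt e (r • d + s • e)
      = ((a * s - b * r) * (-r)) * (dt d e * dt d e) := by simp [dt]; ring
    rw [this, mul_pos_iff_of_pos_right h2, mul_pos_iff_of_pos_right h2]
  rw [e1, e2] at hiff
  rcases lt_trichotomy (a * s - b * r) 0 with hlt | heq | hgt
  · have h3 : ¬ (0 < (a * s - b * r) * a ∧ 0 < (a * s - b * r) * (-r)) := by
      rintro ⟨h, -⟩; nlinarith
    have h4 : 0 ≤ s := by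
      by_contra! hs
      exact h3 (hiff.mp ⟨by nlinarith, by nlinarith⟩)
    have h5 : 0 < r := by
      by_contra! hr
      nlinarith
    rcases h4.eq_or_lt with h4 | h4
    · apply hwd r h5
      rw [← h4]; simp
    · exact hrs ⟨h5, h4⟩
  · apply h0
    have hr : r ≤ 0 := by
      by_contra! hr
      apply hrs ⟨hr, ?_⟩
      by_contra! hs
      nlinarith
    refine ⟨-r / (a - r), a / (a - r), div_nonneg (by linarith) (by linarith),
      div_nonneg (by linarith) (by linarith), ?_, ?_⟩
    · have : a - r ≠ 0 := by linarith
      field_simp; ring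
    · have : a - r ≠ 0 := by linarith
      have h6 : (-r / (a - r)) • (a • d + b • e) + (a / (a - r)) • (r • d + s • e)
        = ((a * s - b * r) / (a - r)) • e := by
        match_scalars <;> field_simp <;> ring
      rw [h6, heq]; simp
  · have h3 : ¬ (0 < (a * s - b * r) * (-b) ∧ 0 < (a * s - b * r) * s) := by
      rintro ⟨h, -⟩; nlinarith
    have h4 : 0 ≤ r := by
      by_contra! hs
      exact h3 (hiff.mpr ⟨by nlinarith, by nlinarith⟩)
    have h5 : 0 < s := by
      by_contra! hr
      nlinarith
    rcases h4.eq_or_lt with h4 | h4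
    · apply hwe s h5
      rw [← h4]; simp
    · exact hrs ⟨h4, h5⟩

/-- path vertices with labels `≤ t` lie on one side of the rays through two vertices with
labels `> t`. -/
lemma fan_sep (N : ℕ) (v : ℕ → ℝ × ℝ)
    (h1 : ∀ i j, i < N → j < N → i ≠ j → ∀ r : ℝ, 0 < r → v i ≠ r • v j)
    (h2 : ∀ i j, i + 1 < N → j < N → j ≠ i → j ≠ i + 1 →
      Disjoint (segment ℝ 0 (v j)) (segment ℝ (v i) (v (i + 1))))
    (h3 : ∀ i j, i + 1 < N → j + 1 < N → j ≠ i → j ≠ i + 1 → j + 1 ≠ i →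
      Disjoint (segment ℝ (v j) (v (j + 1))) (segment ℝ (v i) (v (i + 1))))
    (h4 : ∀ i, i + 1 < N → (0 : ℝ × ℝ) ∉ segment ℝ (v i) (v (i + 1)))
    (a b d e : ℕ) (hd : d < N) (he : e < N)
    (had : a < d) (hae : a < e) (hbd : b < d) (hbe : b < e) :
    Cone (v d) (v e) (v a) ↔ Cone (v d) (v e) (v b) := by
  have step : ∀ i j, i + 1 < N → j + 1 < N → i + 1 < j →
      (Cone (v i) (v (i+1)) (v j) ↔ Cone (v i) (v (i+1)) (v (j+1))) := by
    intro i j hi hj hij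
    constructor
    · apply cone_step
      · exact h2 i j hi (by omega) (by omega) (by omega)
      · exact (h2 j i hj (by omega) (by omega) (by omega)).symm
      · exact (h2 j (i+1) hj (by omega) (by omega) (by omega)).symm
      · exact h3 i j hi hj (by omega) (by omega) (by omega)
    · apply cone_step
      · exact h2 i (j+1) hi (by omega) (by omega) (by omega)
      · rw [segment_symm]; exact (h2 j i hj (by omega) (by omega) (by omega)).symm
      · rw [segment_symm]; exact (h2 j (i+1) hj (by omega) (by omega) (by omega)).symm
      · rw [segment_symm]; exact h3 i j hi hj (by omega) (by omega) (by omega)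
  have steps : ∀ i j k, i + 1 < j → j + k < N →
      (Cone (v i) (v (i+1)) (v j) ↔ Cone (v i) (v (i+1)) (v (j+k))) := by
    intro i j k hij
    induction k with
    | zero => intro _; rfl
    | succ k ih =>
      intro hk
      rw [ih (by omega)]
      exact step i (j + k) (by omega) (by omega) (by omega)
  have stepsde : ∀ i, i + 1 < d → i + 1 < e →
      (Cone (v i) (v (i+1)) (v d) ↔ Cone (v i) (v (i+1)) (v e)) := by
    intro i hid hie
    rcases le_total d e with h | h
    · obtain ⟨k, rfl⟩ := Nat.exists_eq_add_of_le h
      exact steps i d k hid he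
    · obtain ⟨k, rfl⟩ := Nat.exists_eq_add_of_le h
      exact (steps i e k hie hd).symm
  have cone_swap : ∀ x y z : ℝ × ℝ, Cone x y z ↔ Cone y x z := by
    intro x y z
    have e1 : dt x y * dt x z = dt y x * dt z x := by simp only [dt]; ring
    have e2 : dt x y * dt z y = dt y x * dt y z := by simp only [dt]; ring
    unfold Cone
    rw [e1, e2]; tauto
  have one : ∀ i, i + 1 < d → i + 1 < e →
      (Cone (v d) (v e) (v i) ↔ Cone (v d) (v e) (v (i+1))) := by
    intro i hid hie
    constructor
    · apply cone_sep
      · exact h1 _ _ (by omega) (by omega) (by omega)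
      · exact h1 _ _ (by omega) (by omega) (by omega)
      · exact h4 i (by omega)
      · exact stepsde i hid hie
    · apply cone_sep
      · exact h1 _ _ (by omega) (by omega) (by omega)
      · exact h1 _ _ (by omega) (by omega) (by omega)
      · rw [segment_symm]; exact h4 i (by omega)
      · rw [cone_swap, cone_swap (v (i+1))]; exact stepsde i hid hie
  have all : ∀ i, i < d → i < e →
      (Cone (v d) (v e) (v 0) ↔ Cone (v d) (v e) (v i)) := by
    intro i
    induction i with
    | zero => intros; rfl
    | succ i ih =>
      intro hid hie
      rw [ih (by omega) (by omega)]
      exact one i hid hie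
  rw [← all a had hae, ← all b hbd hbe]

/-- the position of label `l` on the line -/
def posn (q l : ℕ) : ℤ := ((l % q : ℕ) : ℤ) * q - ((l / q : ℕ) : ℤ)

lemma posn_lt_iff (q x y : ℕ) (hx : x < q * q) (hy : y < q * q) :
    posn q x < posn q y ↔ x % q < y % q ∨ (x % q = y % q ∧ y / q < x / q) := by
  have hq : 0 < q := by
    rcases Nat.eq_zero_or_pos q with h | h
    · subst h; simp at hx
    · exact h
  have ax : x / q < q := Nat.div_lt_of_lt_mul hx
  have ay : y / q < q := Nat.div_lt_of_lt_mul hy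
  unfold posn
  generalize x / q = a at *
  generalize y / q = b at *
  generalize x % q = r at *
  generalize y % q = s at *
  rcases lt_trichotomy r s with h | h | h
  · have : ((r : ℤ) + 1) * q ≤ s * q := by gcongr; omega
    constructor
    · intro _; left; exact h
    · intro _; nlinarith
  · subst h; constructor
    · intro h; right; omega
    · intro h; omega
  · have : ((s : ℤ) + 1) * q ≤ r * q := by gcongr; omega
    constructor
    · intro h; exfalso; nlinarith
    · intro _; omega

lemma lab_lt_iff (q x y : ℕ) (hx : x < q * q) :
    x < y ↔ x / q < y / q ∨ (x / q = y / q ∧ x % q < y % q) := by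
  have hq : 0 < q := by
    rcases Nat.eq_zero_or_pos q with h | h
    · subst h; simp at hx
    · exact h
  have ex := Nat.div_add_mod x q
  have ey := Nat.div_add_mod y q
  have mx := Nat.mod_lt x hq
  have my := Nat.mod_lt y hq
  generalize x / q = a at *
  generalize y / q = b at *
  generalize x % q = r at *
  generalize y % q = s at *
  subst ex; subst ey
  rcases lt_trichotomy a b with h | h | h
  · have : q * (a + 1) ≤ q * b := by gcongr; omega
    constructor
    · intro _; left; exact h
    · intro _; nlinarith
  · subst h; omega
  · have : q * (b + 1) ≤ q * a := by gcongr; omega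
    constructor
    · intro _; nlinarith
    · intro _; omega

lemma posn_range (q x : ℕ) (hx : x < q * q) : -(q : ℤ) < posn q x ∧ posn q x ≤ (q : ℤ) * q - q := by
  have hq : 0 < q := by
    rcases Nat.eq_zero_or_pos q with h | h
    · subst h; simp at hx
    · exact h
  have ax : x / q < q := Nat.div_lt_of_lt_mul hx
  have mx := Nat.mod_lt x hq
  unfold posn
  generalize x / q = a at *
  generalize x % q = r at *
  have : ((r : ℤ) + 1) * q ≤ q * q := by gcongr; omega
  constructor
  · have : 0 ≤ (r : ℤ) * q := by positivity
    omega
  · nlinarith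

lemma posn_inj (q x y : ℕ) (hx : x < q * q) (hy : y < q * q) (h : posn q x = posn q y) : x = y := by
  have h1 := posn_lt_iff q x y hx hy
  have h2 := posn_lt_iff q y x hy hx
  have h3 := lab_lt_iff q x y hx
  have h4 := lab_lt_iff q y x hy
  omega

def Betw (p r x : ℤ) : Prop := (p < x ∧ x < r) ∨ (r < x ∧ x < p)

lemma comb_bound (q : ℕ) (hq : 0 < q) (F : Finset ℕ) (hF : ∀ x ∈ F, x < q * q)
    (hS : ∀ a ∈ F, ∀ b ∈ F, ∀ d ∈ F, ∀ e ∈ F, a < d → a < e → b < d → b < e →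
      (Betw (posn q d) (posn q e) (posn q a) ↔ Betw (posn q d) (posn q e) (posn q b))) :
    F.card ≤ 2 * q := by
  classical
  rcases F.eq_empty_or_nonempty with rfl | hne
  · simp
  set m := F.min' hne with hm
  set M := F.max' hne with hM
  have hmF : m ∈ F := F.min'_mem hne
  have hMF : M ∈ F := F.max'_mem hne
  have hmle : ∀ x ∈ F, m ≤ x := fun x hx => F.min'_le x hx
  have hMle : ∀ x ∈ F, x ≤ M := fun x hx => F.le_max' x hx
  clear_value m M
  obtain ⟨p, hp⟩ : ∃ p : ℕ → ℤ, ∀ x, p x = if posn q m ≤ posn q x then posn q x - posn q m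
    else posn q x - posn q m + (q : ℤ) * q := ⟨_, fun _ => rfl⟩
  have hr : ∀ x ∈ F, -(q : ℤ) < posn q x ∧ posn q x ≤ (q : ℤ) * q - q :=
    fun x hx => posn_range q x (hF x hx)
  have hinj : ∀ x ∈ F, ∀ y ∈ F, posn q x = posn q y → x = y :=
    fun x hx y hy => posn_inj q x y (hF x hx) (hF y hy)
  -- increasing arc
  have incr : ∀ x ∈ F, ∀ y ∈ F, 0 < p x → p x < p y → p y ≤ p M → x < y := by
    intro x hx y hy h0 hxy hyM
    by_contra! hle
    have hne : x ≠ y := by rintro rfl; omega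
    have hyM' : y ≠ M := by
      rintro rfl
      have := hMle x hx
      omega
    have hxM : x ≠ M := by rintro rfl; omega
    have hpm : p m = 0 := by rw [hp]; simp
    have hym : y ≠ m := by rintro rfl; omega
    have hxm : x ≠ m := by rintro rfl; omega
    have l1 := hmle x hx
    have l2 := hmle y hy
    have l3 := hMle x hx
    have l4 := hMle y hy
    have := hS m hmF y hy x hx M hMF (by omega) (by omega) (by omega) (by omega)
    have r1 := hr x hx
    have r2 := hr y hy
    have r3 := hr m hmF
    have r4 := hr M hMF
    have i1 : posn q x ≠ posn q m := fun h => hxm (hinj x hx m hmF h)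
    have i2 : posn q y ≠ posn q m := fun h => hym (hinj y hy m hmF h)
    have i3 : posn q y ≠ posn q M := fun h => hyM' (hinj y hy M hMF h)
    rw [hp] at h0 hxy hyM
    rw [hp] at hxy hyM
    unfold Betw at this
    generalize (q : ℤ) * q = Q at *
    split_ifs at * <;> omega
  have decr : ∀ x ∈ F, ∀ y ∈ F, p M < p x → p x < p y → y < x := by
    intro x hx y hy h0 hxy
    by_contra! hle
    have hne : x ≠ y := by rintro rfl; omega
    have hyM' : y ≠ M := by rintro rfl; omega
    have hxM : x ≠ M := by rintro rfl; omega
    have hpm : p m = 0 := by rw [hp]; simp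
    have r1 := hr x hx
    have r2 := hr y hy
    have r3 := hr m hmF
    have r4 := hr M hMF
    have hpM : 0 ≤ p M := by rw [hp]; split_ifs <;> linarith
    have hym : y ≠ m := by rintro rfl; omega
    have hxm : x ≠ m := by rintro rfl; omega
    have l1 := hmle x hx
    have l2 := hmle y hy
    have l3 := hMle x hx
    have l4 := hMle y hy
    have := hS m hmF x hx y hy M hMF (by omega) (by omega) (by omega) (by omega)
    have i1 : posn q x ≠ posn q m := fun h => hxm (hinj x hx m hmF h)
    have i2 : posn q y ≠ posn q m := fun h => hym (hinj y hy m hmF h)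
    have i3 : posn q y ≠ posn q M := fun h => hyM' (hinj y hy M hMF h)
    have i4 : posn q m ≠ posn q M := fun h => by
      have := hinj m hmF M hMF h
      omega
    rw [hp] at h0 hxy hpM
    rw [hp] at h0 hxy
    unfold Betw at this
    generalize (q : ℤ) * q = Q at *
    split_ifs at * <;> omega
  have pinj : ∀ x ∈ F, ∀ y ∈ F, p x = p y → x = y := by
    intro x hx y hy hxy
    apply hinj x hx y hy
    have r1 := hr x hx
    have r2 := hr y hy
    have r3 := hr m hmF
    rw [hp, hp] at hxy
    generalize (q : ℤ) * q = Q at *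
    split_ifs at * <;> omega
  have pnn : ∀ x ∈ F, 0 ≤ p x := by
    intro x hx
    have r1 := hr x hx
    have r3 := hr m hmF
    rw [hp]; split_ifs <;> linarith
  have hpm : p m = 0 := by rw [hp]; simp
  have hAc : (F.filter (fun x => 0 < p x ∧ p x ≤ p M)).card ≤ (Finset.range q).card := by
    have key : ∀ x ∈ F, ∀ y ∈ F, 0 < p x → p x < p y → p y ≤ p M → x % q ≠ y % q := by
      intro x hx y hy h0 hxy hyM heq
      have hlt := incr x hx y hy h0 hxy hyM
      have l1 := hmle x hx
      have := posn_lt_iff q y x (hF y hy) (hF x hx)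
      have := posn_lt_iff q y m (hF y hy) (hF m hmF)
      have := posn_lt_iff q m x (hF m hmF) (hF x hx)
      have := lab_lt_iff q x y (hF x hx)
      have := lab_lt_iff q x m (hF x hx)
      have r1 := hr x hx
      have r2 := hr y hy
      have r3 := hr m hmF
      rw [hp] at h0 hxy
      rw [hp] at hxy
      generalize (q : ℤ) * q = Q at *
      split_ifs at * <;> omega
    apply Finset.card_le_card_of_injOn (fun x => x % q)
    · intro x hx
      simpa using Nat.mod_lt x hq
    · intro x hx y hy hxy
      simp only [Finset.coe_filter, Set.mem_ofPred_eq] at hx hy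
      rcases lt_trichotomy (p x) (p y) with h | h | h
      · exact absurd hxy (key x hx.1 y hy.1 hx.2.1 h hy.2.2)
      · exact pinj x hx.1 y hy.1 h
      · exact absurd hxy.symm (key y hy.1 x hx.1 hy.2.1 h hx.2.2)
  have hBc : (F.filter (fun x => ¬ (0 < p x ∧ p x ≤ p M))).card ≤ (Finset.range q).card := by
    by_cases hmM : m = M
    · have : F.filter (fun x => ¬ (0 < p x ∧ p x ≤ p M)) ⊆ {m} := by
        intro x hx
        have hx := (Finset.mem_filter.mp hx).1
        have := hmle x hx
        have := hMle x hx
        simp; omega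
      have := Finset.card_le_card this
      simp at this ⊢; omega
    have hpMpos : 0 < p M := by
      rcases (pnn M hMF).eq_or_lt with h | h
      · exact absurd (pinj m hmF M hMF (by omega)) hmM
      · exact h
    have key : ∀ x ∈ F, ∀ y ∈ F, p M < p x → (p x < p y ∨ y = m) →
        (if posn q M < posn q x then x / q + 1 else x / q) ≠
        (if posn q M < posn q y then y / q + 1 else y / q) := by
      intro x hx y hy h0 hxy heq
      have hlt : y < x := by
        rcases hxy with h | h
        · exact decr x hx y hy h0 h
        · subst h
          have := hmle x hx
          have : x ≠ y := by rintro rfl; omega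
          omega
      have l1 := hmle y hy
      have := posn_lt_iff q y x (hF y hy) (hF x hx)
      have := posn_lt_iff q x y (hF x hx) (hF y hy)
      have := lab_lt_iff q y x (hF y hy)
      have r1 := hr x hx
      have r2 := hr y hy
      have r3 := hr m hmF
      have r4 := hr M hMF
      have i3 := hinj y hy m hmF
      have i4 := hinj x hx y hy
      have i5 := hinj x hx M hMF
      have i6 := hinj y hy M hMF
      have l3 := hMle x hx
      have hsplit : (posn q x < posn q y ∧ (posn q M < posn q x ∨ posn q y < posn q M)) ∨
          (posn q M < posn q x ∧ posn q y < posn q M) := by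
        rw [hp, hp] at h0 hxy
        clear heq
        generalize (q : ℤ) * q = Q at *
        rcases hxy with hxy | hxy
        · split_ifs at * <;> omega
        · subst hxy
          split_ifs at * <;> omega
      clear hxy
      split_ifs at heq <;> omega
    apply Finset.card_le_card_of_injOn
      (fun x => if posn q M < posn q x then x / q + 1 else x / q)
    · intro x hx
      have hx := (Finset.mem_filter.mp hx).1
      have h1 := posn_lt_iff q M x (hF M hMF) (hF x hx)
      have h2 := lab_lt_iff q M x (hF M hMF)
      have h3 := hMle x hx
      have ax : x / q < q := Nat.div_lt_of_lt_mul (hF x hx)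
      have aM : M / q < q := Nat.div_lt_of_lt_mul (hF M hMF)
      simp only [Finset.coe_range, Set.mem_Iio]
      split_ifs <;> omega
    · intro x hx y hy hxy
      simp only [Finset.coe_filter, Set.mem_ofPred_eq] at hx hy
      have px := pnn x hx.1
      have py := pnn y hy.1
      have ex : p x = 0 → x = m := fun h => pinj x hx.1 m hmF (by omega)
      have ey : p y = 0 → y = m := fun h => pinj y hy.1 m hmF (by omega)
      rcases lt_trichotomy (p x) (p y) with h | h | h
      · by_cases h0 : p x = 0
        · exact absurd hxy.symm (key y hy.1 x hx.1 (by omega) (Or.inr (ex h0)))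
        · exact absurd hxy (key x hx.1 y hy.1 (by omega) (Or.inl h))
      · exact pinj x hx.1 y hy.1 h
      · by_cases h0 : p y = 0
        · exact absurd hxy (key x hx.1 y hy.1 (by omega) (Or.inr (ey h0)))
        · exact absurd hxy.symm (key y hy.1 x hx.1 (by omega) (Or.inl h))
  have := Finset.card_filter_add_card_filter_not (s := F) (fun x => 0 < p x ∧ p x ≤ p M)
  simp only [Finset.card_range] at hAc hBc
  omega

/-- the fan -/
def fan (N : ℕ) : SimpleGraph (Fin (N + 1)) where
  Adj u v := u ≠ v ∧ (u.val = 0 ∨ v.val = 0 ∨ u.val + 1 = v.val ∨ v.val + 1 = u.val)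
  symm := ⟨by intro u v h; exact ⟨h.1.symm, by tauto⟩⟩
  loopless := ⟨by intro u h; exact h.1 rfl⟩

/-- points on the parabola -/
def par (N : ℕ) (i : Fin (N + 1)) : ℝ × ℝ := ((i.val : ℝ), (i.val : ℝ) ^ 2)

lemma par_inj (N : ℕ) : Function.Injective (par N) := by
  intro i j h
  have := congrArg Prod.fst h
  simp only [par, Nat.cast_inj] at this
  exact Fin.ext this

lemma par_convex (N : ℕ) : StrictlyConvexPosition (Set.range (par N)) := by
  rintro _ ⟨i, rfl⟩ hmem
  have hsub : convexHull ℝ (Set.range (par N) \ {par N i}) ⊆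
      {x : ℝ × ℝ | 0 < x.2 - 2 * i.val * x.1 + (i.val : ℝ) ^ 2} := by
    apply convexHull_min
    · rintro _ ⟨⟨j, rfl⟩, hj⟩
      have hne : (j.val : ℝ) - i.val ≠ 0 := by
        intro h
        apply hj
        have : (j.val : ℝ) = i.val := by linarith
        simp [par, this]
      have := pow_pos (abs_pos.mpr hne) 2
      rw [sq_abs] at this
      simp only [par, Set.mem_ofPred_eq]
      nlinarith
    · intro x hx y hy a b ha hb hab
      simp only [Set.mem_ofPred_eq, Prod.fst_add, Prod.snd_add, Prod.smul_fst, Prod.smul_snd,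
        smul_eq_mul] at *
      have e : a * x.2 + b * y.2 - 2 * i.val * (a * x.1 + b * y.1) + (i.val : ℝ) ^ 2
        = a * (x.2 - 2 * i.val * x.1 + (i.val : ℝ) ^ 2)
          + b * (y.2 - 2 * i.val * y.1 + (i.val : ℝ) ^ 2) := by
        have : b = 1 - a := by linarith
        subst this; ring
      rw [e]
      rcases ha.eq_or_lt with h | h
      · have : b = 1 := by linarith
        subst this; rw [← h]; linarith
      · have := mul_pos h hx
        have := mul_nonneg hb hy.le
        linarith
  have := hsub hmem
  simp only [par, Set.mem_ofPred_eq] at this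
  nlinarith

lemma par_path (N : ℕ) (u v a b : Fin (N + 1)) (huv : u.val + 1 = v.val)
    (hne : ({u, v} : Set (Fin (N + 1))) ≠ {a, b}) (hab : a ≠ b) (p : ℝ × ℝ)
    (hp : p ∈ segment ℝ (par N u) (par N v)) (hp' : p ∈ segment ℝ (par N a) (par N b)) :
    ∃ w, (w = u ∨ w = v) ∧ (w = a ∨ w = b) ∧ p = par N w := by
  obtain ⟨s, t, hs, ht, hst, rfl⟩ := hp
  obtain ⟨s', t', hs', ht', hst', h⟩ := hp'
  have hval : ∀ k : Fin (N + 1), 0 ≤ ((k.val : ℝ) - u.val) * ((k.val : ℝ) - v.val) ∧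
      (k ≠ u → k ≠ v → 0 < ((k.val : ℝ) - u.val) * ((k.val : ℝ) - v.val)) := by
    intro k
    have h1 : (v.val : ℝ) = u.val + 1 := by exact_mod_cast huv.symm
    rcases lt_trichotomy k u with hk | hk | hk
    · have : (k.val : ℝ) + 1 ≤ u.val := by exact_mod_cast hk
      have : 0 < ((k.val : ℝ) - u.val) * ((k.val : ℝ) - v.val) := by nlinarith
      exact ⟨this.le, fun _ _ => this⟩
    · subst hk; simp
    · rcases eq_or_ne k v with rfl | hkv
      · simp
      · have hlt : v.val < k.val := by
          have : k.val ≠ v.val := fun h => hkv (Fin.ext h)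
          have : u.val < k.val := hk
          omega
        have : (v.val : ℝ) + 1 ≤ k.val := by exact_mod_cast hlt
        have : 0 < ((k.val : ℝ) - u.val) * ((k.val : ℝ) - v.val) := by
          apply mul_pos <;> linarith
        exact ⟨this.le, fun _ _ => this⟩
  have hL : s' * (((a.val : ℝ) - u.val) * ((a.val : ℝ) - v.val))
      + t' * (((b.val : ℝ) - u.val) * ((b.val : ℝ) - v.val)) = 0 := by
    have e1 := congrArg Prod.fst h
    have e2 := congrArg Prod.snd h
    simp only [par, Prod.fst_add, Prod.snd_add, Prod.smul_fst, Prod.smul_snd, smul_eq_mul] at e1 e2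
    have e3 : s = 1 - t := by linarith
    have e4 : s' = 1 - t' := by linarith
    subst e3 e4
    linear_combination e2 - ((u.val : ℝ) + v.val) * e1
  have ha := hval a
  have hb := hval b
  have m1 := mul_nonneg hs' ha.1
  have m2 := mul_nonneg ht' hb.1
  have za : a ≠ u → a ≠ v → s' = 0 := by
    intro h1 h2
    have := ha.2 h1 h2
    by_contra h0
    have := mul_pos (lt_of_le_of_ne hs' (Ne.symm h0)) this
    linarith
  have zb : b ≠ u → b ≠ v → t' = 0 := by
    intro h1 h2
    have := hb.2 h1 h2
    by_contra h0
    have := mul_pos (lt_of_le_of_ne ht' (Ne.symm h0)) this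
    linarith
  rw [← h]
  by_cases hau : a = u ∨ a = v
  · have hb1 : b ≠ u ∧ b ≠ v := by
      constructor
      · rintro rfl
        rcases hau with rfl | rfl
        · exact hab rfl
        · exact hne (Set.pair_comm _ _)
      · rintro rfl
        rcases hau with rfl | rfl
        · exact hne rfl
        · exact hab rfl
    have h0 := zb hb1.1 hb1.2
    have h1 : s' = 1 := by linarith
    refine ⟨a, hau, Or.inl rfl, ?_⟩
    rw [h0, h1]; simp
  · push Not at hau
    have h0 := za hau.1 hau.2
    have h1 : t' = 1 := by linarith
    by_cases hbu : b = u ∨ b = v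
    · refine ⟨b, hbu, Or.inr rfl, ?_⟩
      rw [h0, h1]; simp
    · push Not at hbu
      have := zb hbu.1 hbu.2
      linarith

lemma par_spoke (N : ℕ) (o v b : Fin (N + 1)) (ho : o.val = 0) (hv : o ≠ v)
    (hne : v ≠ b) (p : ℝ × ℝ)
    (hp : p ∈ segment ℝ (par N o) (par N v)) (hp' : p ∈ segment ℝ (par N o) (par N b)) :
    p = par N o := by
  obtain ⟨s, t, hs, ht, hst, rfl⟩ := hp
  obtain ⟨s', t', hs', ht', hst', h⟩ := hp'
  have e1 := congrArg Prod.fst h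
  have e2 := congrArg Prod.snd h
  have hvb : (v.val : ℝ) - b.val ≠ 0 := by
    intro h; apply hne; apply Fin.ext
    have : (v.val : ℝ) = b.val := by linarith
    exact_mod_cast this
  have hv0 : (v.val : ℝ) ≠ 0 := by
    intro h; apply hv; apply Fin.ext
    rw [ho]; symm; exact_mod_cast h
  simp only [par, Prod.fst_add, Prod.snd_add, Prod.smul_fst, Prod.smul_snd, smul_eq_mul, ho,
    Nat.cast_zero] at e1 e2
  have : t * (v.val * ((v.val : ℝ) - b.val)) = 0 := by
    linear_combination -e2 + (b.val : ℝ) * e1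
  have ht0 : t = 0 := by
    rcases mul_eq_zero.mp this with h | h
    · exact h
    · exact absurd h (mul_ne_zero hv0 hvb)
  have : s = 1 := by linarith
  rw [ht0, this]; simp

lemma par_plane (N : ℕ) : IsPlaneDrawing (fan N) (par N) := by
  refine ⟨par_inj N, ?_, ?_⟩
  · intro u v w huv hw
    by_contra! hne
    obtain ⟨s, t, hs, ht, hst, h⟩ := hw
    have hu : (u.val : ℝ) - w.val ≠ 0 := by
      intro h; apply hne.1; apply Fin.ext
      have : (w.val : ℝ) = u.val := by linarith
      exact_mod_cast this
    have hv : (v.val : ℝ) - w.val ≠ 0 := by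
      intro h; apply hne.2; apply Fin.ext
      have : (w.val : ℝ) = v.val := by linarith
      exact_mod_cast this
    have e1 := congrArg Prod.fst h
    have e2 := congrArg Prod.snd h
    simp only [par, Prod.fst_add, Prod.snd_add, Prod.smul_fst, Prod.smul_snd, smul_eq_mul] at e1 e2
    have hL : s * ((u.val : ℝ) - w.val) ^ 2 + t * ((v.val : ℝ) - w.val) ^ 2 = 0 := by
      have e3 : s = 1 - t := by linarith
      subst e3
      linear_combination e2 - 2 * (w.val : ℝ) * e1
    have p1 : 0 < ((u.val : ℝ) - w.val) ^ 2 := by positivity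
    have p2 : 0 < ((v.val : ℝ) - w.val) ^ 2 := by positivity
    rcases hs.eq_or_lt with h0 | h0
    · have : t = 1 := by linarith
      rw [← h0, this] at hL
      linarith
    · have := mul_pos h0 p1
      have := mul_nonneg ht p2.le
      linarith
  · intro u v a b huv hab hne p hp hp'
    obtain ⟨nuv, huv⟩ := huv
    obtain ⟨nab, hab⟩ := hab
    by_cases c1 : u.val + 1 = v.val
    · exact par_path N u v a b c1 hne nab p hp hp'
    by_cases c2 : v.val + 1 = u.val
    · obtain ⟨w, h1, h2, h3⟩ := par_path N v u a b c2 (by rwa [Set.pair_comm]) nab p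
        (by rwa [segment_symm]) hp'
      exact ⟨w, h1.symm, h2, h3⟩
    by_cases c3 : a.val + 1 = b.val
    · obtain ⟨w, h1, h2, h3⟩ := par_path N a b u v c3 hne.symm nuv p hp' hp
      exact ⟨w, h2, h1, h3⟩
    by_cases c4 : b.val + 1 = a.val
    · obtain ⟨w, h1, h2, h3⟩ := par_path N b a u v c4 (by rw [Set.pair_comm b a]; exact hne.symm)
        nuv p (by rwa [segment_symm]) hp
      exact ⟨w, h2, h1.symm, h3⟩
    have huv : u.val = 0 ∨ v.val = 0 := by tauto
    have hab : a.val = 0 ∨ b.val = 0 := by tauto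
    rcases huv with hu | hu <;> rcases hab with ha | ha
    · obtain rfl : u = a := Fin.ext (by omega)
      have : v ≠ b := by rintro rfl; exact hne rfl
      exact ⟨u, Or.inl rfl, Or.inl rfl, par_spoke N u v b hu nuv this p hp hp'⟩
    · obtain rfl : u = b := Fin.ext (by omega)
      have : v ≠ a := by rintro rfl; exact hne (Set.pair_comm _ _)
      exact ⟨u, Or.inl rfl, Or.inr rfl, par_spoke N u v a hu nuv this p hp
        (by rwa [segment_symm])⟩
    · obtain rfl : v = a := Fin.ext (by omega)
      have : u ≠ b := by rintro rfl; exact hne (Set.pair_comm _ _)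
      exact ⟨v, Or.inr rfl, Or.inl rfl, par_spoke N v u b hu nuv.symm this p
        (by rwa [segment_symm]) hp'⟩
    · obtain rfl : v = b := Fin.ext (by omega)
      have : u ≠ a := by rintro rfl; exact hne rfl
      exact ⟨v, Or.inr rfl, Or.inr rfl, par_spoke N v u a hu nuv.symm this p
        (by rwa [segment_symm]) (by rwa [segment_symm])⟩

lemma fan_fix (q : ℕ) (hq : 0 < q) (δ : Fin (q * q + 1) → ℝ × ℝ)
    (hδ : IsPlaneDrawing (fan (q * q)) δ) (F : Finset ℕ) (hF : ∀ x ∈ F, x < q * q)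
    (hfix : ∀ x ∈ F, ∀ h : x + 1 < q * q + 1, δ ⟨x + 1, h⟩ = ((posn q x : ℝ), 0)) :
    F.card ≤ 2 * q := by
  classical
  obtain ⟨hinj, hvert, hedge⟩ := hδ
  set c := δ 0 with hc
  -- total path-vertex map
  obtain ⟨P, hP⟩ : ∃ P : ℕ → ℝ × ℝ, ∀ i, ∀ h : i + 1 < q * q + 1, P i = δ ⟨i + 1, h⟩ :=
    ⟨fun i => if h : i + 1 < q * q + 1 then δ ⟨i + 1, h⟩ else 0, fun i h => dif_pos h⟩
  have spoke : ∀ i (h : i + 1 < q * q + 1), (fan (q * q)).Adj 0 ⟨i + 1, h⟩ := by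
    intro i h
    refine ⟨?_, Or.inl rfl⟩
    intro h; have := congrArg Fin.val h; simp at this
  have pedge : ∀ i (h : i + 1 < q * q + 1) (h' : i + 1 + 1 < q * q + 1),
      (fan (q * q)).Adj ⟨i + 1, h⟩ ⟨i + 1 + 1, h'⟩ := by
    intro i h h'
    refine ⟨?_, Or.inr (Or.inr (Or.inl rfl))⟩
    intro h; have := congrArg Fin.val h; simp at this
  have noSpoke : ∀ i j, i < q * q → j < q * q → i ≠ j → P i ∉ segment ℝ c (P j) := by
    intro i j hi hj hij hmem
    rw [hP i (by omega), hP j (by omega)] at hmem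
    rcases hvert _ _ _ (spoke j (by omega)) hmem with h | h
    · have := congrArg Fin.val h; simp at this
    · have := congrArg Fin.val h; simp at this; omega
  have Pne : ∀ i, i < q * q → P i ≠ c := by
    intro i hi h
    rw [hP i (by omega)] at h
    have := congrArg Fin.val (hinj h); simp at this
  have hPfix : ∀ x ∈ F, P x = ((posn q x : ℝ), 0) := by
    intro x hx
    have := hF x hx
    rw [hP x (by omega)]; exact hfix x hx _
  -- multiples
  have h1 : ∀ i j, i < q * q → j < q * q → i ≠ j → ∀ r : ℝ, 0 < r → P i - c ≠ r • (P j - c) := by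
    have aux : ∀ i j, i < q * q → j < q * q → i ≠ j → ∀ r : ℝ, 0 < r → r ≤ 1 →
        P i - c ≠ r • (P j - c) := by
      intro i j hi hj hij r hr0 hr1 h
      apply noSpoke i j hi hj hij
      refine ⟨1 - r, r, by linarith, hr0.le, by ring, ?_⟩
      rw [sub_eq_iff_eq_add.mp h]; module
    intro i j hi hj hij r hr h
    rcases le_total r 1 with h1 | h1
    · exact aux i j hi hj hij r hr h1 h
    · apply aux j i hj hi hij.symm r⁻¹ (by positivity) (inv_le_one_of_one_le₀ h1)
      rw [h, smul_smul, inv_mul_cancel₀ hr.ne', one_smul]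
  by_cases hcl : c.2 = 0
  · -- the apex lies on the line
    have : F.card ≤ (Finset.univ : Finset Bool).card := by
      apply Finset.card_le_card_of_injOn (fun x => decide ((posn q x : ℝ) < c.1))
      · intro x _; exact Finset.mem_coe.2 (Finset.mem_univ _)
      · intro x hx y hy hxy
        by_contra hne
        have hx' := hF x hx
        have hy' := hF y hy
        have nx := Pne x hx'
        have ny := Pne y hy'
        rw [hPfix x hx] at nx
        rw [hPfix y hy] at ny
        have nx : (posn q x : ℝ) - c.1 ≠ 0 := fun h => nx (Prod.ext (by simp; linarith) hcl.symm)
        have ny : (posn q y : ℝ) - c.1 ≠ 0 := fun h => ny (Prod.ext (by simp; linarith) hcl.symm)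
        have hpos : 0 < ((posn q x : ℝ) - c.1) / ((posn q y : ℝ) - c.1) := by
          simp only [decide_eq_decide] at hxy
          rcases lt_or_gt_of_ne nx with h | h
          · exact div_pos_of_neg_of_neg h (by linarith [hxy.mp (by linarith)])
          · apply div_pos h
            rcases lt_or_gt_of_ne ny with h2 | h2
            · linarith [hxy.mpr (by linarith)]
            · exact h2
        apply h1 x y hx' hy' hne _ hpos
        rw [hPfix x hx, hPfix y hy]
        ext
        · simp only [Prod.fst_sub, Prod.smul_fst, smul_eq_mul]; field_simp
        · simp [hcl]
    simp at this
    omega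
  apply comb_bound q hq F hF
  -- translated disjointness
  have tr : ∀ x y : ℝ × ℝ, ∀ p, p ∈ segment ℝ (x - c) (y - c) → p + c ∈ segment ℝ x y := by
    rintro x y p ⟨s, t, hs, ht, hst, rfl⟩
    refine ⟨s, t, hs, ht, hst, ?_⟩
    have : s = 1 - t := by linarith
    subst this; module
  have tr0 : ∀ y : ℝ × ℝ, ∀ p, p ∈ segment ℝ 0 (y - c) → p + c ∈ segment ℝ c y := by
    intro y p hp
    apply tr
    rwa [sub_self]
  have h2 : ∀ i j, i + 1 < q * q → j < q * q → j ≠ i → j ≠ i + 1 →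
      Disjoint (segment ℝ 0 (P j - c)) (segment ℝ (P i - c) (P (i + 1) - c)) := by
    intro i j hi hj h1 h2
    rw [Set.disjoint_left]
    intro p hp hp'
    have m1 := tr0 _ _ hp
    have m2 := tr _ _ _ hp'
    rw [hP j (by omega)] at m1
    rw [hP i (by omega), hP (i+1) (by omega)] at m2
    obtain ⟨w, hw1, hw2, -⟩ := hedge _ _ _ _ (spoke j (by omega))
      (pedge i (by omega) (by omega)) (by
        intro h
        have : (0 : Fin (q * q + 1)) ∈ ({⟨i + 1, by omega⟩, ⟨i + 1 + 1, by omega⟩} : Set (Fin (q * q + 1))) := by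
          rw [← h]; simp
        simp [Fin.ext_iff] at this) _ m1 m2
    simp only [Fin.ext_iff] at hw1 hw2
    have z : ((0 : Fin (q * q + 1)) : ℕ) = 0 := rfl
    omega
  have h3 : ∀ i j, i + 1 < q * q → j + 1 < q * q → j ≠ i → j ≠ i + 1 → j + 1 ≠ i →
      Disjoint (segment ℝ (P j - c) (P (j + 1) - c)) (segment ℝ (P i - c) (P (i + 1) - c)) := by
    intro i j hi hj h1 h2 h3
    rw [Set.disjoint_left]
    intro p hp hp'
    have m1 := tr _ _ _ hp
    have m2 := tr _ _ _ hp'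
    rw [hP j (by omega), hP (j+1) (by omega)] at m1
    rw [hP i (by omega), hP (i+1) (by omega)] at m2
    obtain ⟨w, hw1, hw2, -⟩ := hedge _ _ _ _ (pedge j (by omega) (by omega))
      (pedge i (by omega) (by omega)) (by
        intro h
        have : (⟨j + 1, by omega⟩ : Fin (q * q + 1)) ∈ ({⟨i + 1, by omega⟩, ⟨i + 1 + 1, by omega⟩} : Set (Fin (q * q + 1))) := by
          rw [← h]; simp
        simp [Fin.ext_iff] at this
        omega) _ m1 m2
    simp only [Fin.ext_iff] at hw1 hw2
    omega
  have h4 : ∀ i, i + 1 < q * q → (0 : ℝ × ℝ) ∉ segment ℝ (P i - c) (P (i + 1) - c) := by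
    intro i hi hmem
    have m := tr _ _ _ hmem
    rw [zero_add, hP i (by omega), hP (i+1) (by omega)] at m
    rcases hvert _ _ _ (pedge i (by omega) (by omega)) m with h | h
    · have := congrArg Fin.val h; simp at this
    · have := congrArg Fin.val h; simp at this
  have conv : ∀ a ∈ F, ∀ d ∈ F, ∀ e ∈ F,
      (Betw (posn q d) (posn q e) (posn q a) ↔ Cone (P d - c) (P e - c) (P a - c)) := by
    intro a ha d hd e he
    have hc2 : 0 < c.2 * c.2 := mul_self_pos.mpr hcl
    rw [hPfix a ha, hPfix d hd, hPfix e he]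
    have e1 : dt (((posn q d : ℝ), 0) - c) (((posn q e : ℝ), 0) - c) *
        dt (((posn q d : ℝ), 0) - c) (((posn q a : ℝ), 0) - c) =
        (((posn q e - posn q d) * (posn q a - posn q d) : ℤ) : ℝ) * (c.2 * c.2) := by
      simp [dt]; ring
    have e2 : dt (((posn q d : ℝ), 0) - c) (((posn q e : ℝ), 0) - c) *
        dt (((posn q a : ℝ), 0) - c) (((posn q e : ℝ), 0) - c) =
        (((posn q e - posn q d) * (posn q e - posn q a) : ℤ) : ℝ) * (c.2 * c.2) := by
      simp [dt]; ring
    unfold Cone Betw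
    rw [e1, e2, mul_pos_iff_of_pos_right hc2, mul_pos_iff_of_pos_right hc2, Int.cast_pos,
      Int.cast_pos, mul_pos_iff, mul_pos_iff]
    omega
  intro a ha b hb d hd e he had hae hbd hbe
  rw [conv a ha d hd e he, conv b hb d hd e he]
  exact fan_sep (q * q) (fun i => P i - c) h1 h2 h3 h4 a b d e (hF d hd) (hF e he) had hae hbd hbe

/-- For every positive integer `n₀` there exists an outerplanar graph `H` (a graph with
a plane straight-line drawing whose vertex images are in strictly convex position) with
some number `n ≥ n₀` of vertices such that `fix(H) ≤ 2√(n-1) + 1`, i.e. there is a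
straight-line drawing `δ` of `H` such that every plane straight-line drawing of `H`
fixes at most `2√(n-1) + 1` vertices of `δ`. -/
theorem outerplanar_fix_upper_bound (n₀ : ℕ) (hn₀ : 0 < n₀) :
    ∃ (n : ℕ) (H : SimpleGraph (Fin n)),
      n₀ ≤ n ∧
      (∃ δ : Fin n → ℝ × ℝ, IsPlaneDrawing H δ ∧ StrictlyConvexPosition (Set.range δ)) ∧
      ∃ δ : Fin n → ℝ × ℝ, Function.Injective δ ∧
        ∀ δ' : Fin n → ℝ × ℝ, IsPlaneDrawing H δ' →
          ({v : Fin n | δ' v = δ v}.ncard : ℝ) ≤ 2 * Real.sqrt ((n : ℝ) - 1) + 1 := by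
  classical
  refine ⟨n₀ * n₀ + 1, fan (n₀ * n₀), by nlinarith, ⟨par _, par_plane _, par_convex _⟩,
    fun v => if v.val = 0 then (0, 1) else ((posn n₀ (v.val - 1) : ℝ), 0), ?_, ?_⟩
  · intro u v h
    have hu := u.isLt
    have hv := v.isLt
    simp only at h
    apply Fin.ext
    split_ifs at h with h1 h2 h2
    · omega
    · simp at h
    · simp at h
    · have h3 := congrArg Prod.fst h
      simp only [Int.cast_inj] at h3
      have := posn_inj n₀ _ _ (by omega) (by omega) h3
      omega
  · intro δ' hδ'
    have hb : ({v : Fin (n₀ * n₀ + 1) | δ' v = if v.val = 0 then (0, 1)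
        else ((posn n₀ (v.val - 1) : ℝ), 0)}.ncard) ≤ 2 * n₀ + 1 := by
      set S : Finset (Fin (n₀ * n₀ + 1)) := Finset.univ.filter (fun v => δ' v = if v.val = 0
        then (0, 1) else ((posn n₀ (v.val - 1) : ℝ), 0)) with hS
      have hSe : {v : Fin (n₀ * n₀ + 1) | δ' v = if v.val = 0 then (0, 1)
        else ((posn n₀ (v.val - 1) : ℝ), 0)} = (S : Set (Fin (n₀ * n₀ + 1))) := by
        ext v; simp [hS]
      rw [hSe, Set.ncard_coe_finset]
      set F : Finset ℕ := (S.erase 0).image (fun v => v.val - 1) with hF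
      have hmem : ∀ x ∈ F, ∃ v ∈ S, v.val = x + 1 := by
        intro x hx
        rw [hF, Finset.mem_image] at hx
        obtain ⟨v, hv, rfl⟩ := hx
        rw [Finset.mem_erase] at hv
        have : v.val ≠ 0 := fun h => hv.1 (Fin.ext h)
        exact ⟨v, hv.2, by omega⟩
      have hcard : F.card = (S.erase 0).card := by
        apply Finset.card_image_of_injOn
        intro u hu v hv huv
        have hu := Finset.mem_erase.mp hu
        have hv := Finset.mem_erase.mp hv
        have : v.val ≠ 0 := fun h => hv.1 (Fin.ext h)
        have : u.val ≠ 0 := fun h => hu.1 (Fin.ext h)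
        simp only at huv
        apply Fin.ext
        omega
      have hFb : F.card ≤ 2 * n₀ := by
        apply fan_fix n₀ hn₀ δ' hδ' F
        · intro x hx
          obtain ⟨v, -, hv⟩ := hmem x hx
          have := v.isLt
          omega
        · intro x hx h
          obtain ⟨v, hv, hvx⟩ := hmem x hx
          obtain rfl : v = ⟨x + 1, h⟩ := Fin.ext hvx
          have := (Finset.mem_filter.mp hv).2
          simpa using this
      have := Finset.pred_card_le_card_erase (s := S) (a := 0)
      omega
    have hs : Real.sqrt (((n₀ * n₀ + 1 : ℕ) : ℝ) - 1) = n₀ := by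
      push_cast
      rw [add_sub_cancel_right]
      exact Real.sqrt_mul_self (by positivity)
    rw [hs]
    exact_mod_cast hb
end

section
/- For every integer q ≥ 1: every increasing subsequence of σ_q has length at most q, every decreasing subsequence of σ_q has length at most q, and there exist both an increasing subsequence of σ_q of length q and a decreasing subsequence of σ_q of length q. -/
/-- The sequence `σ_q`: the entry at position `p = i·q + j` (with `0 ≤ i, j ≤ q-1`)
is `(q-1-j)·q + i`; i.e. `σ_q` is the concatenation of the `q` blocks
`((q-1)q+i, (q-2)q+i, …, q+i, i)` for `i = 0, …, q-1`. -/
def sigmaSeq (q p : ℕ) : ℕ := (q - 1 - p % q) * q + p / q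

/-- For every integer `q ≥ 1`: every increasing subsequence of `σ_q` has length at
most `q`, every decreasing subsequence of `σ_q` has length at most `q`, and there
exist both an increasing and a decreasing subsequence of `σ_q` of length `q`. -/
theorem sigmaSeq_monotone_subsequences (q : ℕ) (hq : 1 ≤ q) :
    (∀ (k : ℕ) (p : Fin k → ℕ), StrictMono p → (∀ i, p i < q ^ 2) →
      StrictMono (fun i => sigmaSeq q (p i)) → k ≤ q) ∧
    (∀ (k : ℕ) (p : Fin k → ℕ), StrictMono p → (∀ i, p i < q ^ 2) →
      StrictAnti (fun i => sigmaSeq q (p i)) → k ≤ q) ∧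
    (∃ p : Fin q → ℕ, StrictMono p ∧ (∀ i, p i < q ^ 2) ∧
      StrictMono (fun i => sigmaSeq q (p i))) ∧
    (∃ p : Fin q → ℕ, StrictMono p ∧ (∀ i, p i < q ^ 2) ∧
      StrictAnti (fun i => sigmaSeq q (p i))) := by
  have hq0 : 0 < q := hq
  refine ⟨?_, ?_, ?_, ?_⟩
  · intro k p hp hb hs
    have key : ∀ a b, a < b → p a / q ≠ p b / q := by
      intro a b hab h
      have h1 := hp hab
      have h2 := hs hab
      simp only [sigmaSeq] at h2
      rw [h] at h2
      have e1 := Nat.div_add_mod (p a) q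
      have e2 := Nat.div_add_mod (p b) q
      rw [h] at e1
      have h3 : p a % q ≤ p b % q := by omega
      have h4 : (q - 1 - p b % q) * q ≤ (q - 1 - p a % q) * q :=
        Nat.mul_le_mul_right q (by omega)
      omega
    have hlt : ∀ a, p a / q < q := fun a =>
      Nat.div_lt_of_lt_mul (by have := hb a; rwa [pow_two] at this)
    have hinj : Function.Injective (fun a => (⟨p a / q, hlt a⟩ : Fin q)) := by
      intro a b h
      have h' : p a / q = p b / q := congrArg Fin.val h
      rcases lt_trichotomy a b with hab | hab | hab
      · exact absurd h' (key a b hab)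
      · exact hab
      · exact absurd h'.symm (key b a hab)
    simpa using Fintype.card_le_of_injective _ hinj
  · intro k p hp hb hs
    have key : ∀ a b, a < b → p a % q ≠ p b % q := by
      intro a b hab h
      have h1 := hp hab
      have h2 := hs hab
      simp only [sigmaSeq] at h2
      rw [h] at h2
      have h3 : p a / q ≤ p b / q := Nat.div_le_div_right h1.le
      omega
    have hinj : Function.Injective (fun a => (⟨p a % q, Nat.mod_lt _ hq0⟩ : Fin q)) := by
      intro a b h
      have h' : p a % q = p b % q := congrArg Fin.val h
      rcases lt_trichotomy a b with hab | hab | hab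
      · exact absurd h' (key a b hab)
      · exact hab
      · exact absurd h'.symm (key b a hab)
    simpa using Fintype.card_le_of_injective _ hinj
  · refine ⟨fun i => i.val * q, ?_, ?_, ?_⟩
    · intro a b hab
      exact Nat.mul_lt_mul_of_pos_right hab hq0
    · intro i
      rw [pow_two]
      exact Nat.mul_lt_mul_of_pos_right i.isLt hq0
    · intro a b hab
      have : a.val < b.val := hab
      simp only [sigmaSeq, Nat.mul_mod_left, Nat.mul_div_cancel _ hq0]
      omega
  · refine ⟨fun i => i.val, ?_, ?_, ?_⟩
    · intro a b hab
      exact hab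
    · intro i
      have := i.isLt
      nlinarith
    · intro a b hab
      have h : a.val < b.val := hab
      have hb := b.isLt
      simp only [sigmaSeq, Nat.mod_eq_of_lt a.isLt, Nat.mod_eq_of_lt b.isLt,
        Nat.div_eq_of_lt a.isLt, Nat.div_eq_of_lt b.isLt, add_zero]
      exact Nat.mul_lt_mul_of_pos_right (by omega) hq0
end

section
/- Let q ≥ 1 and let Σ and Σ' be two separated decreasing subsequences of σ_q, or two separated increasing subsequences of σ_q, of lengths k and k' respectively. Then k + k' ≤ q + 1. -/
theorem aux_growth {k : ℕ} (f : Fin (k + 1) → ℕ) (hf : StrictMono f) :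
    ∀ n (hn : n < k + 1), f 0 + n ≤ f ⟨n, hn⟩ := by
  intro n
  induction n with
  | zero => intro hn; exact le_refl _
  | succ m ih =>
    intro hn
    have h1 := ih (by omega)
    have h2 : f ⟨m, by omega⟩ < f ⟨m + 1, hn⟩ := hf (by simp [Fin.lt_def])
    omega

theorem aux_card {q k k' : ℕ} (f : Fin k → ℕ) (g : Fin k' → ℕ)
    (hf : StrictMono f) (hg : StrictMono g) (hfq : ∀ i, f i < q) (hgq : ∀ i, g i < q)
    (h : ∀ i j, f i ≤ g j) : k + k' ≤ q + 1 := by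
  rcases k with _ | k <;> rcases k' with _ | k'
  · omega
  · have h1 := aux_growth g hg k' (by omega)
    have h2 := hgq ⟨k', by omega⟩
    omega
  · have h1 := aux_growth f hf k (by omega)
    have h2 := hfq ⟨k, by omega⟩
    omega
  · have h1 := aux_growth g hg k' (by omega)
    have h2 := hgq ⟨k', by omega⟩
    have h3 := aux_growth f hf k (by omega)
    have h4 := h ⟨k, by omega⟩ 0
    omega

theorem aux_val {q a b : ℕ} (ha : a < q ^ 2) (hb : b < q ^ 2)
    (h : sigmaSeq q a < sigmaSeq q b) : b % q < a % q ∨ b % q = a % q ∧ a / q < b / q := by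
  have hq : 0 < q := by
    rcases q with _ | q
    · simp at ha
    · omega
  have h1 := Nat.mod_lt a hq
  have h2 := Nat.mod_lt b hq
  have h3 : a / q < q := Nat.div_lt_of_lt_mul (by nlinarith)
  have h4 : b / q < q := Nat.div_lt_of_lt_mul (by nlinarith)
  unfold sigmaSeq at h
  rcases lt_trichotomy (b % q) (a % q) with h5 | h5 | h5
  · exact Or.inl h5
  · rw [h5] at h
    exact Or.inr ⟨h5, by omega⟩
  · exfalso
    have h6 : (q - 1 - b % q) + 1 ≤ q - 1 - a % q := by omega
    have h7 := Nat.mul_le_mul_right q h6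
    rw [Nat.add_mul] at h7
    have h8 := Nat.zero_le (a / q)
    linarith

theorem aux_inc {q a b : ℕ} (ha : a < q ^ 2) (hb : b < q ^ 2) (hab : a < b)
    (h : sigmaSeq q a < sigmaSeq q b) : a / q < b / q := by
  rcases aux_val ha hb h with h1 | h1
  · by_contra h2
    have h3 : a / q = b / q := le_antisymm (Nat.div_le_div_right hab.le) (by omega)
    have h4 := Nat.div_add_mod a q
    have h5 := Nat.div_add_mod b q
    rw [h3] at h4
    omega
  · exact h1.2

theorem aux_dec {q a b : ℕ} (ha : a < q ^ 2) (hb : b < q ^ 2) (hab : a < b)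
    (h : sigmaSeq q b < sigmaSeq q a) : a % q < b % q := by
  rcases aux_val hb ha h with h1 | h1
  · exact h1
  · have := Nat.div_le_div_right (c := q) hab.le
    omega

/-- Let `q ≥ 1` and let `Σ`, `Σ'` be two separated decreasing subsequences of `σ_q`,
or two separated increasing subsequences of `σ_q`, of lengths `k` and `k'`.
(Separated: all positions of one subsequence precede all positions of the other, and
all values of one subsequence are smaller than all values of the other.)
Then `k + k' ≤ q + 1`. -/
theorem sigmaSeq_separated_subsequences (q : ℕ) (hq : 1 ≤ q) (k k' : ℕ)
    (p : Fin k → ℕ) (p' : Fin k' → ℕ)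
    (hp : StrictMono p) (hp' : StrictMono p')
    (hpb : ∀ i, p i < q ^ 2) (hpb' : ∀ i, p' i < q ^ 2)
    (hmono : (StrictMono (fun i => sigmaSeq q (p i)) ∧
              StrictMono (fun i => sigmaSeq q (p' i))) ∨
             (StrictAnti (fun i => sigmaSeq q (p i)) ∧
              StrictAnti (fun i => sigmaSeq q (p' i))))
    (hsepPos : (∀ i j, p i < p' j) ∨ (∀ i j, p' i < p j))
    (hsepVal : (∀ i j, sigmaSeq q (p i) < sigmaSeq q (p' j)) ∨
               (∀ i j, sigmaSeq q (p' i) < sigmaSeq q (p j))) :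
    k + k' ≤ q + 1 := by
  have hd : ∀ a, a < q ^ 2 → a / q < q := fun a ha => Nat.div_lt_of_lt_mul (by nlinarith)
  have hm : ∀ a, a % q < q := fun a => Nat.mod_lt a hq
  rcases hmono with ⟨h1, h2⟩ | ⟨h1, h2⟩
  · have hf : StrictMono (fun i => p i / q) :=
      fun i j hij => aux_inc (hpb i) (hpb j) (hp hij) (h1 hij)
    have hg : StrictMono (fun i => p' i / q) :=
      fun i j hij => aux_inc (hpb' i) (hpb' j) (hp' hij) (h2 hij)
    rcases hsepPos with h | h
    · exact aux_card _ _ hf hg (fun i => hd _ (hpb i)) (fun i => hd _ (hpb' i))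
        (fun i j => Nat.div_le_div_right (h i j).le)
    · rw [add_comm]
      exact aux_card _ _ hg hf (fun i => hd _ (hpb' i)) (fun i => hd _ (hpb i))
        (fun i j => Nat.div_le_div_right (h i j).le)
  · have hf : StrictMono (fun i => p i % q) :=
      fun i j hij => aux_dec (hpb i) (hpb j) (hp hij) (h1 hij)
    have hg : StrictMono (fun i => p' i % q) :=
      fun i j hij => aux_dec (hpb' i) (hpb' j) (hp' hij) (h2 hij)
    rcases hsepVal with h | h
    · rw [add_comm]
      refine aux_card _ _ hg hf (fun i => hm _) (fun i => hm _) (fun i j => ?_)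
      have := aux_val (hpb j) (hpb' i) (h j i)
      show p' i % q ≤ p j % q
      omega
    · refine aux_card _ _ hf hg (fun i => hm _) (fun i => hm _) (fun i j => ?_)
      have := aux_val (hpb' j) (hpb i) (h j i)
      show p i % q ≤ p' j % q
      omega
end

section
/- Let l ≥ 1 be an integer and let C be a noncrossing set of chords of the path 1,2,…,l. Then the simple graph on vertex set {1,…,l} with edge set C has an independent set of size at least (l+1)/2. -/
/-- `c = (i, j)` is a chord of the path `1, 2, …, l`: `1 ≤ i` and `i + 2 ≤ j ≤ l`. -/
def IsChord (l : ℕ) (c : ℕ × ℕ) : Prop := 1 ≤ c.1 ∧ c.1 + 2 ≤ c.2 ∧ c.2 ≤ l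

/-- Two chords `{i,j}` (`i < j`) and `{a,b}` (`a < b`) cross if
`i < a < j < b` or `a < i < b < j`. -/
def ChordsCross (c d : ℕ × ℕ) : Prop :=
  (c.1 < d.1 ∧ d.1 < c.2 ∧ c.2 < d.2) ∨ (d.1 < c.1 ∧ c.1 < d.2 ∧ d.2 < c.2)

theorem nc_aux (C : Finset (ℕ × ℕ))
    (hnc : ∀ c ∈ C, ∀ d ∈ C, c ≠ d → ¬ ChordsCross c d) (n : ℕ) :
    ∀ V : Finset ℕ, V.card = n → V.Nonempty →
    (∀ a ∈ V, ∀ b ∈ V, (a, b) ∈ C → a < b ∧ ∃ k ∈ V, a < k ∧ k < b) →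
    ∃ S : Finset ℕ, S ⊆ V ∧ (∀ i ∈ S, ∀ j ∈ S, (i, j) ∉ C) ∧ V.card + 1 ≤ 2 * S.card := by
  have nc : ∀ a b c d : ℕ, (a, b) ∈ C → (c, d) ∈ C → a < c → c < b → b < d → False := by
    intro a b c d h1 h2 h3 h4 h5
    refine hnc _ h1 _ h2 ?_ (Or.inl ⟨h3, h4, h5⟩)
    intro h
    rw [Prod.mk.injEq] at h
    omega
  induction n using Nat.strong_induction_on with
  | _ n ih =>
  intro V hn hV hC
  by_cases hex : ∃ m : ℕ, ∃ a ∈ V, ∃ b ∈ V, (a, b) ∈ C ∧ b - a = m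
  swap
  · refine ⟨V, subset_rfl, ?_, ?_⟩
    · intro i hi j hj h
      exact hex ⟨_, i, hi, j, hj, h, rfl⟩
    · have := hV.card_pos
      omega
  classical
  obtain ⟨i, hi, j, hj, hij, hm⟩ := Nat.find_spec hex
  have hmin : ∀ a ∈ V, ∀ b ∈ V, (a, b) ∈ C → j - i ≤ b - a := by
    intro a ha b hb h
    rw [hm]
    exact Nat.find_min' hex ⟨a, ha, b, hb, h, rfl⟩
  clear hm
  obtain ⟨hlt, u, hu, hiu, huj⟩ := hC i hi j hj hij
  have iso1 : ∀ k, i < k → k < j → k ∈ V → ∀ b ∈ V, (k, b) ∉ C := by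
    intro k h1 h2 hk b hb h
    have := hmin _ hk _ hb h
    have := (hC _ hk _ hb h).1
    exact nc _ _ _ _ hij h h1 h2 (by omega)
  have iso2 : ∀ k, i < k → k < j → k ∈ V → ∀ a ∈ V, (a, k) ∉ C := by
    intro k h1 h2 hk a ha h
    have := hmin _ ha _ hk h
    have := (hC _ ha _ hk h).1
    exact nc _ _ _ _ h hij (by omega) h1 h2
  -- finishing from a good deletion
  have fin : ∀ v ∈ V, v ≠ u → ∀ w ∈ V, w ≠ u → w ≠ v →
      (∀ a ∈ V, ∀ b ∈ V, a ≠ u → a ≠ v → b ≠ u → b ≠ v → (a, b) ∈ C →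
        ∃ k ∈ V, k ≠ u ∧ k ≠ v ∧ a < k ∧ k < b) →
      ∃ S : Finset ℕ, S ⊆ V ∧ (∀ i ∈ S, ∀ j ∈ S, (i, j) ∉ C) ∧
        V.card + 1 ≤ 2 * S.card := by
    intro v hv hvu w hw hwu hwv hgood
    have hc1 := Finset.card_erase_add_one hu
    have hc2 := Finset.card_erase_add_one (Finset.mem_erase.2 ⟨hvu, hv⟩)
    obtain ⟨S, hS, hind, hcard⟩ := ih ((V.erase u).erase v).card (by omega) _ rfl
      ⟨w, by simp [*]⟩ (by
        intro a ha b hb h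
        simp only [Finset.mem_erase] at ha hb
        refine ⟨(hC a ha.2.2 b hb.2.2 h).1, ?_⟩
        obtain ⟨k, h1, h2, h3, h4⟩ :=
          hgood a ha.2.2 b hb.2.2 ha.2.1 ha.1 hb.2.1 hb.1 h
        exact ⟨k, by simp [*], h4⟩)
    have hSV : ∀ x ∈ S, x ∈ V ∧ x ≠ u := by
      intro x hx
      have := hS hx
      simp only [Finset.mem_erase] at this
      exact ⟨this.2.2, this.2.1⟩
    have hun : u ∉ S := fun h => (hSV u h).2 rfl
    have hsub : insert u S ⊆ V := by
      intro x hx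
      rcases Finset.mem_insert.1 hx with rfl | hx
      · exact hu
      · exact (hSV x hx).1
    refine ⟨insert u S, hsub, ?_, ?_⟩
    · intro x hx y hy
      have hxV := hsub hx
      have hyV := hsub hy
      rcases Finset.mem_insert.1 hx with rfl | hx
      · exact iso1 _ hiu huj hu y hyV
      · rcases Finset.mem_insert.1 hy with rfl | hy
        · exact iso2 _ hiu huj hu x hxV
        · exact hind x hx y hy
    · rw [Finset.card_insert_of_notMem hun]
      omega
  -- a chord of V over a point of [i,j] not ending inside spans it
  by_cases hA : ∃ a, a < i ∧ (a, j) ∈ C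
  · obtain ⟨a0, ha0, ha0C⟩ := hA
    refine fin j hj (by omega) i hi (by omega) (by omega) ?_
    intro a ha b hb hau haj hbu hbj h
    obtain ⟨hab, k, hk, h1, h2⟩ := hC a ha b hb h
    by_cases hk' : k ≠ u ∧ k ≠ j
    · exact ⟨k, hk, hk'.1, hk'.2, h1, h2⟩
    have ha' : ¬ (i < a ∧ a < j) := fun hh => iso1 a hh.1 hh.2 ha b hb h
    have hb' : ¬ (i < b ∧ b < j) := fun hh => iso2 b hh.1 hh.2 hb a ha h
    have hai : a ≠ i := by
      rintro rfl
      exact nc _ _ _ _ ha0C h ha0 hlt (by omega)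
    exact ⟨i, hi, by omega, by omega, by omega, by omega⟩
  · refine fin i hi (by omega) j hj (by omega) (by omega) ?_
    intro a ha b hb hau hai hbu hbi h
    obtain ⟨hab, k, hk, h1, h2⟩ := hC a ha b hb h
    by_cases hk' : k ≠ u ∧ k ≠ i
    · exact ⟨k, hk, hk'.1, hk'.2, h1, h2⟩
    have ha' : ¬ (i < a ∧ a < j) := fun hh => iso1 a hh.1 hh.2 ha b hb h
    have hb' : ¬ (i < b ∧ b < j) := fun hh => iso2 b hh.1 hh.2 hb a ha h
    have hbj : b ≠ j := by
      rintro rfl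
      exact hA ⟨a, by omega, h⟩
    exact ⟨j, hj, by omega, by omega, by omega, by omega⟩

/-- Let `l ≥ 1` and let `C` be a noncrossing set of chords of the path `1, 2, …, l`.
Then the graph on `{1, …, l}` with edge set `C` has an independent set of size at
least `(l+1)/2`. -/
theorem noncrossing_chords_independent_set (l : ℕ) (hl : 1 ≤ l)
    (C : Finset (ℕ × ℕ))
    (hC : ∀ c ∈ C, IsChord l c)
    (hnc : ∀ c ∈ C, ∀ d ∈ C, c ≠ d → ¬ ChordsCross c d) :
    ∃ S : Finset ℕ, S ⊆ Finset.Icc 1 l ∧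
      (∀ i ∈ S, ∀ j ∈ S, (i, j) ∉ C) ∧
      ((l : ℝ) + 1) / 2 ≤ (S.card : ℝ) := by
  obtain ⟨S, hS, hind, hcard⟩ := nc_aux C hnc _ (Finset.Icc 1 l) rfl
    ⟨1, by simp [hl]⟩ (by
      intro a ha b hb h
      obtain ⟨h1, h2, h3⟩ := hC _ h
      simp only at h1 h2 h3
      exact ⟨by omega, a + 1, by simp; omega, by omega, by omega⟩)
  refine ⟨S, hS, hind, ?_⟩
  rw [Nat.card_Icc, Nat.add_sub_cancel] at hcard
  have : ((l : ℝ) + 1) ≤ 2 * S.card := by exact_mod_cast hcard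
  linarith
end
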